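/- arXiv:1406.0107 — 2 statements merged into one kernel-verified Lean document; each statement's English description precedes it below -/
import Mathlib

section
/- Let q be an odd prime power, d ≥ 2, and E ⊆ 𝔽_q^d with |E| > (2k/ln 2)·q^{(d+1)/2}. Suppose t_1, …, t_k ∈ 𝔽_q are all nonzero and set t⃗ = (t_1,…,t_k). Then C_k(t⃗) = |E|^{k+1}/q^k + D_k(t⃗) where |D_k(t⃗)| ≤ (2k/ln 2)·q^{(d+1)/2}·|E|^k/q^k. -/
/-- The chain count `C_k(t⃗)`: the number of `(k+1)`-tuples `(x^1, …, x^{k+1})` of points of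
`E ⊆ 𝔽_q^d` with `‖x^i − x^{i+1}‖ = t_i` for `1 ≤ i ≤ k`, where `‖x‖ = x_1^2 + ⋯ + x_d^2`. -/
def chainCountVec {F : Type} [Field F] [Fintype F] [DecidableEq F] {d k : ℕ}
    (E : Finset (Fin d → F)) (t : Fin k → F) : ℕ :=
  (Finset.univ.filter (fun x : Fin (k + 1) → (Fin d → F) =>
    (∀ i, x i ∈ E) ∧
      ∀ i : Fin k, ∑ j, (x i.castSucc j - x i.succ j) ^ 2 = t i)).card

section PartA

open Polynomial in
theorem KL_stepanov_core {L : Type} [Field L] [Fintype L] (p e : ℕ) [Fact p.Prime] [CharP L p]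
    (q r R : ℕ) (hR : R = q * r) (hRp : R = p ^ e) (hr : 2 ≤ r) (hq : 1 ≤ q)
    (hcard : Fintype.card L = R ^ 2) (W : L[X]) (hW : W.natDegree = 2 * r) (u : L)
    (Z : Finset L)
    (hZ : ∀ x ∈ Z, x ≠ 0 ∧ (W.eval x / x ^ r) ^ R = u - W.eval x / x ^ r) :
    Z.card ≤ r * R + 2 * R := by
  classical
  have hW0 : W ≠ 0 := by rintro rfl; simp at hW; omega
  let ι := Fin (r + 1) × Fin r × Fin q
  let N := (r + 1) + (r - 1) * R + 2 * r * (q - 1)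
  let tH : ι → L[X] := fun i =>
    X ^ ((i.1 : ℕ) + i.2.1 * R) * (C u * X ^ r - W) ^ (i.2.2 : ℕ) * X ^ (r * (q - 1 - i.2.2))
  let tG : ι → L[X] := fun i =>
    X ^ ((i.1 : ℕ) * R + i.2.1) * W ^ (i.2.2 : ℕ) * X ^ (r * (q - 1 - i.2.2))
  have hRpos : 2 ≤ R := by rw [hR]; nlinarith
  have hVdeg : (C u * X ^ r - W).natDegree ≤ 2 * r := by
    refine (natDegree_sub_le _ _).trans (max_le ?_ hW.le)
    refine (natDegree_C_mul_X_pow_le _ _).trans (by omega)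
  have htHdeg : ∀ i, (tH i).natDegree < N := by
    intro i
    obtain ⟨⟨i, hi⟩, ⟨k, hk⟩, ⟨j, hj⟩⟩ := i
    simp only [tH]
    have h1 : ((C u * X ^ r - W) ^ j).natDegree ≤ j * (2 * r) :=
      natDegree_pow_le.trans (Nat.mul_le_mul_left _ hVdeg)
    have h2 := natDegree_mul_le (p := X ^ (i + k * R) * (C u * X ^ r - W) ^ j)
      (q := X ^ (r * (q - 1 - j)))
    have h3 := natDegree_mul_le (p := (X : L[X]) ^ (i + k * R)) (q := (C u * X ^ r - W) ^ j)
    rw [natDegree_X_pow] at h2 h3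
    have h4 : k * R ≤ (r - 1) * R := Nat.mul_le_mul_right _ (by omega)
    have h5 : j * (2 * r) + r * (q - 1 - j) ≤ 2 * r * (q - 1) := by
      obtain ⟨s, rfl⟩ : ∃ s, q = s + j + 1 := ⟨q - 1 - j, by omega⟩
      have : s + j + 1 - 1 - j = s := by omega
      rw [this]
      have : s + j + 1 - 1 = s + j := by omega
      rw [this]; nlinarith
    simp only [N]
    omega
  let Φ : (ι → L) →ₗ[L] (Fin N → L) :=
    { toFun := fun c n => ∑ i, c i * (tH i).coeff n
      map_add' := by intro c d; funext n; simp [add_mul, Finset.sum_add_distrib]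
      map_smul' := by intro c d; funext n; simp [Finset.mul_sum, mul_assoc] }
  have hlt : Module.finrank L (Fin N → L) < Module.finrank L (ι → L) := by
    simp only [Module.finrank_fintype_fun_eq_card, Fintype.card_fin, ι, Fintype.card_prod, N]
    obtain ⟨s, rfl⟩ : ∃ s, q = s + 1 := ⟨q - 1, by omega⟩
    obtain ⟨r', rfl⟩ : ∃ s, r = s + 2 := ⟨r - 2, by omega⟩
    have e1 : r' + 2 - 1 = r' + 1 := by omega
    have e2 : s + 1 - 1 = s := by omega
    rw [e1, e2, hR]
    nlinarith
  have hker := LinearMap.ker_ne_bot_of_finrank_lt (f := Φ) hlt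
  obtain ⟨c, hc, hc0⟩ := Submodule.exists_mem_ne_zero_of_ne_bot hker
  have hH : ∑ i, C (c i) * tH i = 0 := by
    ext n
    rw [finsetSum_coeff]
    simp only [coeff_C_mul, coeff_zero]
    by_cases hn : n < N
    · have := congrFun (LinearMap.mem_ker.1 hc) ⟨n, hn⟩
      simpa [Φ] using this
    · refine Finset.sum_eq_zero fun i _ => ?_
      rw [coeff_eq_zero_of_natDegree_lt (lt_of_lt_of_le (htHdeg i) (not_lt.1 hn)), mul_zero]
  have htGdeg : ∀ i, tG i ≠ 0 ∧ (tG i).natDegree = i.1 * R + i.2.1 + r * i.2.2 + r * (q - 1) := by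
    intro i
    obtain ⟨⟨i, hi⟩, ⟨k, hk⟩, ⟨j, hj⟩⟩ := i
    simp only [tG]
    refine ⟨by simp [hW0], ?_⟩
    rw [natDegree_mul (by simp [hW0]) (by simp), natDegree_mul (by simp) (by simp [hW0]),
      natDegree_X_pow, natDegree_X_pow, natDegree_pow, hW]
    obtain ⟨s, rfl⟩ : ∃ s, q = s + j + 1 := ⟨q - 1 - j, by omega⟩
    have : s + j + 1 - 1 - j = s := by omega
    rw [this]
    have : s + j + 1 - 1 = s + j := by omega
    rw [this]; ring
  have hinj : ∀ i i' : ι, (tG i).natDegree = (tG i').natDegree → i = i' := by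
    intro i i' h
    rw [(htGdeg i).2, (htGdeg i').2] at h
    obtain ⟨⟨i, hi⟩, ⟨k, hk⟩, ⟨j, hj⟩⟩ := i
    obtain ⟨⟨i', hi'⟩, ⟨k', hk'⟩, ⟨j', hj'⟩⟩ := i'
    simp only at h
    rw [hR] at h
    have h1 : k + r * (j + q * i) = k' + r * (j' + q * i') := by nlinarith
    have hk2 : k = k' := by
      have := congrArg (· % r) h1
      simpa [Nat.add_mul_mod_self_left, Nat.mod_eq_of_lt hk, Nat.mod_eq_of_lt hk'] using this
    subst hk2
    have h2 : j + q * i = j' + q * i' := by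
      have : r * (j + q * i) = r * (j' + q * i') := by omega
      exact Nat.eq_of_mul_eq_mul_left (by omega) this
    have hj2 : j = j' := by
      have := congrArg (· % q) h2
      simpa [Nat.add_mul_mod_self_left, Nat.mod_eq_of_lt hj, Nat.mod_eq_of_lt hj'] using this
    subst hj2
    have : i = i' := Nat.eq_of_mul_eq_mul_left (by omega : 0 < q) (by omega)
    subst this
    rfl
  let G : L[X] := ∑ i, C (c i ^ R) * tG i
  have hG0 : G ≠ 0 := by
    have hd : degree G = Finset.univ.sup fun i => degree (C (c i ^ R) * tG i) := by
      apply degree_sum_eq_of_disjoint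
      rintro i ⟨-, hi⟩ i' ⟨-, hi'⟩ hne
      simp only [Function.onFun, Function.comp, ne_eq]
      intro h
      apply hne
      apply hinj
      have h1 : c i ^ R ≠ 0 := by rintro h; simp [h] at hi
      have h2 : c i' ^ R ≠ 0 := by rintro h; simp [h] at hi'
      rw [degree_C_mul h1, degree_C_mul h2] at h
      exact natDegree_eq_of_degree_eq h
    obtain ⟨i, hi⟩ := Function.ne_iff.1 hc0
    intro h
    rw [h, degree_zero] at hd
    have h1 : degree (C (c i ^ R) * tG i) ≤ ⊥ := by
      rw [hd]; exact Finset.le_sup (f := fun i => degree (C (c i ^ R) * tG i)) (Finset.mem_univ i)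
    rw [le_bot_iff, degree_eq_bot] at h1
    simp only [mul_eq_zero, C_eq_zero, (htGdeg i).1, or_false] at h1
    exact hi (by simpa using (pow_eq_zero_iff (by omega)).1 h1)
  have hGdeg : G.natDegree ≤ r * R + 2 * R := by
    refine natDegree_sum_le_of_forall_le _ _ fun i _ => ?_
    refine (natDegree_C_mul_le _ _).trans ?_
    rw [(htGdeg i).2]
    obtain ⟨⟨i, hi⟩, ⟨k, hk⟩, ⟨j, hj⟩⟩ := i
    simp only
    have h1 : i * R ≤ r * R := Nat.mul_le_mul_right _ (by omega)
    have h2 : r * j ≤ r * (q - 1) := Nat.mul_le_mul_left _ (by omega)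
    have h3 : r * (q - 1) + r = R := by
      obtain ⟨s, rfl⟩ : ∃ s, q = s + 1 := ⟨q - 1, by omega⟩
      rw [hR]; simp; ring
    omega
  have hroot : ∀ x ∈ Z, G.eval x = 0 := by
    intro x hx
    obtain ⟨hx0, hxW⟩ := hZ x hx
    set w := W.eval x / x ^ r with hw
    have hWw : W.eval x = x ^ r * w := by rw [hw]; field_simp
    have hxQ : ∀ y : L, (y ^ R) ^ R = y := by
      intro y
      rw [← pow_mul, ← sq, ← hcard, FiniteField.pow_card]
    have hHx : ∑ i : ι, c i * (x ^ ((i.1 : ℕ) + i.2.1 * R) * (u - w) ^ (i.2.2 : ℕ)) = 0 := by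
      have h := congrArg (eval x) hH
      simp only [eval_finsetSum, eval_mul, eval_C, eval_zero, tH, eval_pow, eval_X, eval_sub,
        hWw] at h
      have h' : x ^ (r * (q - 1)) *
          ∑ i : ι, c i * (x ^ ((i.1 : ℕ) + i.2.1 * R) * (u - w) ^ (i.2.2 : ℕ)) = 0 := by
        rw [← h, Finset.mul_sum]
        refine Finset.sum_congr rfl fun i _ => ?_
        have : r * (q - 1) = r * i.2.2 + r * (q - 1 - i.2.2) := by
          rw [← mul_add]; congr 1; have := i.2.2.2; omega
        rw [this, pow_add, pow_mul x r (i.2.2 : ℕ),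
          show u * x ^ r - x ^ r * w = x ^ r * (u - w) by ring, mul_pow]
        ring
      exact (mul_eq_zero.1 h').resolve_left (pow_ne_zero _ hx0)
    have hGx : G.eval x = x ^ (r * (q - 1)) *
        ∑ i : ι, c i ^ R * (x ^ ((i.1 : ℕ) * R + i.2.1) * w ^ (i.2.2 : ℕ)) := by
      simp only [G, eval_finsetSum, eval_mul, eval_C, tG, eval_pow, eval_X, hWw]
      rw [Finset.mul_sum]
      refine Finset.sum_congr rfl fun i _ => ?_
      have : r * (q - 1) = r * i.2.2 + r * (q - 1 - i.2.2) := by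
        rw [← mul_add]; congr 1; have := i.2.2.2; omega
      rw [this, pow_add x (r * (i.2.2 : ℕ)), pow_mul x r (i.2.2 : ℕ), mul_pow]
      ring
    have hs : (∑ i : ι, c i ^ R * (x ^ ((i.1 : ℕ) * R + i.2.1) * w ^ (i.2.2 : ℕ))) ^ R = 0 := by
      rw [hRp, sum_pow_char_pow, ← hRp, ← hHx]
      refine Finset.sum_congr rfl fun i _ => ?_
      have h1 : (x ^ ((i.1 : ℕ) * R + i.2.1)) ^ R = x ^ ((i.1 : ℕ) + i.2.1 * R) := by
        rw [pow_add, mul_pow, pow_mul, hxQ, pow_add, pow_mul]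
      rw [mul_pow, mul_pow, hxQ, pow_right_comm w, hxW, h1]
    rw [hGx, (pow_eq_zero_iff (by omega)).1 hs, mul_zero]
  calc Z.card ≤ G.roots.toFinset.card := Finset.card_le_card fun x hx => by
          simp [hG0, hroot x hx]
    _ ≤ G.roots.card := Multiset.toFinset_card_le _
    _ ≤ G.natDegree := card_roots' _
    _ ≤ _ := hGdeg

end PartA

section PartB

open Polynomial in
theorem KL_stepanov {F L : Type} [Field F] [Fintype F] [Field L] [Fintype L] [Algebra F L]
    (q : ℕ) (hq : Fintype.card F = q) (m : ℕ) (hm : 2 ≤ m)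
    (hfin : Module.finrank F L = 2 * m) (a b u : F) (ha : a ≠ 0) (Z : Finset L)
    (hZ : ∀ x ∈ Z, x ≠ 0 ∧
      Algebra.trace F L (algebraMap F L a * x + algebraMap F L b * x⁻¹) = u) :
    Z.card ≤ q ^ (2 * m - 1) + 2 * q ^ m := by
  classical
  obtain ⟨m', rfl⟩ : ∃ s, m = s + 1 := ⟨m - 1, by omega⟩
  obtain ⟨p, hp⟩ := CharP.exists F
  obtain ⟨n, hpp, hpn⟩ := FiniteField.card F p
  have : Fact p.Prime := ⟨hpp⟩
  have : CharP L p := charP_of_injective_algebraMap (algebraMap F L).injective p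
  have hqp : q = p ^ (n : ℕ) := hq ▸ hpn
  have hq2 : 2 ≤ q := by rw [← hq]; exact Fintype.one_lt_card
  have hcardL : Fintype.card L = (q ^ (m' + 1)) ^ 2 := by
    rw [Module.card_eq_pow_finrank (K := F), hfin, hq, ← pow_mul]; ring_nf
  set r := q ^ m' with hr
  have hrq : ∀ i, i < m' → q ^ i < r := fun i hi => Nat.pow_lt_pow_right (by omega) hi
  let A := algebraMap F L a
  let B := algebraMap F L b
  have hA : A ≠ 0 := by simpa [A] using ha
  have hfix : ∀ (c : F) (i : ℕ), (algebraMap F L c) ^ q ^ i = algebraMap F L c := by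
    intro c i
    rw [← map_pow, ← hq, FiniteField.pow_card_pow]
  let W : L[X] := ∑ i ∈ Finset.range (m' + 1), (C A * X ^ (r + q ^ i) + C B * X ^ (r - q ^ i))
  have hWdeg : W.natDegree = 2 * r := by
    apply natDegree_eq_of_le_of_coeff_ne_zero
    · refine natDegree_sum_le_of_forall_le _ _ fun i hi => ?_
      have h1 : q ^ i ≤ r := Nat.pow_le_pow_right (by omega) (by simp at hi; omega)
      refine (natDegree_add_le _ _).trans (max_le ?_ ?_)
      · exact (natDegree_C_mul_X_pow_le _ _).trans (by omega)
      · exact (natDegree_C_mul_X_pow_le _ _).trans (by omega)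
    · have h0 : 0 < r := by positivity
      have : W.coeff (2 * r) = A := by
        simp only [W, finsetSum_coeff]
        rw [Finset.sum_range_succ, Finset.sum_eq_zero, zero_add]
        · simp only [coeff_add, coeff_C_mul, coeff_X_pow]
          rw [if_pos (by omega), if_neg (by omega)]; simp
        · intro i hi
          have := hrq i (by simpa using hi)
          simp only [coeff_add, coeff_C_mul, coeff_X_pow]
          rw [if_neg (by omega), if_neg (by omega)]; simp
      rw [this]; exact hA
  have key := KL_stepanov_core p (n * (m' + 1)) q r (q ^ (m' + 1)) (by rw [hr, pow_succ, mul_comm])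
    (by rw [pow_mul, ← hqp]) ?_ (by omega) hcardL W hWdeg (algebraMap F L u) Z ?_
  · refine key.trans (le_of_eq ?_)
    congr 1
    rw [hr, ← pow_add]; congr 1; omega
  · calc 2 ≤ q ^ 1 := by simpa using hq2
      _ ≤ r := Nat.pow_le_pow_right (by omega) (by omega)
  · intro x hx
    obtain ⟨hx0, htr⟩ := hZ x hx
    refine ⟨hx0, ?_⟩
    have hpow : ∀ i, (A * x + B * x⁻¹) ^ q ^ i = A * x ^ q ^ i + B * (x ^ q ^ i)⁻¹ := by
      intro i
      have : q ^ i = p ^ (n * i) := by rw [pow_mul, ← hqp]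
      rw [this, add_pow_char_pow, ← this, mul_pow, mul_pow, hfix, hfix, inv_pow]
    have hw : W.eval x / x ^ r = ∑ i ∈ Finset.range (m' + 1), (A * x + B * x⁻¹) ^ q ^ i := by
      simp only [W, eval_finsetSum, Finset.sum_div]
      refine Finset.sum_congr rfl fun i hi => ?_
      have h1 : q ^ i ≤ r := Nat.pow_le_pow_right (by omega) (by simp at hi; omega)
      rw [hpow]
      simp only [eval_add, eval_mul, eval_C, eval_pow, eval_X]
      rw [pow_sub₀ x hx0 h1, pow_add]
      field_simp
    have hR : q ^ (m' + 1) = p ^ (n * (m' + 1)) := by rw [pow_mul, ← hqp]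
    have hwR : (W.eval x / x ^ r) ^ q ^ (m' + 1) =
        ∑ i ∈ Finset.range (m' + 1), (A * x + B * x⁻¹) ^ q ^ (m' + 1 + i) := by
      rw [hw, hR, sum_pow_char_pow, ← hR]
      refine Finset.sum_congr rfl fun i hi => ?_
      rw [← pow_mul, ← pow_add, add_comm i]
    have htr2 := FiniteField.algebraMap_trace_eq_sum_pow F L (A * x + B * x⁻¹)
    rw [htr, hfin, two_mul, Finset.sum_range_add, Nat.card_eq_fintype_card, hq] at htr2
    rw [hwR, htr2, hw]; ring

end PartB

section PartC

theorem KL_ext_bound {F L : Type} [Field F] [Fintype F] [DecidableEq F] [Field L] [Fintype L] [Algebra F L]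
    [DecidableEq L]
    (q : ℕ) (hq : Fintype.card F = q) (m : ℕ) (hm : 2 ≤ m)
    (hfin : Module.finrank F L = 2 * m) (a b : F) (ha : a ≠ 0) (ψ : AddChar F ℂ) (hψ : ψ ≠ 1) :
    ‖∑ x : L, if x = 0 then (0 : ℂ) else
      ψ (Algebra.trace F L (algebraMap F L a * x + algebraMap F L b * x⁻¹))‖
      ≤ (2 * q + 1) * (q : ℝ) ^ m := by
  classical
  have hq2 : 2 ≤ q := by rw [← hq]; exact Fintype.one_lt_card
  let T : L → F := fun x => Algebra.trace F L (algebraMap F L a * x + algebraMap F L b * x⁻¹)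
  let U : Finset L := Finset.univ.filter (fun x => x ≠ 0)
  let Z : F → Finset L := fun u => U.filter (fun x => T x = u)
  have hZ : ∀ u, ((Z u).card : ℝ) ≤ (q : ℝ) ^ (2 * m - 1) + 2 * (q : ℝ) ^ m := by
    intro u
    have := KL_stepanov q hq m hm hfin a b u ha (Z u) (by
      intro x hx
      simp only [Z, U, Finset.mem_filter, Finset.mem_univ, true_and] at hx
      exact hx)
    exact_mod_cast this
  have hU : (U.card : ℝ) = (q : ℝ) ^ (2 * m) - 1 := by
    have h1 : U.card = Fintype.card L - 1 := by
      simp only [U]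
      rw [Finset.filter_ne', Finset.card_erase_of_mem (Finset.mem_univ _), Finset.card_univ]
    have h2 : Fintype.card L = q ^ (2 * m) := by
      rw [Module.card_eq_pow_finrank (K := F), hfin, hq]
    rw [h1, h2, Nat.cast_sub (Nat.one_le_pow _ _ (by omega))]
    push_cast; rfl
  have hsumZ : ∑ u, ((Z u).card : ℝ) = U.card := by
    rw [Finset.card_eq_sum_card_fiberwise (f := T) (t := Finset.univ) (fun x _ => by simp)]
    push_cast; rfl
  set c : ℝ := (q : ℝ) ^ (2 * m - 1) + 2 * (q : ℝ) ^ m with hc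
  have h1 : (∑ x : L, if x = 0 then (0 : ℂ) else
      ψ (Algebra.trace F L (algebraMap F L a * x + algebraMap F L b * x⁻¹))) =
      ∑ u, ψ u * (((Z u).card : ℝ) - c : ℝ) := by
    have h2 : ∑ u, ψ u * (((Z u).card : ℝ) - c : ℝ) = ∑ u, ψ u * ((Z u).card : ℂ) := by
      push_cast
      simp only [mul_sub, Finset.sum_sub_distrib]
      rw [← Finset.sum_mul, AddChar.sum_eq_zero_of_ne_one hψ, zero_mul, sub_zero]
    rw [h2]
    have h3 : (∑ x : L, if x = 0 then (0 : ℂ) else ψ (T x)) = ∑ x ∈ U, ψ (T x) := by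
      rw [Finset.sum_filter]
      refine Finset.sum_congr rfl fun x _ => ?_
      by_cases h : x = 0 <;> simp [h]
    change (∑ x : L, if x = 0 then (0 : ℂ) else ψ (T x)) = _
    rw [h3, ← Finset.sum_fiberwise U T]
    refine Finset.sum_congr rfl fun u _ => ?_
    rw [Finset.sum_congr rfl (g := fun _ => ψ u)]
    · simp [Z, mul_comm]
    · intro x hx
      rw [(Finset.mem_filter.1 hx).2]
  rw [h1]
  calc _ ≤ ∑ u, ‖ψ u * (((Z u).card : ℝ) - c : ℝ)‖ := norm_sum_le _ _
    _ = ∑ u, (c - (Z u).card) := by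
      refine Finset.sum_congr rfl fun u _ => ?_
      rw [norm_mul, AddChar.norm_apply, one_mul, Complex.norm_real, Real.norm_eq_abs, abs_sub_comm,
        abs_of_nonneg (sub_nonneg.2 (hZ u))]
    _ = q * c - ((q : ℝ) ^ (2 * m) - 1) := by
      rw [Finset.sum_sub_distrib, hsumZ, hU]; simp [hq]
    _ = 2 * q * (q : ℝ) ^ m + 1 := by
      have : (q : ℝ) ^ (2 * m) = q * (q : ℝ) ^ (2 * m - 1) := by
        rw [← pow_succ']; congr 1; omega
      rw [this, hc]; ring
    _ ≤ _ := by
      have : (1 : ℝ) ≤ (q : ℝ) ^ m := one_le_pow₀ (by exact_mod_cast (by omega : 1 ≤ q))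
      nlinarith

end PartC

section PartD

open Polynomial

noncomputable def KL_poly {F : Type} [Field F] (n : ℕ) (c : Fin n → F) : F[X] :=
  X ^ n + ∑ i : Fin n, C (c i) * X ^ (i : ℕ)

theorem KL_poly_coeff {F : Type} [Field F] (n : ℕ) (c : Fin n → F) (i : Fin n) :
    (KL_poly n c).coeff i = c i := by
  unfold KL_poly
  rw [coeff_add, finsetSum_coeff, coeff_X_pow, if_neg (by have := i.2; omega), zero_add,
    Finset.sum_eq_single i]
  · simp
  · intro j _ hj
    simp only [coeff_C_mul, coeff_X_pow]
    rw [if_neg (by intro h; exact hj (Fin.ext h.symm)), mul_zero]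
  · simp

theorem KL_poly_low {F : Type} [Field F] (n : ℕ) (c : Fin n → F) :
    (∑ i : Fin n, C (c i) * X ^ (i : ℕ)).degree < (n : WithBot ℕ) := by
  refine (degree_sum_le _ _).trans_lt ?_
  rw [Finset.sup_lt_iff (by exact WithBot.bot_lt_coe n)]
  intro i _
  refine (degree_C_mul_X_pow_le _ _).trans_lt ?_
  exact_mod_cast i.2

theorem KL_poly_monic {F : Type} [Field F] (n : ℕ) (c : Fin n → F) : (KL_poly n c).Monic :=
  monic_X_pow_add (KL_poly_low n c)

theorem KL_poly_natDegree {F : Type} [Field F] (n : ℕ) (c : Fin n → F) :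
    (KL_poly n c).natDegree = n := by
  unfold KL_poly
  rw [natDegree_add_eq_left_of_degree_lt]
  · simp
  · rw [degree_X_pow]; exact KL_poly_low n c

theorem KL_poly_inj {F : Type} [Field F] (n : ℕ) :
    Function.Injective (KL_poly n : (Fin n → F) → F[X]) := by
  intro c d h
  funext i
  rw [← KL_poly_coeff n c i, h, KL_poly_coeff]

open Classical in
noncomputable def KL_mon (F : Type) [Field F] [Fintype F] (n : ℕ) : Finset F[X] :=
  Finset.univ.image (KL_poly n : (Fin n → F) → F[X])

theorem KL_mem_mon {F : Type} [Field F] [Fintype F] (n : ℕ) (h : F[X]) :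
    h ∈ KL_mon F n ↔ h.Monic ∧ h.natDegree = n := by
  classical
  unfold KL_mon
  rw [Finset.mem_image]
  constructor
  · rintro ⟨c, -, rfl⟩
    exact ⟨KL_poly_monic n c, KL_poly_natDegree n c⟩
  · rintro ⟨hm, hd⟩
    refine ⟨fun i => h.coeff i, Finset.mem_univ _, ?_⟩
    unfold KL_poly
    conv_rhs => rw [hm.as_sum, hd]
    rw [Finset.sum_range]

theorem KL_sum_mon {F : Type} [Field F] [Fintype F] (n : ℕ) (g : F[X] → ℂ) :
    ∑ h ∈ KL_mon F n, g h = ∑ c : Fin n → F, g (KL_poly n c) := by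
  classical
  unfold KL_mon
  rw [Finset.sum_image]
  intro x _ y _ h
  exact KL_poly_inj n h

open Classical in
noncomputable def KL_irr (F : Type) [Field F] [Fintype F] (n : ℕ) : Finset F[X] :=
  ((Finset.range (n + 1)).biUnion (KL_mon F)).filter Irreducible

theorem KL_mem_irr {F : Type} [Field F] [Fintype F] (n : ℕ) (h : F[X]) :
    h ∈ KL_irr F n ↔ h.Monic ∧ h.natDegree ≤ n ∧ Irreducible h := by
  classical
  unfold KL_irr
  simp only [Finset.mem_filter, Finset.mem_biUnion, Finset.mem_range, KL_mem_mon]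
  constructor
  · rintro ⟨⟨d, hd, hm, hh⟩, hi⟩
    exact ⟨hm, by omega, hi⟩
  · rintro ⟨hm, hd, hi⟩
    exact ⟨⟨h.natDegree, by omega, hm, rfl⟩, hi⟩

open Classical in
theorem KL_mangoldt {F : Type} [Field F] [Fintype F] (n : ℕ) (h : F[X]) (hh : h ∈ KL_mon F n) :
    ∑ j ∈ Finset.Icc 1 n, ∑ P ∈ (KL_irr F n).filter (fun P => P.natDegree ∣ j),
      (if P ^ (j / P.natDegree) ∣ h then P.natDegree else 0) = n := by
  obtain ⟨hm, hd⟩ := (KL_mem_mon n h).1 hh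
  have hh0 : h ≠ 0 := hm.ne_zero
  have hcount : ∀ P ∈ KL_irr F n, ∀ k : ℕ,
      P ^ k ∣ h ↔ k ≤ (UniqueFactorizationMonoid.normalizedFactors h).count P := by
    intro P hP k
    obtain ⟨hPm, hPd, hPi⟩ := (KL_mem_irr n P).1 hP
    rw [pow_dvd_iff_le_emultiplicity,
      UniqueFactorizationMonoid.emultiplicity_eq_count_normalizedFactors hPi hh0,
      hPm.normalize_eq_self]
    exact_mod_cast Iff.rfl
  simp only [Finset.sum_filter]
  rw [Finset.sum_comm]
  have h1 : ∀ P ∈ KL_irr F n, (∑ j ∈ Finset.Icc 1 n,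
      if P.natDegree ∣ j then (if P ^ (j / P.natDegree) ∣ h then P.natDegree else 0) else 0) =
      (UniqueFactorizationMonoid.normalizedFactors h).count P * P.natDegree := by
    intro P hP
    obtain ⟨hPm, hPd, hPi⟩ := (KL_mem_irr n P).1 hP
    have hpos : 0 < P.natDegree := hPi.natDegree_pos
    simp only [← ite_and]
    rw [← Finset.sum_filter, Finset.sum_const, smul_eq_mul]
    congr 1
    set t := (UniqueFactorizationMonoid.normalizedFactors h).count P with ht
    have : (Finset.Icc 1 n).filter (fun j => P.natDegree ∣ j ∧ P ^ (j / P.natDegree) ∣ h) =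
        (Finset.Icc 1 t).image (fun k => P.natDegree * k) := by
      ext j
      simp only [Finset.mem_filter, Finset.mem_Icc, Finset.mem_image]
      constructor
      · rintro ⟨⟨h1, h2⟩, ⟨k, rfl⟩, h3⟩
        rw [Nat.mul_div_cancel_left _ hpos, hcount P hP] at h3
        refine ⟨k, ⟨?_, h3⟩, rfl⟩
        rcases Nat.eq_zero_or_pos k with rfl | h
        · simp at h1
        · exact h
      · rintro ⟨k, ⟨h1, h2⟩, rfl⟩
        have h3 := (hcount P hP k).2 h2
        refine ⟨⟨Nat.mul_pos hpos h1, ?_⟩, dvd_mul_right _ _, ?_⟩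
        · have := natDegree_le_of_dvd h3 hh0
          rw [natDegree_pow, hd, mul_comm] at this
          exact this
        · rwa [Nat.mul_div_cancel_left _ hpos]
    rw [this, Finset.card_image_of_injective _ (fun x y hxy => Nat.eq_of_mul_eq_mul_left hpos hxy)]
    simp
  rw [Finset.sum_congr rfl h1]
  have hmonf : ∀ P ∈ UniqueFactorizationMonoid.normalizedFactors h, P.Monic := by
    intro P hP
    have h1 := UniqueFactorizationMonoid.normalize_normalized_factor P hP
    have h2 := (UniqueFactorizationMonoid.irreducible_of_normalized_factor P hP).ne_zero
    rw [← h1]; exact monic_normalize h2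
  have hprod : (UniqueFactorizationMonoid.normalizedFactors h).prod = h := by
    have h1 := UniqueFactorizationMonoid.prod_normalizedFactors hh0
    refine eq_of_monic_of_associated ?_ hm h1
    have h2 := monic_multiset_prod_of_monic _ (fun x => x) hmonf
    simpa using h2
  have hdeg : ((UniqueFactorizationMonoid.normalizedFactors h).map natDegree).sum = n := by
    rw [← natDegree_multiset_prod_of_monic _ hmonf, hprod, hd]
  refine Eq.trans ?_ hdeg
  rw [Finset.sum_multiset_map_count]
  symm
  simp only [smul_eq_mul]
  apply Finset.sum_subset
  · intro P hP
    rw [Multiset.mem_toFinset] at hP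
    rw [KL_mem_irr]
    refine ⟨hmonf P hP, ?_, UniqueFactorizationMonoid.irreducible_of_normalized_factor P hP⟩
    rw [← hd]
    exact natDegree_le_of_dvd (UniqueFactorizationMonoid.dvd_of_mem_normalizedFactors hP) hh0
  · intro P _ hP
    rw [Multiset.mem_toFinset] at hP
    rw [Multiset.count_eq_zero_of_notMem hP, zero_mul]

end PartD

section PartE

open Polynomial

open Classical in
noncomputable def KL_lam {F : Type} [Field F] (ψ : AddChar F ℂ) (a b : F) (h : F[X]) : ℂ :=
  if h.coeff 0 = 0 then 0 else ψ (-(a * h.nextCoeff + b * (h.coeff 1 / h.coeff 0)))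

theorem KL_lam_mul {F : Type} [Field F] (ψ : AddChar F ℂ) (a b : F) (g h : F[X])
    (hg : g.Monic) (hh : h.Monic) : KL_lam ψ a b (g * h) = KL_lam ψ a b g * KL_lam ψ a b h := by
  unfold KL_lam
  rw [mul_coeff_zero]
  by_cases h1 : g.coeff 0 = 0
  · simp [h1]
  by_cases h2 : h.coeff 0 = 0
  · simp [h2]
  rw [if_neg (mul_ne_zero h1 h2), if_neg h1, if_neg h2, ← AddChar.map_add_eq_mul,
    hg.nextCoeff_mul hh, mul_coeff_one]
  congr 1
  field_simp
  ring

theorem KL_lam_one {F : Type} [Field F] (ψ : AddChar F ℂ) (a b : F) :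
    KL_lam ψ a b 1 = 1 := by
  unfold KL_lam
  have : (1 : F[X]).nextCoeff = 0 := by rw [← C_1]; exact nextCoeff_C_eq_zero 1
  simp [this, coeff_one]

theorem KL_lam_pow {F : Type} [Field F] (ψ : AddChar F ℂ) (a b : F) (g : F[X])
    (hg : g.Monic) (k : ℕ) : KL_lam ψ a b (g ^ k) = KL_lam ψ a b g ^ k := by
  induction k with
  | zero => simp [KL_lam_one]
  | succ k ih => rw [pow_succ, KL_lam_mul _ _ _ _ _ (hg.pow k) hg, ih, pow_succ]

open Classical in
noncomputable def KL_Lam {F : Type} [Field F] [Fintype F] (ψ : AddChar F ℂ) (a b : F) (j : ℕ) : ℂ :=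
  ∑ P ∈ (KL_irr F j).filter (fun P => P.natDegree ∣ j),
    (P.natDegree : ℂ) * KL_lam ψ a b P ^ (j / P.natDegree)

noncomputable def KL_S {F : Type} [Field F] [Fintype F] (ψ : AddChar F ℂ) (a b : F) (n : ℕ) : ℂ :=
  ∑ h ∈ KL_mon F n, KL_lam ψ a b h

theorem KL_newton {F : Type} [Field F] [Fintype F] (ψ : AddChar F ℂ) (a b : F) (n : ℕ) :
    (n : ℂ) * KL_S ψ a b n = ∑ j ∈ Finset.Icc 1 n, KL_Lam ψ a b j * KL_S ψ a b (n - j) := by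
  classical
  have h1 : ∀ j ∈ Finset.Icc 1 n, KL_Lam ψ a b j * KL_S ψ a b (n - j) =
      ∑ h ∈ KL_mon F n, ∑ P ∈ (KL_irr F n).filter (fun P => P.natDegree ∣ j),
        KL_lam ψ a b h * ((if P ^ (j / P.natDegree) ∣ h then P.natDegree else 0 : ℕ) : ℂ) := by
    intro j hj
    rw [Finset.mem_Icc] at hj
    have hf : (KL_irr F n).filter (fun P => P.natDegree ∣ j) =
        (KL_irr F j).filter (fun P => P.natDegree ∣ j) := by
      ext P
      simp only [Finset.mem_filter, KL_mem_irr]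
      constructor
      · rintro ⟨⟨h1, h2, h3⟩, h4⟩
        exact ⟨⟨h1, Nat.le_of_dvd (by omega) h4, h3⟩, h4⟩
      · rintro ⟨⟨h1, h2, h3⟩, h4⟩
        exact ⟨⟨h1, by omega, h3⟩, h4⟩
    rw [hf, Finset.sum_comm]
    unfold KL_Lam
    rw [Finset.sum_mul]
    refine Finset.sum_congr rfl fun P hP => ?_
    simp only [Finset.mem_filter, KL_mem_irr] at hP
    obtain ⟨⟨hPm, hPd, hPi⟩, hPj⟩ := hP
    set k := j / P.natDegree with hk
    have hkj : P.natDegree * k = j := Nat.mul_div_cancel' hPj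
    have hPk : (P ^ k).Monic := hPm.pow k
    have hPkd : (P ^ k).natDegree = j := by rw [natDegree_pow, mul_comm, hkj]
    have h2 : ∑ h ∈ KL_mon F n, KL_lam ψ a b h * ((if P ^ k ∣ h then P.natDegree else 0 : ℕ) : ℂ) =
        ∑ h ∈ (KL_mon F n).filter (fun h => P ^ k ∣ h), KL_lam ψ a b h * (P.natDegree : ℂ) := by
      rw [Finset.sum_filter]
      refine Finset.sum_congr rfl fun h _ => ?_
      split_ifs <;> simp
    have h3 : (KL_mon F n).filter (fun h => P ^ k ∣ h) =
        (KL_mon F (n - j)).image (fun g => P ^ k * g) := by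
      ext h
      simp only [Finset.mem_filter, KL_mem_mon, Finset.mem_image]
      constructor
      · rintro ⟨⟨hm, hd⟩, g, rfl⟩
        have hg : g.Monic := hPk.of_mul_monic_left hm
        rw [hPk.natDegree_mul hg, hPkd] at hd
        exact ⟨g, ⟨hg, by omega⟩, rfl⟩
      · rintro ⟨g, ⟨hg, hd⟩, rfl⟩
        refine ⟨⟨hPk.mul hg, ?_⟩, dvd_mul_right _ _⟩
        rw [hPk.natDegree_mul hg, hPkd]; omega
    rw [h2, h3, Finset.sum_image (fun x _ y _ h => mul_left_cancel₀ hPk.ne_zero h)]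
    unfold KL_S
    rw [Finset.mul_sum]
    refine Finset.sum_congr rfl fun g hg => ?_
    rw [KL_lam_mul _ _ _ _ _ hPk ((KL_mem_mon _ _).1 hg).1, KL_lam_pow _ _ _ _ hPm]
    ring
  rw [Finset.sum_congr rfl h1, Finset.sum_comm]
  unfold KL_S
  rw [Finset.mul_sum]
  refine Finset.sum_congr rfl fun h hh => ?_
  simp only [← Finset.mul_sum]
  rw [mul_comm]
  congr 1
  have := KL_mangoldt n h hh
  exact_mod_cast this.symm

theorem KL_S_zero {F : Type} [Field F] [Fintype F] (ψ : AddChar F ℂ) (a b : F) :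
    KL_S ψ a b 0 = 1 := by
  unfold KL_S
  rw [KL_sum_mon]
  simp [KL_poly, KL_lam_one]

theorem KL_S_one {F : Type} [Field F] [Fintype F] [DecidableEq F] (ψ : AddChar F ℂ) (a b : F) :
    KL_S ψ a b 1 = ∑ s : F, if s = 0 then 0 else ψ (a * s + b * s⁻¹) := by
  unfold KL_S
  rw [KL_sum_mon]
  let e : F ≃ (Fin 1 → F) := (Equiv.neg F).trans (Equiv.funUnique (Fin 1) F).symm
  rw [← e.sum_comp]
  refine Finset.sum_congr rfl fun s _ => ?_
  have h0 : (KL_poly 1 (e s)).coeff 0 = -s := KL_poly_coeff 1 (e s) 0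
  have h1 : (KL_poly 1 (e s)).coeff 1 = 1 := by
    have := (KL_poly_monic 1 (e s)).coeff_natDegree
    rwa [KL_poly_natDegree] at this
  have h2 : (KL_poly 1 (e s)).nextCoeff = -s := by
    rw [nextCoeff_of_natDegree_pos (by rw [KL_poly_natDegree]; omega), KL_poly_natDegree]
    exact h0
  unfold KL_lam
  rw [h0, h1, h2]
  by_cases hs : s = 0
  · simp [hs]
  · rw [if_neg (by simpa using hs), if_neg hs]
    congr 1
    field_simp
    ring

theorem KL_S_two {F : Type} [Field F] [Fintype F] [DecidableEq F] (ψ : AddChar F ℂ)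
    (hψ : ψ.IsPrimitive) (a b : F) (ha : a ≠ 0) (hb : b ≠ 0) :
    KL_S ψ a b 2 = Fintype.card F := by
  unfold KL_S
  rw [KL_sum_mon]
  rw [← (finTwoArrowEquiv F).symm.sum_comp, Fintype.sum_prod_type]
  have h : ∀ s t : F, KL_lam ψ a b (KL_poly 2 ((finTwoArrowEquiv F).symm (s, t))) =
      if s = 0 then 0 else ψ (t * (-(a + b / s))) := by
    intro s t
    set c := (finTwoArrowEquiv F).symm (s, t) with hc
    have h0 : (KL_poly 2 c).coeff 0 = s := KL_poly_coeff 2 c 0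
    have h1 : (KL_poly 2 c).coeff 1 = t := KL_poly_coeff 2 c 1
    have h2 : (KL_poly 2 c).nextCoeff = t := by
      rw [nextCoeff_of_natDegree_pos (by rw [KL_poly_natDegree]; omega), KL_poly_natDegree]
      exact h1
    unfold KL_lam
    rw [h0, h1, h2]
    split_ifs
    · rfl
    · congr 1; ring
  simp only [h]
  rw [Finset.sum_eq_single (-b / a)]
  · have hs : -b / a ≠ 0 := by simp [ha, hb]
    simp only [if_neg hs]
    have : a + b / (-b / a) = 0 := by field_simp; ring
    rw [this]; simp
  · intro s _ hs
    by_cases hs0 : s = 0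
    · simp [hs0]
    · simp only [if_neg hs0]
      rw [AddChar.sum_mulShift _ hψ, if_neg]
      · simp
      · intro h
        apply hs
        have : a * s = -b := by
          have h2 : a + b / s = 0 := neg_eq_zero.1 h
          field_simp at h2
          linear_combination h2
        rw [← this]; field_simp
  · simp

theorem KL_S_big {F : Type} [Field F] [Fintype F] [DecidableEq F] (ψ : AddChar F ℂ)
    (hψ : ψ.IsPrimitive) (a b : F) (ha : a ≠ 0) (n : ℕ) (hn : 3 ≤ n) :
    KL_S ψ a b n = 0 := by
  obtain ⟨m, rfl⟩ : ∃ m, n = m + 3 := ⟨n - 3, by omega⟩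
  unfold KL_S
  rw [KL_sum_mon]
  rw [← (Fin.snocEquiv (fun _ : Fin (m + 3) => F)).sum_comp, Fintype.sum_prod_type, Finset.sum_comm]
  refine Finset.sum_eq_zero fun c _ => ?_
  have h : ∀ t : F, KL_lam ψ a b (KL_poly (m + 3)
      ((Fin.snocEquiv (fun _ : Fin (m + 3) => F)) (t, c))) =
      if c 0 = 0 then 0 else ψ (t * (-a)) * ψ (-(b * (c 1 / c 0))) := by
    intro t
    set c' : Fin (m + 3) → F := (Fin.snocEquiv (fun _ : Fin (m + 3) => F)) (t, c) with hc
    have e0 : c' 0 = c 0 := by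
      have : (0 : Fin (m + 3)) = Fin.castSucc 0 := rfl
      rw [hc, this]; simp [Fin.snocEquiv]
    have e1 : c' 1 = c 1 := by
      have : (1 : Fin (m + 3)) = Fin.castSucc 1 := rfl
      rw [hc, this]
      change Fin.snoc (α := fun _ => F) c t (Fin.castSucc 1) = c 1
      exact Fin.snoc_castSucc (α := fun _ => F) t c 1
    have e2 : c' (Fin.last _) = t := by
      rw [hc]; simp [Fin.snocEquiv]
    have h0 : (KL_poly (m + 3) c').coeff 0 = c 0 := by rw [← e0]; exact KL_poly_coeff (m + 3) c' 0
    have h1 : (KL_poly (m + 3) c').coeff 1 = c 1 := by rw [← e1]; exact KL_poly_coeff (m + 3) c' 1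
    have h2 : (KL_poly (m + 3) c').nextCoeff = t := by
      rw [nextCoeff_of_natDegree_pos (by rw [KL_poly_natDegree]; omega), KL_poly_natDegree, ← e2]
      exact KL_poly_coeff (m + 3) c' (Fin.last _)
    unfold KL_lam
    rw [h0, h1, h2, ← AddChar.map_add_eq_mul]
    split_ifs
    · rfl
    · congr 1; ring
  simp only [h]
  split_ifs
  · simp
  · rw [← Finset.sum_mul, AddChar.sum_mulShift _ hψ, if_neg (by simpa using ha)]
    simp

end PartE

section PartF

open Polynomial

theorem KL_minpoly_inv {F L : Type} [Field F] [Field L] [Algebra F L] [FiniteDimensional F L]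
    (x : L) (hx : x ≠ 0) :
    (minpoly F x⁻¹).natDegree = (minpoly F x).natDegree ∧
    (minpoly F x⁻¹).nextCoeff = (minpoly F x).coeff 1 / (minpoly F x).coeff 0 := by
  have hi : IsIntegral F x := Algebra.IsIntegral.isIntegral x
  have hi' : IsIntegral F x⁻¹ := Algebra.IsIntegral.isIntegral x⁻¹
  have h0 : (minpoly F x).coeff 0 ≠ 0 := minpoly.coeff_zero_ne_zero hi hx
  set P := minpoly F x with hP
  have hP0 : P ≠ 0 := minpoly.ne_zero hi
  have hdeg : (minpoly F x⁻¹).natDegree = P.natDegree := by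
    rw [← IntermediateField.adjoin.finrank hi', hP, ← IntermediateField.adjoin.finrank hi]
    have : IntermediateField.adjoin F {x⁻¹} = IntermediateField.adjoin F {x} := by
      apply le_antisymm
      · rw [IntermediateField.adjoin_simple_le_iff]
        exact inv_mem (IntermediateField.mem_adjoin_simple_self F x)
      · rw [IntermediateField.adjoin_simple_le_iff]
        have := inv_mem (IntermediateField.mem_adjoin_simple_self F x⁻¹)
        simpa using this
    rw [this]
  refine ⟨hdeg, ?_⟩
  let Q : F[X] := C (P.coeff 0)⁻¹ * P.reverse
  have hrevlead : P.reverse.leadingCoeff = P.coeff 0 := by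
    rw [reverse_leadingCoeff, trailingCoeff, natTrailingDegree_eq_zero.2 (Or.inr h0)]
  have hQm : Q.Monic := by
    unfold Monic
    simp only [Q]
    rw [leadingCoeff_mul, leadingCoeff_C, hrevlead, inv_mul_cancel₀ h0]
  have hrevdeg : P.reverse.natDegree = P.natDegree := by
    rw [reverse_natDegree, natTrailingDegree_eq_zero.2 (Or.inr h0), Nat.sub_zero]
  have hQd : Q.natDegree = P.natDegree := by
    simp only [Q]
    rw [natDegree_C_mul (inv_ne_zero h0), hrevdeg]
  have hroot : aeval x⁻¹ Q = 0 := by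
    have h1 : aeval x P = 0 := minpoly.aeval F x
    have h2 : eval₂ (algebraMap F L) x⁻¹ P.reverse = 0 := by
      let _ : Invertible x := invertibleOfNonzero hx
      have := (eval₂_reverse_eq_zero_iff (algebraMap F L) x P).2 h1
      simpa using this
    simp only [Q, map_mul]
    rw [aeval_def x⁻¹ P.reverse, h2, mul_zero]
  have heq : Q = minpoly F x⁻¹ := by
    refine eq_of_monic_of_dvd_of_natDegree_le (minpoly.monic hi') hQm (minpoly.dvd F x⁻¹ hroot) ?_
    rw [hQd, hdeg]
  rw [← heq]
  simp only [Q]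
  have hpos : 0 < P.natDegree := minpoly.natDegree_pos hi
  rw [nextCoeff_C_mul, nextCoeff_of_natDegree_pos (by rw [hrevdeg]; exact hpos), hrevdeg,
    coeff_reverse, revAt_le (by omega), Nat.sub_sub_self hpos]
  field_simp

theorem KL_Lam_eq {F L : Type} [Field F] [Fintype F] [Field L] [Fintype L] [Algebra F L]
    [DecidableEq L] (n : ℕ) (hn : 1 ≤ n)
    (hfin : Module.finrank F L = n) (a b : F) (ψ : AddChar F ℂ) :
    KL_Lam ψ a b n = ∑ x : L, if x = 0 then (0 : ℂ) else
      ψ (Algebra.trace F L (algebraMap F L a * x + algebraMap F L b * x⁻¹)) := by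
  classical
  have hmem : ∀ x : L, minpoly F x ∈ (KL_irr F n).filter (fun P => P.natDegree ∣ n) := by
    intro x
    have hi : IsIntegral F x := Algebra.IsIntegral.isIntegral x
    have hdvd : (minpoly F x).natDegree ∣ n := by rw [← hfin]; exact minpoly.degree_dvd hi
    rw [Finset.mem_filter, KL_mem_irr]
    exact ⟨⟨minpoly.monic hi, Nat.le_of_dvd hn hdvd, minpoly.irreducible hi⟩, hdvd⟩
  have hval : ∀ x : L, (if x = 0 then (0 : ℂ) else
      ψ (Algebra.trace F L (algebraMap F L a * x + algebraMap F L b * x⁻¹))) =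
      KL_lam ψ a b (minpoly F x) ^ (n / (minpoly F x).natDegree) := by
    intro x
    have hi : IsIntegral F x := Algebra.IsIntegral.isIntegral x
    have hdvd : (minpoly F x).natDegree ∣ n := by rw [← hfin]; exact minpoly.degree_dvd hi
    have hpos : 0 < (minpoly F x).natDegree := minpoly.natDegree_pos hi
    have hk : n / (minpoly F x).natDegree ≠ 0 :=
      (Nat.div_pos (Nat.le_of_dvd hn hdvd) hpos).ne'
    by_cases hx : x = 0
    · rw [if_pos hx]
      unfold KL_lam
      rw [if_pos, zero_pow hk]
      subst hx
      simp
    rw [if_neg hx]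
    have h0 : (minpoly F x).coeff 0 ≠ 0 := minpoly.coeff_zero_ne_zero hi hx
    unfold KL_lam
    rw [if_neg h0, ← AddChar.map_nsmul_eq_pow]
    congr 1
    have hrank : ∀ y : L, Module.finrank (IntermediateField.adjoin F {y}) L =
        n / (minpoly F y).natDegree := by
      intro y
      have hy : IsIntegral F y := Algebra.IsIntegral.isIntegral y
      rw [← IntermediateField.adjoin.finrank hy, ← hfin,
        ← Module.finrank_mul_finrank F (IntermediateField.adjoin F {y}) L,
        Nat.mul_div_cancel_left _ Module.finrank_pos]
    obtain ⟨e1, e2⟩ := KL_minpoly_inv (F := F) x hx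
    rw [map_add, ← Algebra.smul_def, ← Algebra.smul_def, map_smul, map_smul,
      trace_eq_finrank_mul_minpoly_nextCoeff, trace_eq_finrank_mul_minpoly_nextCoeff, hrank, hrank,
      e1, e2]
    simp only [smul_eq_mul, nsmul_eq_mul]
    ring
  simp only [hval]
  rw [← Finset.sum_fiberwise_of_maps_to (fun x _ => hmem x)]
  unfold KL_Lam
  refine Finset.sum_congr rfl fun P hP => ?_
  simp only [Finset.mem_filter, KL_mem_irr] at hP
  obtain ⟨⟨hPm, hPd, hPi⟩, hPj⟩ := hP
  rw [Finset.sum_congr rfl (g := fun _ => KL_lam ψ a b P ^ (n / P.natDegree))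
    (fun x hx => by rw [(Finset.mem_filter.1 hx).2]), Finset.sum_const, nsmul_eq_mul]
  congr 2
  have : Fact (Irreducible P) := ⟨hPi⟩
  obtain ⟨x, hx⟩ : ∃ x : L, minpoly F x = P := by
    have hfA : Module.finrank F (AdjoinRoot P) = P.natDegree := by
      rw [(AdjoinRoot.powerBasis hPi.ne_zero).finrank, AdjoinRoot.powerBasis_dim]
    have : FiniteDimensional F (AdjoinRoot P) := (AdjoinRoot.powerBasis hPi.ne_zero).finite
    have : Finite (AdjoinRoot P) := Module.finite_of_finite F
    obtain ⟨f⟩ := FiniteField.nonempty_algHom_of_finrank_dvd (F := F) (K := AdjoinRoot P) (L := L)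
      (by rw [hfA, hfin]; exact hPj)
    refine ⟨f (AdjoinRoot.root P), ?_⟩
    symm
    apply minpoly.eq_of_irreducible_of_monic hPi _ hPm
    rw [aeval_algHom_apply]
    simp [AdjoinRoot.aeval_eq]
  have hsplit : (P.map (algebraMap F L)).Splits := by
    rw [← hx]; exact Normal.splits inferInstance x
  have hsep : P.Separable := by
    rw [← hx]; exact Algebra.IsSeparable.isSeparable F x
  have hcard := card_rootSet_eq_natDegree hsep hsplit
  rw [← hcard, ← Set.toFinset_card]
  congr 1
  ext y
  simp only [Set.mem_toFinset, Finset.mem_filter, Finset.mem_univ, true_and,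
    mem_rootSet, ne_eq, hPi.ne_zero, not_false_eq_true]
  constructor
  · intro h
    exact (minpoly.eq_of_irreducible_of_monic hPi h hPm).symm
  · rintro rfl
    exact minpoly.aeval F y

end PartF

section PartG

theorem KL_analytic (Λ : ℕ → ℂ) (K : ℂ) (q : ℝ) (hq : 0 < q) (C : ℝ) (h1 : Λ 1 = K)
    (h2 : Λ 2 = 2 * q - K ^ 2) (hrec : ∀ n, Λ (n + 3) = - K * Λ (n + 2) - q * Λ (n + 1))
    (hb : ∀ m, 2 ≤ m → ‖Λ (2 * m)‖ ≤ C * q ^ m) : ‖K‖ ≤ 2 * Real.sqrt q := by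
  obtain ⟨s, hs⟩ : ∃ s : ℂ, s ^ 2 = K ^ 2 - 4 * q := IsAlgClosed.exists_pow_nat_eq _ (by norm_num)
  let α := (-K + s) / 2
  let β := (-K - s) / 2
  have hsum : α + β = -K := by simp only [α, β]; ring
  have hprod : α * β = q := by
    simp only [α, β]
    linear_combination (-1 / 4) * hs
  have hpow : ∀ n, Λ (n + 1) = -(α ^ (n + 1) + β ^ (n + 1)) ∧
      Λ (n + 2) = -(α ^ (n + 2) + β ^ (n + 2)) := by
    intro n
    induction n with
    | zero =>
      refine ⟨?_, ?_⟩
      · simp only [zero_add, pow_one]; rw [h1]; linear_combination -hsum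
      · simp only [zero_add]; rw [h2, ← hprod]; linear_combination (-(α + β) + K) * hsum
    | succ n ih =>
      refine ⟨ih.2, ?_⟩
      have := hrec n
      rw [show n + 1 + 2 = n + 3 by ring, this, ih.1, ih.2, ← hprod]
      have hK : K = -(α + β) := by rw [hsum]; ring
      rw [hK]; ring
  have hsq : 0 < Real.sqrt q := Real.sqrt_pos.2 hq
  have main : ∀ α β : ℂ, α * β = q → (∀ m, 2 ≤ m → ‖α ^ (2 * m) + β ^ (2 * m)‖ ≤ C * q ^ m) →
      ‖α‖ ≤ Real.sqrt q := by
    intro α β hprod hb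
    by_contra! hlt
    have hn : ‖α‖ * ‖β‖ = q := by
      rw [← norm_mul, hprod, Complex.norm_real, Real.norm_of_nonneg hq.le]
    have hqq : Real.sqrt q * Real.sqrt q = q := Real.mul_self_sqrt hq.le
    have hβ : ‖β‖ ≤ Real.sqrt q := by
      by_contra! h
      nlinarith
    have hα2 : q < ‖α‖ ^ 2 := by nlinarith
    have hβ2 : ‖β‖ ^ 2 ≤ q := by nlinarith [norm_nonneg β]
    have hbd : ∀ m, 2 ≤ m → (‖α‖ ^ 2 / q) ^ m ≤ C + 1 := by
      intro m hm
      have e1 : ‖α ^ (2 * m)‖ ≤ ‖α ^ (2 * m) + β ^ (2 * m)‖ + ‖β ^ (2 * m)‖ := by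
        have := norm_sub_le (α ^ (2 * m) + β ^ (2 * m)) (β ^ (2 * m))
        simpa using this
      rw [norm_pow, norm_pow, pow_mul, pow_mul ‖β‖] at e1
      have e2 : (‖β‖ ^ 2) ^ m ≤ q ^ m := pow_le_pow_left₀ (by positivity) hβ2 m
      rw [div_pow, div_le_iff₀ (by positivity)]
      have := hb m hm
      linarith
    have hgt : 1 < ‖α‖ ^ 2 / q := by rw [lt_div_iff₀ hq]; linarith
    obtain ⟨m, hm⟩ := pow_unbounded_of_one_lt (C + 1) hgt
    have h3 := hbd (m + 2) (by omega)
    have h4 : (‖α‖ ^ 2 / q) ^ m ≤ (‖α‖ ^ 2 / q) ^ (m + 2) :=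
      pow_le_pow_right₀ hgt.le (by omega)
    linarith
  have hb' : ∀ m, 2 ≤ m → ‖α ^ (2 * m) + β ^ (2 * m)‖ ≤ C * q ^ m := by
    intro m hm
    have := hb m hm
    obtain ⟨t, ht⟩ : ∃ t, 2 * m = t + 1 := ⟨2 * m - 1, by omega⟩
    rw [ht, (hpow t).1, norm_neg, ← ht] at this
    exact this
  have ha := main α β hprod hb'
  have hbb := main β α (by rw [mul_comm, hprod]) (fun m hm => by rw [add_comm]; exact hb' m hm)
  have : ‖K‖ = ‖α + β‖ := by rw [hsum, norm_neg]
  rw [this]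
  linarith [norm_add_le α β]

theorem KL_kloosterman {F : Type} [Field F] [Fintype F] [DecidableEq F] (q : ℕ)
    (hq : Fintype.card F = q) (ψ : AddChar F ℂ) (hψ : ψ.IsPrimitive) (a b : F) (ha : a ≠ 0)
    (hb : b ≠ 0) :
    ‖∑ s : F, if s = 0 then (0 : ℂ) else ψ (a * s + b * s⁻¹)‖ ≤ 2 * Real.sqrt q := by
  classical
  have hq2 : 2 ≤ q := by rw [← hq]; exact Fintype.one_lt_card
  have hψ1 : ψ ≠ 1 := by
    have := hψ one_ne_zero
    simpa using this
  rw [← KL_S_one]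
  have hS0 := KL_S_zero ψ a b
  have hS2 := KL_S_two ψ hψ a b ha hb
  rw [hq] at hS2
  have h1 : KL_Lam ψ a b 1 = KL_S ψ a b 1 := by
    have := KL_newton ψ a b 1
    simpa [hS0] using this.symm
  refine KL_analytic (KL_Lam ψ a b) (KL_S ψ a b 1) q (by exact_mod_cast (by omega : 0 < q))
    (2 * q + 1) h1 ?_ ?_ ?_
  · have := KL_newton ψ a b 2
    rw [show Finset.Icc 1 2 = {1, 2} by rfl, Finset.sum_pair (by norm_num), hS2, h1] at this
    simp only [Nat.sub_self, hS0, show 2 - 1 = 1 by rfl] at this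
    push_cast at this ⊢
    linear_combination -this
  · intro n
    have := KL_newton ψ a b (n + 3)
    rw [KL_S_big ψ hψ a b ha (n + 3) (by omega), mul_zero,
      Finset.sum_Icc_succ_top (by omega), Finset.sum_Icc_succ_top (by omega)] at this
    by_cases hn : n = 0
    · subst hn
      simp [hS0, hS2] at this
      push_cast
      linear_combination -this
    rw [Finset.sum_Icc_succ_top (by omega), Finset.sum_eq_zero] at this
    · rw [show n + 3 - (n + 1) = 2 by omega, show n + 3 - (n + 1 + 1) = 1 by omega,
        show n + 3 - (n + 2 + 1) = 0 by omega, hS0, hS2, zero_add, mul_one] at this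
      push_cast
      linear_combination -this
    · intro j hj
      rw [Finset.mem_Icc] at hj
      rw [KL_S_big ψ hψ a b ha _ (by omega), mul_zero]
  · intro m hm
    obtain ⟨p, hp⟩ := CharP.exists F
    obtain ⟨n, hpp, hpn⟩ := FiniteField.card F p
    have : Fact p.Prime := ⟨hpp⟩
    have : NeZero (2 * m) := ⟨by omega⟩
    let L := FiniteField.Extension F p (2 * m)
    have : Finite L := Module.finite_of_finite F
    let _ : Fintype L := Fintype.ofFinite L
    have hfin : Module.finrank F L = 2 * m := FiniteField.finrank_extension F p (2 * m)
    rw [KL_Lam_eq (L := L) (2 * m) (by omega) hfin]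
    exact KL_ext_bound q hq m hm hfin a b ha ψ hψ1

end PartG

section PartH

noncomputable def KL_chi (F : Type) [Field F] [Fintype F] [DecidableEq F] : MulChar F ℂ :=
  (quadraticChar F).ringHomComp (Int.castRingHom ℂ)

theorem KL_chi_apply {F : Type} [Field F] [Fintype F] [DecidableEq F] (s : F) :
    KL_chi F s = ((quadraticChar F s : ℤ) : ℂ) := rfl

theorem KL_chi_sq {F : Type} [Field F] [Fintype F] [DecidableEq F] (s : F) (hs : s ≠ 0) :
    KL_chi F s ^ 2 = 1 := by
  rw [KL_chi_apply]
  exact_mod_cast quadraticChar_sq_one hs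

theorem KL_chi_norm {F : Type} [Field F] [Fintype F] [DecidableEq F] (s : F) (hs : s ≠ 0) :
    ‖KL_chi F s‖ = 1 := by
  have h := congrArg norm (KL_chi_sq s hs)
  rw [norm_pow, norm_one] at h
  nlinarith [norm_nonneg (KL_chi F s)]

theorem KL_gauss_norm {F : Type} [Field F] [Fintype F] [DecidableEq F] (q : ℕ)
    (hq : Fintype.card F = q) (hF : ringChar F ≠ 2) (ψ : AddChar F ℂ) (hψ : ψ.IsPrimitive) :
    ‖gaussSum (KL_chi F) ψ‖ = Real.sqrt q := by
  have hne : KL_chi F ≠ 1 :=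
    (MulChar.ringHomComp_ne_one_iff (RingHom.injective_int (Int.castRingHom ℂ))).2 (quadraticChar_ne_one hF)
  have hquad : (KL_chi F).IsQuadratic := (quadraticChar_isQuadratic F).comp _
  have h := congrArg norm (gaussSum_sq hne hquad hψ)
  rw [norm_pow, norm_mul, KL_chi_norm _ (by simp), one_mul, hq] at h
  rw [← Real.sqrt_sq (norm_nonneg _), h]
  simp

theorem KL_gauss_sq {F : Type} [Field F] [Fintype F] [DecidableEq F]
    (hF : ringChar F ≠ 2) (ψ : AddChar F ℂ) (hψ : ψ.IsPrimitive) (s : F) (hs : s ≠ 0) :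
    ∑ z : F, ψ (s * z ^ 2) = KL_chi F s * gaussSum (KL_chi F) ψ := by
  have h1 : ∑ z : F, ψ (s * z ^ 2) = ∑ u : F, (KL_chi F u + 1) * ψ (s * u) := by
    rw [← Finset.sum_fiberwise Finset.univ (fun z : F => z ^ 2)]
    refine Finset.sum_congr rfl fun u _ => ?_
    rw [Finset.sum_congr rfl (g := fun _ => ψ (s * u))
      (fun x hx => by rw [(Finset.mem_filter.1 hx).2]), Finset.sum_const, nsmul_eq_mul]
    congr 1
    have := quadraticChar_card_sqrts hF u
    rw [KL_chi_apply]
    have h2 : (Finset.univ.filter (fun z : F => z ^ 2 = u)) = {x : F | x ^ 2 = u}.toFinset := by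
      ext; simp
    rw [h2]
    exact_mod_cast this
  have h2 : ∑ u : F, ψ (s * u) = 0 := by
    have := AddChar.sum_mulShift s hψ
    rw [if_neg hs] at this
    simpa [mul_comm] using this
  rw [h1]
  simp only [add_mul, one_mul, Finset.sum_add_distrib]
  rw [h2, add_zero]
  have h3 := gaussSum_mulShift (KL_chi F) ψ (Units.mk0 s hs)
  have h4 : gaussSum (KL_chi F) (ψ.mulShift s) = ∑ u : F, KL_chi F u * ψ (s * u) := by
    simp [gaussSum, AddChar.mulShift_apply]
  rw [← h4]
  simp only [Units.val_mk0] at h3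
  rw [← h3, ← mul_assoc, ← sq, KL_chi_sq s hs, one_mul]

theorem KL_two_ne {F : Type} [Field F] (hF : ringChar F ≠ 2) : (2 : F) ≠ 0 :=
  Ring.two_ne_zero hF

theorem KL_gauss_lin {F : Type} [Field F] [Fintype F] [DecidableEq F]
    (hF : ringChar F ≠ 2) (ψ : AddChar F ℂ) (hψ : ψ.IsPrimitive) (s : F) (hs : s ≠ 0) (c : F) :
    ∑ z : F, ψ (s * z ^ 2 + c * z) =
      KL_chi F s * gaussSum (KL_chi F) ψ * ψ (-(c ^ 2 / 4) * s⁻¹) := by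
  have h2 := KL_two_ne hF
  have h4 : (4 : F) ≠ 0 := by
    have : (4 : F) = 2 * 2 := by norm_num
    rw [this]; exact mul_ne_zero h2 h2
  rw [← KL_gauss_sq hF ψ hψ s hs, Finset.sum_mul,
    ← Equiv.sum_comp (Equiv.addRight (c / (2 * s)))
      (fun z => ψ (s * z ^ 2) * ψ (-(c ^ 2 / 4) * s⁻¹))]
  refine Finset.sum_congr rfl fun z _ => ?_
  rw [← AddChar.map_add_eq_mul]
  congr 1
  simp only [Equiv.coe_addRight]
  field_simp
  ring

theorem KL_sum_ne_zero {F : Type} [Field F] [Fintype F] [DecidableEq F] (ψ : AddChar F ℂ)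
    (hψ : ψ.IsPrimitive) (A : F) :
    (∑ s : F, if s = 0 then (0 : ℂ) else ψ (s * A)) =
      (if A = 0 then (Fintype.card F : ℂ) else 0) - 1 := by
  have h : ∀ s : F, (if s = 0 then (0 : ℂ) else ψ (s * A)) =
      ψ (s * A) - if s = 0 then 1 else 0 := by
    intro s; split_ifs with h <;> simp [h]
  simp only [h, Finset.sum_sub_distrib]
  rw [AddChar.sum_mulShift A hψ]
  simp

theorem KL_salie {F : Type} [Field F] [Fintype F] [DecidableEq F] (q : ℕ)
    (hq : Fintype.card F = q) (hF : ringChar F ≠ 2) (ψ : AddChar F ℂ) (hψ : ψ.IsPrimitive)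
    (a b : F) (ha : a ≠ 0) :
    ‖∑ s : F, if s = 0 then (0 : ℂ) else KL_chi F s * ψ (a * s + b * s⁻¹)‖ ≤ 2 * Real.sqrt q := by
  have hq2 : 2 ≤ q := by rw [← hq]; exact Fintype.one_lt_card
  have hsq : 0 < Real.sqrt q := Real.sqrt_pos.2 (by exact_mod_cast (by omega : 0 < q))
  have hg := KL_gauss_norm q hq hF ψ hψ
  set g := gaussSum (KL_chi F) ψ with hgdef
  by_cases hb : b = 0
  · have : (∑ s : F, if s = 0 then (0 : ℂ) else KL_chi F s * ψ (a * s + b * s⁻¹)) =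
        KL_chi F a * g := by
      have h3 := gaussSum_mulShift (KL_chi F) ψ (Units.mk0 a ha)
      simp only [Units.val_mk0] at h3
      rw [hgdef, ← h3, ← mul_assoc, ← sq, KL_chi_sq a ha, one_mul]
      unfold gaussSum
      refine Finset.sum_congr rfl fun s _ => ?_
      by_cases hs : s = 0
      · subst hs
        rw [if_pos rfl, MulChar.map_nonunit _ (by simp), zero_mul]
      · simp [hs, hb, AddChar.mulShift_apply]
    rw [this, norm_mul, KL_chi_norm a ha, one_mul, hg]
    linarith
  have hsub : (∑ s : F, if s = 0 then (0 : ℂ) else KL_chi F s * ψ (a * s + b * s⁻¹)) =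
      KL_chi F (-b) * ∑ v : F, if v = 0 then (0 : ℂ) else KL_chi F v * ψ (-(a * b) * v - v⁻¹) := by
    have hb' : -b ≠ 0 := neg_ne_zero.2 hb
    rw [← Equiv.sum_comp (Equiv.mulLeft₀ (-b) hb'), Finset.mul_sum]
    refine Finset.sum_congr rfl fun v _ => ?_
    simp only [Equiv.mulLeft₀_apply]
    by_cases hv : v = 0
    · simp [hv]
    · rw [if_neg (mul_ne_zero hb' hv), if_neg hv, map_mul, mul_assoc]
      congr 3
      field_simp
      ring
  rw [hsub, norm_mul, KL_chi_norm _ (neg_ne_zero.2 hb), one_mul]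
  set A := -(a * b) with hA
  set S := ∑ v : F, if v = 0 then (0 : ℂ) else KL_chi F v * ψ (A * v - v⁻¹) with hS
  have h2 := KL_two_ne hF
  have h4 : (4 : F) ≠ 0 := by
    have : (4 : F) = 2 * 2 := by norm_num
    rw [this]; exact mul_ne_zero h2 h2
  have hgS : g * S = q * ∑ z ∈ Finset.univ.filter (fun z : F => z ^ 2 = -A), ψ (2 * z) := by
    have e1 : g * S = ∑ z : F, ψ (2 * z) * ∑ v : F, if v = 0 then (0 : ℂ) else
        ψ (v * (A + z ^ 2)) := by
      simp only [Finset.mul_sum]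
      rw [Finset.sum_comm, hS, Finset.mul_sum]
      refine Finset.sum_congr rfl fun v _ => ?_
      by_cases hv : v = 0
      · simp [hv]
      · simp only [if_neg hv]
        have := KL_gauss_lin hF ψ hψ v hv 2
        have e : ∀ z, ψ (2 * z) * ψ (v * (A + z ^ 2)) = ψ (A * v) * ψ (v * z ^ 2 + 2 * z) := by
          intro z
          rw [← AddChar.map_add_eq_mul, ← AddChar.map_add_eq_mul]; congr 1; ring
        simp only [e]
        rw [← Finset.mul_sum, this, sub_eq_add_neg, AddChar.map_add_eq_mul]
        have : -((2 : F) ^ 2 / 4) * v⁻¹ = -v⁻¹ := by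
          field_simp; ring
        rw [this]
        ring
    rw [e1]
    simp only [KL_sum_ne_zero ψ hψ, mul_sub, mul_one, Finset.sum_sub_distrib]
    have e2 : ∑ z : F, ψ (2 * z) = 0 := by
      have := AddChar.sum_mulShift (2 : F) hψ
      rw [if_neg h2] at this
      simpa [mul_comm] using this
    rw [e2, sub_zero, Finset.sum_filter, Finset.mul_sum]
    refine Finset.sum_congr rfl fun z _ => ?_
    have : A + z ^ 2 = 0 ↔ z ^ 2 = -A := by
      constructor <;> intro h
      · linear_combination h
      · linear_combination h
    simp only [this, hq]
    split_ifs
    · ring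
    · simp
  have hcard : ((Finset.univ.filter (fun z : F => z ^ 2 = -A)).card : ℝ) ≤ 2 := by
    have := quadraticChar_card_sqrts hF (-A)
    have e : (Finset.univ.filter (fun z : F => z ^ 2 = -A)) = {x : F | x ^ 2 = -A}.toFinset := by
      ext; simp
    rw [← e] at this
    have h3 : quadraticChar F (-A) ≤ 1 := by
      rcases quadraticChar_isQuadratic F (-A) with h | h | h <;> rw [h] <;> norm_num
    have : ((Finset.univ.filter (fun z : F => z ^ 2 = -A)).card : ℤ) ≤ 2 := by linarith
    exact_mod_cast this
  have hn := congrArg norm hgS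
  rw [norm_mul, hg, norm_mul] at hn
  have hle : ‖∑ z ∈ Finset.univ.filter (fun z : F => z ^ 2 = -A), ψ (2 * z)‖ ≤ 2 := by
    refine (norm_sum_le _ _).trans ?_
    simpa [AddChar.norm_apply] using hcard
  rw [Complex.norm_natCast] at hn
  have hqq : Real.sqrt q * Real.sqrt q = q := Real.mul_self_sqrt (by positivity)
  have : Real.sqrt q * ‖S‖ ≤ Real.sqrt q * (2 * Real.sqrt q) := by
    rw [hn]
    calc _ ≤ (q : ℝ) * 2 := by gcongr
      _ = _ := by linear_combination -2 * hqq
  exact le_of_mul_le_mul_left this hsq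

theorem KL_unified {F : Type} [Field F] [Fintype F] [DecidableEq F] (q : ℕ)
    (hq : Fintype.card F = q) (hF : ringChar F ≠ 2) (ψ : AddChar F ℂ) (hψ : ψ.IsPrimitive)
    (a b : F) (ha : a ≠ 0) (d : ℕ) :
    ‖∑ s : F, if s = 0 then (0 : ℂ) else KL_chi F s ^ d * ψ (a * s + b * s⁻¹)‖
      ≤ 2 * Real.sqrt q := by
  have hq2 : 2 ≤ q := by rw [← hq]; exact Fintype.one_lt_card
  rcases Nat.even_or_odd' d with ⟨e, rfl | rfl⟩
  · have h : ∀ s : F, (if s = 0 then (0 : ℂ) else KL_chi F s ^ (2 * e) * ψ (a * s + b * s⁻¹)) =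
        if s = 0 then (0 : ℂ) else ψ (a * s + b * s⁻¹) := by
      intro s
      split_ifs with hs
      · rfl
      · rw [pow_mul, KL_chi_sq s hs, one_pow, one_mul]
    simp only [h]
    by_cases hb : b = 0
    · have h := KL_sum_ne_zero ψ hψ a
      rw [if_neg ha] at h
      have e : (∑ s : F, if s = 0 then (0 : ℂ) else ψ (a * s + b * s⁻¹)) = 0 - 1 := by
        rw [← h]; simp [hb, mul_comm]
      rw [e]
      have : (1 : ℝ) ≤ Real.sqrt q := Real.one_le_sqrt.2 (by exact_mod_cast (by omega : 1 ≤ q))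
      simp; linarith
    · exact KL_kloosterman q hq ψ hψ a b ha hb
  · have h : ∀ s : F, (if s = 0 then (0 : ℂ) else KL_chi F s ^ (2 * e + 1) * ψ (a * s + b * s⁻¹)) =
        if s = 0 then (0 : ℂ) else KL_chi F s * ψ (a * s + b * s⁻¹) := by
      intro s
      split_ifs with hs
      · rfl
      · rw [pow_succ, pow_mul, KL_chi_sq s hs, one_pow, one_mul]
    simp only [h]
    exact KL_salie q hq hF ψ hψ a b ha

end PartH

section PartI

theorem KL_map_sum {F : Type} [Field F] {ι : Type} (ψ : AddChar F ℂ) (s : Finset ι) (f : ι → F) :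
    ψ (∑ i ∈ s, f i) = ∏ i ∈ s, ψ (f i) := by
  classical
  induction s using Finset.induction_on with
  | empty => simp
  | insert a s ha ih => rw [Finset.sum_insert ha, Finset.prod_insert ha, AddChar.map_add_eq_mul, ih]

noncomputable def KL_ft {F : Type} [Field F] [Fintype F] {d : ℕ} (ψ : AddChar F ℂ)
    (f : (Fin d → F) → ℂ) (m : Fin d → F) : ℂ := ∑ x, f x * ψ (∑ i, m i * x i)

theorem KL_orth {F : Type} [Field F] [Fintype F] [DecidableEq F] {d : ℕ} (ψ : AddChar F ℂ)
    (hψ : ψ.IsPrimitive) (w : Fin d → F) :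
    ∑ m : Fin d → F, ψ (∑ i, m i * w i) = if w = 0 then (Fintype.card F : ℂ) ^ d else 0 := by
  have h : ∀ m : Fin d → F, ψ (∑ i, m i * w i) = ∏ i, ψ (m i * w i) := by
    intro m; exact KL_map_sum ψ _ _
  simp only [h]
  rw [← Fintype.piFinset_univ, ← Finset.prod_univ_sum (fun _ => Finset.univ) (fun i z => ψ (z * w i))]
  simp only [AddChar.sum_mulShift _ hψ]
  split_ifs with hw
  · simp [hw]
  · obtain ⟨i, hi⟩ := Function.ne_iff.1 hw
    apply Finset.prod_eq_zero (Finset.mem_univ i)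
    rw [if_neg (by simpa using hi)]; simp

theorem KL_plancherel {F : Type} [Field F] [Fintype F] [DecidableEq F] {d : ℕ} (ψ : AddChar F ℂ)
    (hψ : ψ.IsPrimitive) (f : (Fin d → F) → ℂ) :
    ∑ m, ‖KL_ft ψ f m‖ ^ 2 = (Fintype.card F : ℝ) ^ d * ∑ x, ‖f x‖ ^ 2 := by
  have hC : ∑ m, (KL_ft ψ f m * (starRingEnd ℂ) (KL_ft ψ f m)) =
      (Fintype.card F : ℂ) ^ d * ∑ x, f x * (starRingEnd ℂ) (f x) := by
    have h : ∀ m, KL_ft ψ f m * (starRingEnd ℂ) (KL_ft ψ f m) =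
        ∑ x, ∑ y, (f x * (starRingEnd ℂ) (f y)) * ψ (∑ i, m i * (x - y) i) := by
      intro m
      unfold KL_ft
      rw [map_sum, Finset.sum_mul_sum]
      refine Finset.sum_congr rfl fun x _ => Finset.sum_congr rfl fun y _ => ?_
      rw [map_mul, ← AddChar.map_neg_eq_conj]
      have : ∑ i, m i * (x - y) i = ∑ i, m i * x i + -∑ i, m i * y i := by
        rw [← sub_eq_add_neg, ← Finset.sum_sub_distrib]
        refine Finset.sum_congr rfl fun i _ => ?_
        simp [mul_sub]
      rw [this, AddChar.map_add_eq_mul]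
      ring
    simp only [h]
    rw [Finset.sum_comm, Finset.mul_sum]
    refine Finset.sum_congr rfl fun x _ => ?_
    rw [Finset.sum_comm]
    simp only [← Finset.mul_sum, KL_orth ψ hψ]
    rw [Finset.sum_eq_single x]
    · simp; ring
    · intro y _ hy
      rw [if_neg (sub_ne_zero.2 hy.symm), mul_zero]
    · simp
  simp only [Complex.mul_conj, Complex.normSq_eq_norm_sq] at hC
  exact_mod_cast hC

theorem KL_conv {F : Type} [Field F] [Fintype F] {d : ℕ} (ψ : AddChar F ℂ)
    (k f : (Fin d → F) → ℂ) (m : Fin d → F) :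
    KL_ft ψ (fun x => ∑ y, k (x - y) * f y) m = KL_ft ψ k m * KL_ft ψ f m := by
  unfold KL_ft
  simp only [Finset.sum_mul]
  rw [Finset.sum_comm]
  have h : ∀ y, ∑ x, k (x - y) * f y * ψ (∑ i, m i * x i) =
      ∑ z, k z * f y * ψ (∑ i, m i * (z + y) i) := by
    intro y
    rw [← Equiv.sum_comp (Equiv.addRight y)]
    simp
  simp only [h]
  rw [Finset.sum_comm]
  refine Finset.sum_congr rfl fun z _ => ?_
  rw [Finset.mul_sum]
  refine Finset.sum_congr rfl fun y _ => ?_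
  have : ∑ i, m i * (z + y) i = ∑ i, m i * z i + ∑ i, m i * y i := by
    rw [← Finset.sum_add_distrib]
    refine Finset.sum_congr rfl fun i _ => ?_
    simp [mul_add]
  rw [this, AddChar.map_add_eq_mul]
  ring

theorem KL_op {F : Type} [Field F] [Fintype F] [DecidableEq F] {d : ℕ} (ψ : AddChar F ℂ)
    (hψ : ψ.IsPrimitive) (k f : (Fin d → F) → ℂ) (l : ℝ) (hk : ∀ m, ‖KL_ft ψ k m‖ ≤ l) :
    ∑ x, ‖∑ y, k (x - y) * f y‖ ^ 2 ≤ l ^ 2 * ∑ x, ‖f x‖ ^ 2 := by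
  have hc : (0 : ℝ) < (Fintype.card F : ℝ) ^ d := by
    have : 0 < Fintype.card F := Fintype.card_pos
    positivity
  refine le_of_mul_le_mul_left ?_ hc
  rw [← KL_plancherel ψ hψ (fun x => ∑ y, k (x - y) * f y)]
  calc _ ≤ ∑ m, l ^ 2 * ‖KL_ft ψ f m‖ ^ 2 := by
        refine Finset.sum_le_sum fun m _ => ?_
        rw [KL_conv, norm_mul, mul_pow]
        gcongr
        exact hk m
    _ = _ := by
        rw [← Finset.mul_sum, KL_plancherel ψ hψ]; ring

/-- the balanced sphere kernel -/
noncomputable def KL_ker {F : Type} [Field F] [Fintype F] [DecidableEq F] {d : ℕ} (t : F)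
    (z : Fin d → F) : ℝ := (if ∑ j, z j ^ 2 = t then 1 else 0) - 1 / (Fintype.card F : ℝ)

theorem KL_ker_ft {F : Type} [Field F] [Fintype F] [DecidableEq F] {d : ℕ} (q : ℕ)
    (hq : Fintype.card F = q) (hF : ringChar F ≠ 2) (ψ : AddChar F ℂ) (hψ : ψ.IsPrimitive)
    (t : F) (ht : t ≠ 0) (m : Fin d → F) :
    ‖KL_ft ψ (fun z => (KL_ker t z : ℂ)) m‖ ≤ 2 * Real.sqrt q * Real.sqrt q ^ d / q := by
  have hq2 : 2 ≤ q := by rw [← hq]; exact Fintype.one_lt_card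
  have hq0 : (0 : ℝ) < q := by exact_mod_cast (by omega : 0 < q)
  have hqC : (q : ℂ) ≠ 0 := by exact_mod_cast (by omega : q ≠ 0)
  have hker : ∀ z : Fin d → F, (q : ℂ) * (KL_ker t z : ℂ) =
      ∑ s : F, if s = 0 then (0 : ℂ) else ψ (s * (∑ j, z j ^ 2 - t)) := by
    intro z
    rw [KL_sum_ne_zero ψ hψ, hq]
    unfold KL_ker
    rw [hq]
    simp only [sub_eq_zero]
    split_ifs
    · push_cast; field_simp
    · push_cast; field_simp; ring
  have key : (q : ℂ) * KL_ft ψ (fun z => (KL_ker t z : ℂ)) m =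
      gaussSum (KL_chi F) ψ ^ d * ∑ s : F, if s = 0 then (0 : ℂ) else
        KL_chi F s ^ d * ψ (-t * s + (-((∑ i, m i ^ 2) / 4)) * s⁻¹) := by
    unfold KL_ft
    rw [Finset.mul_sum]
    simp only [← mul_assoc, hker]
    simp only [Finset.sum_mul]
    rw [Finset.sum_comm, Finset.mul_sum]
    refine Finset.sum_congr rfl fun s _ => ?_
    by_cases hs : s = 0
    · simp [hs]
    simp only [if_neg hs]
    have h : ∀ z : Fin d → F, ψ (s * (∑ j, z j ^ 2 - t)) * ψ (∑ i, m i * z i) =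
        ψ (-t * s) * ∏ i, ψ (s * z i ^ 2 + m i * z i) := by
      intro z
      rw [← KL_map_sum, ← AddChar.map_add_eq_mul, ← AddChar.map_add_eq_mul]
      congr 1
      rw [Finset.sum_add_distrib, ← Finset.mul_sum]
      ring
    simp only [h]
    rw [← Finset.mul_sum, ← Fintype.piFinset_univ,
      ← Finset.prod_univ_sum (fun _ => Finset.univ) (fun i z => ψ (s * z ^ 2 + m i * z))]
    simp only [KL_gauss_lin hF ψ hψ s hs]
    rw [Finset.prod_mul_distrib, ← KL_map_sum, ← Finset.sum_mul, AddChar.map_add_eq_mul,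
      Finset.prod_const, Finset.card_univ, Fintype.card_fin, Finset.sum_neg_distrib, Finset.sum_div]
    ring
  have hn := congrArg norm key
  rw [norm_mul, norm_mul, norm_pow, KL_gauss_norm q hq hF ψ hψ, Complex.norm_natCast] at hn
  rw [le_div_iff₀ hq0, mul_comm, hn, mul_comm]
  exact mul_le_mul_of_nonneg_right
    (KL_unified q hq hF ψ hψ _ _ (neg_ne_zero.2 ht) d) (by positivity)

theorem KL_op_real {F : Type} [Field F] [Fintype F] [DecidableEq F] {d : ℕ} (q : ℕ)
    (hq : Fintype.card F = q) (hF : ringChar F ≠ 2) (t : F) (ht : t ≠ 0) (f : (Fin d → F) → ℝ) :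
    ∑ x, (∑ y, KL_ker t (x - y) * f y) ^ 2 ≤
      (2 * Real.sqrt q * Real.sqrt q ^ d / q) ^ 2 * ∑ x, f x ^ 2 := by
  have hψ := AddChar.FiniteField.primitiveChar_to_Complex_isPrimitive F
  have := KL_op _ hψ (fun z => (KL_ker t z : ℂ)) (fun x => (f x : ℂ)) _
    (fun m => KL_ker_ft q hq hF _ hψ t ht m)
  have e : ∀ x, (∑ y, (KL_ker t (x - y) : ℂ) * (f y : ℂ)) =
      ((∑ y, KL_ker t (x - y) * f y : ℝ) : ℂ) := by intro x; push_cast; rfl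
  simpa only [e, Complex.norm_real, Real.norm_eq_abs, sq_abs] using this

end PartI

/-- The indicator function of `E`. -/
noncomputable def KL_ind {F : Type} [DecidableEq F] {d : ℕ} (E : Finset (Fin d → F))
    (x : Fin d → F) : ℝ := if x ∈ E then 1 else 0

/-- Number of chains starting at a given point, recursively. -/
noncomputable def KL_f {F : Type} [Field F] [Fintype F] [DecidableEq F] {d : ℕ}
    (E : Finset (Fin d → F)) : (k : ℕ) → (Fin k → F) → (Fin d → F) → ℝ
  | 0, _, x => KL_ind E x
  | k + 1, t, x => KL_ind E x *
      ∑ y, (if ∑ j, (x j - y j) ^ 2 = t 0 then (1 : ℝ) else 0) * KL_f E k (Fin.tail t) y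

theorem KL_f_eq {F : Type} [Field F] [Fintype F] [DecidableEq F] {d : ℕ}
    (E : Finset (Fin d → F)) (k : ℕ) : ∀ (t : Fin k → F) (x0 : Fin d → F),
    KL_f E k t x0 = ∑ x' : Fin k → (Fin d → F),
      if ((∀ i, (Fin.cons x0 x' : Fin (k+1) → (Fin d → F)) i ∈ E) ∧
      ∀ i : Fin k, ∑ j, ((Fin.cons x0 x' : Fin (k+1) → (Fin d → F)) i.castSucc j -
        (Fin.cons x0 x' : Fin (k+1) → (Fin d → F)) i.succ j) ^ 2 = t i) then (1 : ℝ) else 0 := by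
  induction k with
  | zero =>
    intro t x0
    simp [KL_f, KL_ind, Fin.forall_fin_succ]
  | succ k ih =>
    intro t x0
    rw [KL_f]
    simp only [ih]
    rw [← (Fin.consEquiv (fun _ : Fin (k+1) => (Fin d → F))).sum_comp, Fintype.sum_prod_type,
      Finset.mul_sum]
    refine Finset.sum_congr rfl fun y _ => ?_
    rw [Finset.mul_sum, Finset.mul_sum]
    refine Finset.sum_congr rfl fun x' _ => ?_
    have hP : ((∀ i, (Fin.cons x0 (Fin.cons y x' : Fin (k+1) → (Fin d → F)) :
          Fin (k+1+1) → (Fin d → F)) i ∈ E) ∧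
        ∀ i : Fin (k+1), ∑ j, ((Fin.cons x0 (Fin.cons y x' : Fin (k+1) → (Fin d → F)) :
          Fin (k+1+1) → (Fin d → F)) i.castSucc j -
          (Fin.cons x0 (Fin.cons y x' : Fin (k+1) → (Fin d → F)) :
          Fin (k+1+1) → (Fin d → F)) i.succ j) ^ 2 = t i) ↔
        (x0 ∈ E ∧ ∑ j, (x0 j - y j) ^ 2 = t 0 ∧
        ((∀ i, (Fin.cons y x' : Fin (k+1) → (Fin d → F)) i ∈ E) ∧
          ∀ i : Fin k, ∑ j, ((Fin.cons y x' : Fin (k+1) → (Fin d → F)) i.castSucc j -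
            (Fin.cons y x' : Fin (k+1) → (Fin d → F)) i.succ j) ^ 2 = Fin.tail t i)) := by
      rw [Fin.forall_fin_succ (n := k + 1),
        Fin.forall_fin_succ (n := k) (P := fun i => ∑ j, ((Fin.cons x0 (Fin.cons y x' :
          Fin (k+1) → (Fin d → F)) : Fin (k+1+1) → (Fin d → F)) i.castSucc j -
          (Fin.cons x0 (Fin.cons y x' : Fin (k+1) → (Fin d → F)) :
          Fin (k+1+1) → (Fin d → F)) i.succ j) ^ 2 = t i)]
      simp only [Fin.cons_zero, Fin.cons_succ, Fin.castSucc_zero, ← Fin.succ_castSucc, Fin.tail]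
      tauto
    have hR : (Fin.consEquiv (fun _ : Fin (k+1) => (Fin d → F))) (y, x') = Fin.cons y x' := rfl
    rw [hR, if_congr hP rfl rfl]
    unfold KL_ind
    simp only [ite_and]
    split_ifs <;> simp

theorem KL_count {F : Type} [Field F] [Fintype F] [DecidableEq F] {d k : ℕ}
    (E : Finset (Fin d → F)) (t : Fin k → F) :
    (chainCountVec E t : ℝ) = ∑ x, KL_f E k t x := by
  unfold chainCountVec
  rw [Finset.card_filter]
  push_cast
  rw [← (Fin.consEquiv (fun _ : Fin (k+1) => (Fin d → F))).sum_comp, Fintype.sum_prod_type]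
  refine Finset.sum_congr rfl fun y _ => ?_
  rw [KL_f_eq]
  rfl

/-- The l2 norm. -/
noncomputable def KL_n2 {V : Type} [Fintype V] (f : V → ℝ) : ℝ := Real.sqrt (∑ x, f x ^ 2)

theorem KL_n2_add {V : Type} [Fintype V] (f g : V → ℝ) :
    KL_n2 (fun x => f x + g x) ≤ KL_n2 f + KL_n2 g := by
  have := norm_add_le (WithLp.toLp 2 f : EuclideanSpace ℝ V) (WithLp.toLp 2 g)
  simpa [EuclideanSpace.norm_eq, KL_n2] using this

theorem KL_n2_smul {V : Type} [Fintype V] (c : ℝ) (f : V → ℝ) :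
    KL_n2 (fun x => c * f x) = |c| * KL_n2 f := by
  unfold KL_n2
  simp only [mul_pow]
  rw [← Finset.mul_sum, Real.sqrt_mul (sq_nonneg c), Real.sqrt_sq_eq_abs]

theorem KL_n2_nonneg {V : Type} [Fintype V] (f : V → ℝ) : 0 ≤ KL_n2 f := Real.sqrt_nonneg _

theorem KL_n2_ind {F : Type} [Fintype F] [DecidableEq F] {d : ℕ} (E : Finset (Fin d → F)) :
    KL_n2 (KL_ind E) = Real.sqrt E.card := by
  unfold KL_n2 KL_ind
  simp

theorem KL_sum_le {F : Type} [Fintype F] [DecidableEq F] {d : ℕ} (E : Finset (Fin d → F))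
    (f : (Fin d → F) → ℝ) (hf : ∀ x, f x = KL_ind E x * f x) :
    |∑ x, f x| ≤ Real.sqrt E.card * KL_n2 f := by
  rw [← KL_n2_ind]
  unfold KL_n2
  rw [← Real.sqrt_mul (Finset.sum_nonneg fun _ _ => sq_nonneg _)]
  apply Real.abs_le_sqrt
  have := Finset.sum_mul_sq_le_sq_mul_sq Finset.univ (KL_ind E) f
  simpa only [← hf] using this

/-- The transfer operator. -/
noncomputable def KL_T {F : Type} [Field F] [Fintype F] [DecidableEq F] {d : ℕ}
    (E : Finset (Fin d → F)) (t : F) (f : (Fin d → F) → ℝ) (x : Fin d → F) : ℝ :=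
  KL_ind E x * ∑ y, (if ∑ j, (x j - y j) ^ 2 = t then (1 : ℝ) else 0) * f y

/-- The centred operator. -/
noncomputable def KL_B {F : Type} [Field F] [Fintype F] [DecidableEq F] {d : ℕ}
    (E : Finset (Fin d → F)) (t : F) (f : (Fin d → F) → ℝ) (x : Fin d → F) : ℝ :=
  KL_ind E x * ∑ y, KL_ker t (x - y) * f y

theorem KL_T_eq {F : Type} [Field F] [Fintype F] [DecidableEq F] {d : ℕ} (q : ℕ)
    (hq : Fintype.card F = q)
    (E : Finset (Fin d → F)) (t : F) (f : (Fin d → F) → ℝ) (x : Fin d → F) :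
    KL_T E t f x = KL_B E t f x + ((∑ y, f y) / q) * KL_ind E x := by
  unfold KL_T KL_B KL_ker
  simp only [sub_mul, Finset.sum_sub_distrib, hq, Pi.sub_apply, ← Finset.mul_sum]
  ring

theorem KL_B_le {F : Type} [Field F] [Fintype F] [DecidableEq F] {d : ℕ} (q : ℕ)
    (hq : Fintype.card F = q) (hF : ringChar F ≠ 2) (t : F) (ht : t ≠ 0)
    (E : Finset (Fin d → F)) (f : (Fin d → F) → ℝ) :
    KL_n2 (KL_B E t f) ≤ (2 * Real.sqrt q * Real.sqrt q ^ d / q) * KL_n2 f := by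
  have h := KL_op_real q hq hF t ht f
  unfold KL_n2
  rw [← Real.sqrt_sq (by positivity : 0 ≤ (2 * Real.sqrt q * Real.sqrt q ^ d / q)),
    ← Real.sqrt_mul (sq_nonneg _)]
  apply Real.sqrt_le_sqrt
  refine le_trans (Finset.sum_le_sum fun x _ => ?_) h
  unfold KL_B KL_ind
  split_ifs
  · rw [one_mul]
  · rw [zero_mul, zero_pow two_ne_zero]; exact sq_nonneg _

theorem KL_chain {F : Type} [Field F] [Fintype F] [DecidableEq F] {d : ℕ} (q : ℕ)
    (hq : Fintype.card F = q) (hF : ringChar F ≠ 2)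
    (E : Finset (Fin d → F)) (lam mu : ℝ) (hlam : lam = 2 * Real.sqrt q * Real.sqrt q ^ d / q)
    (hmu : mu = E.card / q) (k : ℕ) : ∀ (t : Fin k → F), (∀ i, t i ≠ 0) →
    (∀ x, KL_f E k t x = KL_ind E x * KL_f E k t x) ∧
    KL_n2 (fun x => KL_f E k t x - mu ^ k * KL_ind E x) ≤
      ((mu + lam) ^ k - mu ^ k) * Real.sqrt E.card := by
  have hlam0 : 0 ≤ lam := by rw [hlam]; positivity
  have hmu0 : 0 ≤ mu := by rw [hmu]; positivity
  have hind : ∀ x, KL_ind E x = KL_ind E x * KL_ind E x := by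
    intro x; unfold KL_ind; split_ifs <;> simp
  have hsE : Real.sqrt E.card * Real.sqrt E.card = E.card := Real.mul_self_sqrt (Nat.cast_nonneg _)
  have hsum : ∑ x, KL_ind E x = (E.card : ℝ) := by unfold KL_ind; simp
  induction k with
  | zero => intro t _; refine ⟨hind, ?_⟩; simp [KL_f, KL_n2]
  | succ k ih =>
    intro t ht
    obtain ⟨h1, h2⟩ := ih (Fin.tail t) (fun i => ht i.succ)
    have hstep : ∀ x, KL_f E (k+1) t x = KL_T E (t 0) (KL_f E k (Fin.tail t)) x := fun x => rfl
    constructor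
    · intro x
      rw [hstep]; unfold KL_T; rw [← mul_assoc, ← hind]
    set g : (Fin d → F) → ℝ := fun x => KL_f E k (Fin.tail t) x - mu ^ k * KL_ind E x with hg
    have hgE : ∀ x, g x = KL_ind E x * g x := by
      intro x
      simp only [hg]
      rw [mul_sub, ← h1 x]
      linear_combination mu ^ k * (-hind x)
    have hgs : ∑ x, KL_f E k (Fin.tail t) x = ∑ x, g x + mu ^ k * E.card := by
      simp only [hg]
      rw [Finset.sum_sub_distrib, ← Finset.mul_sum, hsum]; ring
    have hdec : ∀ x, KL_f E (k+1) t x - mu ^ (k+1) * KL_ind E x =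
        (KL_B E (t 0) (KL_f E k (Fin.tail t)) x) + ((∑ y, g y) / q) * KL_ind E x := by
      intro x
      rw [hstep, KL_T_eq q hq, hgs, hmu]
      ring
    have hn : KL_n2 (KL_f E k (Fin.tail t)) ≤ (mu + lam) ^ k * Real.sqrt E.card := by
      have h3 := KL_n2_add g (fun x => mu ^ k * KL_ind E x)
      rw [KL_n2_smul, KL_n2_ind, abs_of_nonneg (by positivity)] at h3
      have e : (fun x => g x + mu ^ k * KL_ind E x) = KL_f E k (Fin.tail t) := by
        funext x; simp [hg]
      rw [e] at h3
      linarith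
    simp only [hdec]
    refine (KL_n2_add _ _).trans ?_
    rw [KL_n2_smul, KL_n2_ind]
    have hB := KL_B_le q hq hF (t 0) (ht 0) E (KL_f E k (Fin.tail t))
    rw [← hlam] at hB
    have hS := KL_sum_le E g hgE
    have hq0 : (0:ℝ) ≤ q := by positivity
    have h5 : |(∑ y, g y) / (q:ℝ)| * Real.sqrt E.card ≤
        mu * (((mu + lam) ^ k - mu ^ k) * Real.sqrt E.card) := by
      rw [abs_div, abs_of_nonneg hq0]
      calc |∑ y, g y| / (q:ℝ) * Real.sqrt E.card
          ≤ (Real.sqrt E.card * KL_n2 g) / (q:ℝ) * Real.sqrt E.card :=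
            mul_le_mul_of_nonneg_right (div_le_div_of_nonneg_right hS hq0) (Real.sqrt_nonneg _)
        _ = (Real.sqrt E.card * Real.sqrt E.card) / q * KL_n2 g := by ring
        _ = mu * KL_n2 g := by rw [hsE, hmu]
        _ ≤ _ := by gcongr
    have h6 := mul_le_mul_of_nonneg_left hn hlam0
    calc _ ≤ lam * ((mu + lam) ^ k * Real.sqrt E.card) +
          mu * (((mu + lam) ^ k - mu ^ k) * Real.sqrt E.card) := by linarith
      _ = _ := by ring

theorem KL_chain_bound {F : Type} [Field F] [Fintype F] [DecidableEq F] {d : ℕ} (q : ℕ)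
    (hq : Fintype.card F = q) (hF : ringChar F ≠ 2)
    (E : Finset (Fin d → F)) (lam mu : ℝ) (hlam : lam = 2 * Real.sqrt q * Real.sqrt q ^ d / q)
    (hmu : mu = E.card / q) (k : ℕ) (t : Fin k → F) (ht : ∀ i, t i ≠ 0) :
    |(chainCountVec E t : ℝ) - mu ^ k * E.card| ≤ ((mu + lam) ^ k - mu ^ k) * E.card := by
  obtain ⟨h1, h2⟩ := KL_chain q hq hF E lam mu hlam hmu k t ht
  have hind : ∀ x, KL_ind E x = KL_ind E x * KL_ind E x := by
    intro x; unfold KL_ind; split_ifs <;> simp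
  have hsE : Real.sqrt E.card * Real.sqrt E.card = E.card := Real.mul_self_sqrt (Nat.cast_nonneg _)
  have hsum : ∑ x, KL_ind E x = (E.card : ℝ) := by unfold KL_ind; simp
  have h3 := KL_sum_le E (fun x => KL_f E k t x - mu ^ k * KL_ind E x) (by
    intro x
    rw [mul_sub, ← h1 x]
    linear_combination mu ^ k * (-hind x))
  rw [Finset.sum_sub_distrib, ← Finset.mul_sum, hsum, ← KL_count] at h3
  refine h3.trans ?_
  refine (mul_le_mul_of_nonneg_left h2 (Real.sqrt_nonneg _)).trans (le_of_eq ?_)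
  rw [mul_left_comm, hsE]

theorem KL_exp_bound (y : ℝ) (h0 : 0 ≤ y) (h1 : y ≤ Real.log 2) :
    Real.exp y - 1 ≤ y / Real.log 2 := by
  have hl : 0 < Real.log 2 := Real.log_pos (by norm_num)
  have hs : y / Real.log 2 ≤ 1 := (div_le_one hl).2 h1
  have := convexOn_exp.2 (Set.mem_univ 0) (Set.mem_univ (Real.log 2))
    (sub_nonneg.2 hs) (div_nonneg h0 hl.le) (by ring)
  simp only [smul_eq_mul, mul_zero, zero_add, Real.exp_zero, mul_one,
    Real.exp_log (by norm_num : (0:ℝ) < 2), div_mul_cancel₀ _ hl.ne'] at this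
  linarith

theorem KL_pow_bound (k : ℕ) (x : ℝ) (hx : 0 ≤ x) (h : k * x ≤ Real.log 2) :
    (1 + x) ^ k - 1 ≤ k * x / Real.log 2 := by
  refine le_trans ?_ (KL_exp_bound (k * x) (by positivity) h)
  have : (1 + x) ^ k ≤ Real.exp (k * x) := by
    rw [Real.exp_nat_mul]
    exact pow_le_pow_left₀ (by positivity) (by linarith [Real.add_one_le_exp x]) k
  linarith

theorem statement0 {F : Type} [Field F] [Fintype F] [DecidableEq F]
    (q : ℕ) (hq : Fintype.card F = q) (hodd : Odd q)
    (d : ℕ) (hd : 2 ≤ d) (k : ℕ)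
    (E : Finset (Fin d → F))
    (hE : (2 * (k : ℝ) / Real.log 2) * (q : ℝ) ^ (((d : ℝ) + 1) / 2) < (E.card : ℝ))
    (t : Fin k → F) (ht : ∀ i, t i ≠ 0) :
    ∃ D : ℝ,
      (chainCountVec E t : ℝ) = (E.card : ℝ) ^ (k + 1) / (q : ℝ) ^ k + D ∧
        |D| ≤ (2 * (k : ℝ) / Real.log 2) * (q : ℝ) ^ (((d : ℝ) + 1) / 2) *
          ((E.card : ℝ) ^ k / (q : ℝ) ^ k) := by
  have hF : ringChar F ≠ 2 := by
    intro h
    have := FiniteField.even_card_iff_char_two.1 h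
    rw [hq] at this
    have := Nat.odd_iff.1 hodd
    omega
  have hq1 : 0 < q := by rw [← hq]; exact Fintype.card_pos
  have hq0 : (0 : ℝ) < q := by exact_mod_cast hq1
  have hl : 0 < Real.log 2 := Real.log_pos (by norm_num)
  set Q : ℝ := (q : ℝ) ^ (((d : ℝ) + 1) / 2) with hQ
  have hQ0 : 0 < Q := Real.rpow_pos_of_pos hq0 _
  have hQs : Real.sqrt q * Real.sqrt q ^ d = Q := by
    rw [← pow_succ', Real.sqrt_eq_rpow, ← Real.rpow_natCast, ← Real.rpow_mul hq0.le, hQ]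
    congr 1; push_cast; ring
  have hE0 : (0 : ℝ) < E.card := lt_of_le_of_lt (by positivity) hE
  have hb := KL_chain_bound q hq hF E (2 * Real.sqrt q * Real.sqrt q ^ d / q) (E.card / q) rfl rfl
    k t ht
  rw [mul_assoc 2, hQs] at hb
  refine ⟨(chainCountVec E t : ℝ) - (E.card : ℝ) ^ (k + 1) / (q : ℝ) ^ k, by ring, ?_⟩
  have e1 : (E.card : ℝ) ^ (k + 1) / (q : ℝ) ^ k = ((E.card : ℝ) / q) ^ k * E.card := by
    rw [div_pow]; ring
  rw [e1]
  refine hb.trans ?_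
  set x : ℝ := 2 * Q / E.card with hx
  have hx0 : 0 ≤ x := by positivity
  have hkx : k * x ≤ Real.log 2 := by
    rw [hx, ← mul_div_assoc, div_le_iff₀ hE0]
    have := hE.le
    rw [div_mul_eq_mul_div, div_le_iff₀ hl] at this
    linarith
  have hp := KL_pow_bound k x hx0 hkx
  have e2 : (E.card : ℝ) / q + 2 * Q / q = (E.card / q) * (1 + x) := by
    rw [hx]; field_simp
  rw [e2, mul_pow]
  have e3 : (2 * (k : ℝ) / Real.log 2) * Q * ((E.card : ℝ) ^ k / (q : ℝ) ^ k) =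
      ((E.card : ℝ) / q) ^ k * (k * x / Real.log 2) * E.card := by
    rw [hx, div_pow]; field_simp
  rw [e3]
  calc (((E.card : ℝ) / q) ^ k * (1 + x) ^ k - ((E.card : ℝ) / q) ^ k) * (E.card:ℝ)
      = ((E.card : ℝ) / q) ^ k * ((1 + x) ^ k - 1) * E.card := by ring
    _ ≤ _ := by gcongr
end

section
/- Let q be an odd prime power, d ≥ 2, and E ⊆ 𝔽_q^d with |E| > (2k/ln 2)·q^{(d+1)/2}. Suppose t_1, …, t_k ∈ 𝔽_q are all nonzero and set t⃗ = (t_1,…,t_k). Then C_k(t⃗) > 0; that is, E contains a chain of k steps with the prescribed consecutive distances t_1, …, t_k. -/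
open Polynomial in
lemma kl_nonsq {L : Type} [Field L] {g r t : L[X]} (hg : g.Separable) (hdeg : g.degree ≠ 0)
    {c : L} (hc : c ≠ 0) (h : r ^ 2 = C c * g * t ^ 2) : t = 0 ∧ r = 0 := by
  have ht : t = 0 := by
    by_contra ht
    let Ω := AlgebraicClosure L
    let i := algebraMap L Ω
    have hg0 : g ≠ 0 := hg.ne_zero
    have hdeg' : (g.map i).degree ≠ 0 := by rwa [degree_map]
    obtain ⟨α, hα⟩ := IsAlgClosed.exists_root _ hdeg'
    have hgi : g.map i ≠ 0 := (Polynomial.map_ne_zero_iff i.injective).2 hg0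
    have hti : t.map i ≠ 0 := (Polynomial.map_ne_zero_iff i.injective).2 ht
    have hCi : C (i c) ≠ 0 := by simpa using hc
    have h1 : rootMultiplicity α (g.map i) = 1 := by
      have := rootMultiplicity_le_one_of_separable (hg.map (f := i)) α
      have := (rootMultiplicity_pos hgi).2 hα
      omega
    have h2 := congrArg (fun u => rootMultiplicity α (u.map i)) h
    simp only [Polynomial.map_pow, Polynomial.map_mul, Polynomial.map_C] at h2
    have hne : C (i c) * g.map i * (t.map i)^2 ≠ 0 := mul_ne_zero (mul_ne_zero hCi hgi) (pow_ne_zero _ hti)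
    have hri : r.map i ≠ 0 := by
      intro h0
      have h3 := congrArg (fun u => u.map i) h
      simp only [Polynomial.map_pow, Polynomial.map_mul, Polynomial.map_C, h0] at h3
      apply hne
      rw [← h3]; simp
    rw [rootMultiplicity_mul hne, rootMultiplicity_mul (mul_ne_zero hCi hgi), h1,
      pow_two, pow_two, rootMultiplicity_mul (mul_ne_zero hri hri),
      rootMultiplicity_mul (mul_ne_zero hti hti), rootMultiplicity_C] at h2
    omega
  refine ⟨ht, ?_⟩
  rw [ht] at h
  simpa using h

open Polynomial in
lemma kl_h_ne_zero {L : Type} [Field L] (p : ℕ) [Fact p.Prime] [CharP L p] (e : ℕ)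
    {g : L[X]} (hg : g.Separable) (hdeg : g.degree ≠ 0) (hg0 : g.eval 0 ≠ 0) (s J : ℕ)
    (hs : 2 * s = p ^ e + 1) (r t : ℕ → L[X])
    (hr : ∀ j, 2 * (r j).natDegree < p ^ e) (htd : ∀ j, g.natDegree + 2 * (t j).natDegree < p ^ e)
    (hne : ∃ j < J, ¬ (r j = 0 ∧ t j = 0)) :
    ∑ j ∈ Finset.range J, (r j + t j * g ^ s) * X ^ (j * p ^ e) ≠ 0 := by
  classical
  intro h0
  set P := p ^ e with hP
  let j0 := Nat.find hne
  obtain ⟨hj0, hn0⟩ := Nat.find_spec hne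
  have hmin : ∀ j < j0, r j = 0 ∧ t j = 0 := by
    intro j hj
    have := Nat.find_min hne hj
    by_contra hc
    exact this ⟨lt_trans hj hj0, hc⟩
  change j0 < J at hj0
  change ¬ (r j0 = 0 ∧ t j0 = 0) at hn0
  -- split
  have hdvd : X ^ P ∣ r j0 + t j0 * g ^ s := by
    have h1 : X ^ ((j0 + 1) * P) ∣ (r j0 + t j0 * g ^ s) * X ^ (j0 * P) := by
      have h2 := Finset.sum_erase_add (Finset.range J)
        (fun j => (r j + t j * g ^ s) * (X : L[X]) ^ (j * P)) (Finset.mem_range.2 hj0)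
      rw [h0] at h2
      have h3 : (r j0 + t j0 * g ^ s) * X ^ (j0 * P) =
        - ∑ j ∈ (Finset.range J).erase j0, (r j + t j * g ^ s) * X ^ (j * P) := by
        linear_combination h2
      rw [h3, dvd_neg]
      apply Finset.dvd_sum
      intro j hj
      rcases lt_trichotomy j j0 with hlt | heq | hgt
      · obtain ⟨h4, h5⟩ := hmin j hlt
        simp [h4, h5]
      · simp [heq] at hj
      · apply Dvd.dvd.mul_left
        apply pow_dvd_pow
        exact Nat.mul_le_mul_right _ hgt
    rw [add_mul, one_mul, pow_add, mul_comm (X ^ (j0 * P))] at h1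
    exact (mul_dvd_mul_iff_right (pow_ne_zero _ X_ne_zero)).1 h1
  set R := r j0
  set T := t j0
  have hX : X ^ P ∣ g ^ P - C (g.eval 0 ^ P) := by
    have h1 : (X : L[X]) ∣ g - C (g.eval 0) := by
      rw [X_dvd_iff]; simp [coeff_zero_eq_eval_zero]
    have h2 := pow_dvd_pow_of_dvd h1 P
    rw [hP, sub_pow_char_pow] at h2
    rw [C_pow]
    exact h2
  have hfin : X ^ P ∣ R ^ 2 - C (g.eval 0 ^ P) * g * T ^ 2 := by
    have h1 : R ^ 2 - C (g.eval 0 ^ P) * g * T ^ 2 =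
      (R + T * g ^ s) * (R - T * g ^ s) + (g ^ P - C (g.eval 0 ^ P)) * (g * T ^ 2) := by
      have : g ^ P * g = g ^ s * g ^ s := by
        rw [← pow_succ, ← pow_add]; congr 1; omega
      linear_combination (-T^2) * this
    rw [h1]
    exact dvd_add (Dvd.dvd.mul_right hdvd _) (Dvd.dvd.mul_right hX _)
  have hz : R ^ 2 - C (g.eval 0 ^ P) * g * T ^ 2 = 0 := by
    apply eq_zero_of_dvd_of_natDegree_lt hfin
    rw [natDegree_X_pow]
    apply lt_of_le_of_lt (natDegree_sub_le _ _)
    apply max_lt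
    · rw [natDegree_pow]; exact hr j0
    · refine lt_of_le_of_lt ?_ (htd j0)
      refine natDegree_mul_le.trans ?_
      rw [natDegree_pow]
      have := natDegree_C_mul_le (g.eval 0 ^ P) g
      change _ ≤ g.natDegree + 2 * T.natDegree
      omega
  have := kl_nonsq hg hdeg (pow_ne_zero P hg0) (sub_eq_zero.1 hz)
  exact hn0 ⟨this.2, this.1⟩

set_option maxHeartbeats 1000000 in
open Polynomial in
/-- the auxiliary polynomial of the Stepanov method. -/
lemma kl_stepanov {L : Type} [Field L] [Fintype L] [DecidableEq L] (p : ℕ) [Fact p.Prime]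
    [CharP L p] (hp : p ≠ 2) (e f : ℕ) (hf : f ≠ 0)
    (hcard : Fintype.card L = p ^ e * p ^ e) (hPq : 2 * p ^ f + 3 ≤ p ^ e)
    (a : L) (ha : a ≠ 0) :
    2 * (Finset.univ.filter (fun z : L =>
      quadraticChar L ((z ^ (p ^ f) - z) ^ 2 - 4 * a) = -1)).card
      ≤ p ^ e * p ^ e + 4 * p ^ f * p ^ e := by
  have hpp : p.Prime := Fact.out
  have hpodd : Odd p := hpp.odd_of_ne_two hp
  have h2 : (2 : L) ≠ 0 := by
    have : ringChar L ≠ 2 := by rwa [ringChar.eq L p]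
    exact Ring.two_ne_zero this
  set φ : L →+* L := iterateFrobenius L p e with hφ
  have hφφ : ∀ x, φ (φ x) = x := by
    intro x
    rw [hφ, iterateFrobenius_def, iterateFrobenius_def, ← pow_mul, ← hcard, FiniteField.pow_card]
  have hφP : ∀ x, φ x = x ^ (p ^ e) := fun x => iterateFrobenius_def p e x
  have hqodd : Odd (p ^ f) := hpodd.pow
  have hPodd : Odd (p ^ e) := hpodd.pow
  have hq0 : ((p ^ f : ℕ) : L) = 0 := by
    rw [Nat.cast_pow, CharP.cast_eq_zero, zero_pow hf]
  have hq1 : 1 < p ^ f := Nat.one_lt_pow hf hpp.one_lt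
  generalize hP : p ^ e = P at *
  generalize hq : p ^ f = q at *
  obtain ⟨w, hw⟩ := hPodd
  set u : L[X] := X ^ q - X with hu
  set g : L[X] := u ^ 2 - C (4 * a) with hgdef
  have hud : u.natDegree = q := by
    rw [hu]
    exact FiniteField.X_pow_card_sub_X_natDegree_eq L hq1
  have hgd : g.natDegree = 2 * q := by
    rw [hgdef, natDegree_sub_C, natDegree_pow, hud]
  have hgdeg : g.degree ≠ 0 := by
    intro h
    have := natDegree_eq_zero_iff_degree_le_zero.2 h.le
    omega
  have h4a : 4 * a ≠ 0 := by
    have : (4 : L) = 2 * 2 := by norm_num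
    rw [this]
    exact mul_ne_zero (mul_ne_zero h2 h2) ha
  have hder : derivative g = C (-2) * u := by
    have hu' : derivative u = -1 := by
      rw [hu, derivative_sub, derivative_X_pow, hq0]; simp
    rw [hgdef, derivative_sub, derivative_C, derivative_pow, hu']
    simp
  have hsep : g.Separable := by
    rw [separable_def', hder]
    refine ⟨C (-(4 * a)⁻¹), C (-(4 * a)⁻¹ * 2⁻¹) * u, ?_⟩
    rw [hgdef]
    have h5 : C (-(4 * a)⁻¹) * C (4 * a) = (-1 : L[X]) := by
      rw [← C_mul, neg_mul, inv_mul_cancel₀ h4a]; simp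
    have h6 : (C (-(4 * a)⁻¹ * 2⁻¹) : L[X]) * C (-2) = - C (-(4 * a)⁻¹) := by
      rw [← C_mul, ← C_neg]; congr 1; field_simp
    linear_combination (u^2) * h6 - h5
  have hg0 : g.eval 0 ≠ 0 := by
    have hq0' : q ≠ 0 := by omega
    simp only [hgdef, hu, eval_sub, eval_pow, eval_X, eval_C, zero_pow hq0']
    intro h
    apply h4a
    linear_combination -h
  have hge : ∀ z, g.eval z = (z ^ q - z) ^ 2 - 4 * a := by
    intro z; simp [hgdef, hu]
  set s := w + 1 with hs
  set B := w + 1 - q with hB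
  have hBq : B + q = w + 1 := by omega
  set J := w + 1 + q with hJ
  set D := P * w + q + J with hD
  set G : L[X] := g ^ s with hG
  have hGd : G.natDegree = 2 * q * s := by rw [hG, natDegree_pow, hgd]; ring
  -- linear system
  let Φ0 : (Fin J → (degreeLT L (w+1) × degreeLT L B)) →ₗ[L] L[X] :=
    { toFun := fun v => ∑ j, (expand L P (v j).1.1 - expand L P (v j).2.1 * G) * X ^ (j : ℕ)
      map_add' := by
        intro v v'
        rw [← Finset.sum_add_distrib]
        refine Finset.sum_congr rfl fun j _ => ?_
        simp only [Pi.add_apply, Prod.fst_add, Prod.snd_add, Submodule.coe_add, map_add]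
        ring
      map_smul' := by
        intro c v
        rw [RingHom.id_apply, Finset.smul_sum]
        refine Finset.sum_congr rfl fun j _ => ?_
        simp only [Pi.smul_apply, Prod.smul_fst, Prod.smul_snd, Submodule.coe_smul, map_mul, expand_C, smul_eq_C_mul]
        ring }
  have hΦ0 : ∀ v, Φ0 v ∈ degreeLT L D := by
    intro v
    simp only [Φ0, LinearMap.coe_mk, AddHom.coe_mk]
    refine Submodule.sum_mem _ fun j _ => ?_
    rw [mem_degreeLT]
    have hj := j.2
    have h1 : (v j).1.1.natDegree ≤ w := by
      have := (v j).1.2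
      rw [mem_degreeLT] at this
      by_cases h0 : (v j).1.1 = 0
      · simp [h0]
      · have := (natDegree_lt_iff_degree_lt h0).2 this
        omega
    have h2 : (v j).2.1 ≠ 0 → (v j).2.1.natDegree + q ≤ w := by
      intro h0
      have := (v j).2.2
      rw [mem_degreeLT] at this
      have := (natDegree_lt_iff_degree_lt h0).2 this
      omega
    refine lt_of_le_of_lt degree_le_natDegree ?_
    rw [Nat.cast_lt]
    refine lt_of_le_of_lt natDegree_mul_le ?_
    rw [natDegree_X_pow]
    have h3 : (expand L P (v j).1.1 - expand L P (v j).2.1 * G).natDegree ≤ P * w + q := by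
      refine (natDegree_sub_le _ _).trans (max_le ?_ ?_)
      · rw [natDegree_expand]
        nlinarith
      · by_cases h0 : (v j).2.1 = 0
        · simp [h0]
        · refine natDegree_mul_le.trans ?_
          rw [natDegree_expand, hGd]
          have := h2 h0
          have hPs : 2 * s = P + 1 := by omega
          have : 2 * q * s = q * (P + 1) := by rw [← hPs]; ring
          nlinarith
    omega
  have hker : ∃ v, v ≠ 0 ∧ Φ0 v = 0 := by
    let Φ := Φ0.codRestrict (degreeLT L D) hΦ0
    have : FiniteDimensional L (degreeLT L (w+1)) := (degreeLTEquiv L (w+1)).symm.finiteDimensional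
    have : FiniteDimensional L (degreeLT L B) := (degreeLTEquiv L B).symm.finiteDimensional
    have : FiniteDimensional L (degreeLT L D) := (degreeLTEquiv L D).symm.finiteDimensional
    have hfr : ∀ n, Module.finrank L (degreeLT L n) = n := by
      intro n
      rw [(degreeLTEquiv L n).finrank_eq]; simp
    have hlt : Module.finrank L (degreeLT L D) <
        Module.finrank L (Fin J → (degreeLT L (w+1) × degreeLT L B)) := by
      rw [Module.finrank_pi_fintype]
      simp only [Module.finrank_prod, hfr]
      rw [Finset.sum_const, Finset.card_univ, Fintype.card_fin, smul_eq_mul]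
      zify at *
      nlinarith
    have hk := LinearMap.ker_ne_bot_of_finrank_lt (f := Φ) hlt
    obtain ⟨v, hv, hv0⟩ := Submodule.exists_mem_ne_zero_of_ne_bot hk
    refine ⟨v, hv0, ?_⟩
    have := LinearMap.mem_ker.1 hv
    exact congrArg Subtype.val this
  obtain ⟨v, hv0, hv⟩ := hker
  let r : ℕ → L[X] := fun j => if h : j < J then ((v ⟨j, h⟩).1.1).map φ else 0
  let t : ℕ → L[X] := fun j => if h : j < J then ((v ⟨j, h⟩).2.1).map φ else 0
  have hrd : ∀ j, (r j).natDegree ≤ w := by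
    intro j
    by_cases hj : j < J
    · simp only [r, hj, dif_pos]
      rw [natDegree_map]
      have := (v ⟨j, hj⟩).1.2
      rw [mem_degreeLT] at this
      by_cases h0 : (v ⟨j, hj⟩).1.1 = 0
      · simp [h0]
      · have := (natDegree_lt_iff_degree_lt h0).2 this
        omega
    · simp [r, hj]
  have htd : ∀ j, (t j).natDegree + q ≤ w := by
    intro j
    by_cases hj : j < J
    · simp only [t, hj, dif_pos]
      rw [natDegree_map]
      have := (v ⟨j, hj⟩).2.2
      rw [mem_degreeLT] at this
      by_cases h0 : (v ⟨j, hj⟩).2.1 = 0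
      · simp [h0]; omega
      · have := (natDegree_lt_iff_degree_lt h0).2 this
        omega
    · simp [t, hj]; omega
  have hne : ∃ j < J, ¬ (r j = 0 ∧ t j = 0) := by
    by_contra hcon
    push Not at hcon
    apply hv0
    funext j
    obtain ⟨h1, h2⟩ := hcon j j.2
    simp only [r, t, j.2, dif_pos] at h1 h2
    rw [Polynomial.map_eq_zero] at h1 h2
    ext1
    · exact Subtype.ext h1
    · exact Subtype.ext h2
  have hh := kl_h_ne_zero p e hsep hgdeg hg0 s J (by omega) r t
    (fun j => by have := hrd j; omega) (fun j => by have := htd j; omega) hne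
  rw [hP] at hh
  set h : L[X] := ∑ j ∈ Finset.range J, (r j + t j * g ^ s) * X ^ (j * P) with hhdef
  have hroot : ∀ z : L, quadraticChar L ((z ^ q - z) ^ 2 - 4 * a) = -1 → h.eval z = 0 := by
    intro z hz
    have hφz : φ (h.eval z) = 0 := by
      have hGz : φ (G.eval z) = - G.eval z := by
        have h1 : (g.eval z) ^ (Fintype.card L / 2) = -1 := by
          have h3 : ringChar L ≠ 2 := by rwa [ringChar.eq L p]
          have := quadraticChar_eq_pow_of_char_ne_two' h3 (g.eval z)
          rw [← this, hge, hz]; simp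
        rw [hφP, hG, eval_pow, ← pow_mul]
        have h4 : s * P = Fintype.card L / 2 + s := by
          rw [hcard, hw, hs]
          have : (2 * w + 1) * (2 * w + 1) = 2 * (2 * w * w + 2 * w) + 1 := by ring
          rw [this]
          have : (2 * (2 * w * w + 2 * w) + 1) / 2 = 2 * w * w + 2 * w := by omega
          rw [this]; ring
        rw [h4, pow_add, h1]; ring
      have hev : ∀ ρ : L[X], φ ((ρ.map φ).eval z) = ρ.eval (φ z) := by
        intro ρ
        rw [← eval_map_apply, Polynomial.map_map]
        congr 1
        have : φ.comp φ = RingHom.id L := RingHom.ext hφφ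
        rw [this, Polynomial.map_id]
      have hzero : (Φ0 v).eval z = 0 := by rw [hv]; simp
      rw [← hzero]
      simp only [Φ0, LinearMap.coe_mk, AddHom.coe_mk, hhdef]
      rw [eval_finsetSum, eval_finsetSum, map_sum, Finset.sum_range]
      refine Finset.sum_congr rfl fun j _ => ?_
      simp only [r, t, j.2, dif_pos, eval_mul, eval_add, eval_sub, map_mul, map_add, expand_eval, eval_pow, eval_X, hev]
      have h5 : φ (z ^ ((j:ℕ) * P)) = z ^ (j:ℕ) := by
        rw [mul_comm, pow_mul, ← hφP, map_pow, hφφ]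
      have h6 := hGz
      rw [hG, eval_pow] at h6
      rw [h5, h6, hφP z, hG, eval_pow]
      ring
    simpa using hφz
  have hhd : h.natDegree ≤ w + P * q + (w + q) * P := by
    apply natDegree_sum_le_of_forall_le
    intro j hj
    rw [Finset.mem_range] at hj
    refine natDegree_mul_le.trans ?_
    rw [natDegree_X_pow]
    have h1 : (r j + t j * g ^ s).natDegree ≤ w + P * q := by
      refine (natDegree_add_le _ _).trans (max_le ?_ ?_)
      · have := hrd j
        exact this.trans (Nat.le_add_right _ _)
      · refine natDegree_mul_le.trans ?_
        rw [← hG, hGd]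
        have := htd j
        have hPs : 2 * s = P + 1 := by omega
        have : 2 * q * s = q * (P + 1) := by rw [← hPs]; ring
        nlinarith
    have h2 : j ≤ w + q := by omega
    have := Nat.mul_le_mul_right P h2
    omega
  have hcardle : (Finset.univ.filter (fun z : L =>
      quadraticChar L ((z ^ q - z) ^ 2 - 4 * a) = -1)).card ≤ h.natDegree := by
    have hsub : Finset.univ.filter (fun z : L =>
      quadraticChar L ((z ^ q - z) ^ 2 - 4 * a) = -1) ⊆ h.roots.toFinset := by
      intro z hz
      rw [Finset.mem_filter] at hz
      rw [Multiset.mem_toFinset, mem_roots hh]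
      exact hroot z hz.2
    exact (Finset.card_le_card hsub).trans ((Multiset.toFinset_card_le _).trans (card_roots' h))
  have : 2 * (w + P * q + (w + q) * P) ≤ P * P + 4 * q * P := by
    have h9 : P * P = 2 * (w * P) + P := by nth_rewrite 1 [hw]; ring
    linarith
  omega

/-- Kloosterman sum. -/
noncomputable def kloo {L : Type} [Field L] [Fintype L] [DecidableEq L]
    (Ψ : AddChar L ℂ) (a : L) : ℂ := ∑ x : L, if x ≠ 0 then Ψ (x + a / x) else 0

lemma kl_sum_sq {L : Type} [Field L] [Fintype L] [DecidableEq L] (h2 : ringChar L ≠ 2)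
    (f : L → ℂ) : ∑ v, f (v ^ 2) = ∑ w, f w * (1 + (quadraticChar L w : ℂ)) := by
  rw [← Finset.sum_fiberwise (s := Finset.univ) (g := fun v : L => v ^ 2)]
  refine Finset.sum_congr rfl fun w _ => ?_
  have h1 : ∀ v ∈ Finset.univ.filter (fun v : L => v ^ 2 = w), f (v ^ 2) = f w := by
    intro v hv
    rw [(Finset.mem_filter.1 hv).2]
  rw [Finset.sum_congr rfl h1, Finset.sum_const, nsmul_eq_mul, mul_comm]
  congr 1
  have := quadraticChar_card_sqrts h2 w
  have h3 : {x : L | x ^ 2 = w}.toFinset = Finset.univ.filter (fun v : L => v ^ 2 = w) := by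
    ext; simp
  rw [h3] at this
  have h4 : (((Finset.univ.filter (fun v : L => v ^ 2 = w)).card : ℤ) : ℂ) = ((quadraticChar L w + 1 : ℤ) : ℂ) := by
    rw [this]
  push_cast at h4
  rw [h4]; ring

lemma kl_sum_conj {L : Type} [Field L] [Fintype L] [DecidableEq L] (h2 : ringChar L ≠ 2)
    (f : L → ℂ) (a : L) (ha : a ≠ 0) :
    (∑ x : L, if x ≠ 0 then f (x + a / x) else 0) =
      ∑ s, f s * (1 + (quadraticChar L (s ^ 2 - 4 * a) : ℂ)) := by
  have h20 : (2 : L) ≠ 0 := Ring.two_ne_zero h2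
  rw [← Finset.sum_filter,
    ← Finset.sum_fiberwise (g := fun x : L => x + a / x)]
  refine Finset.sum_congr rfl fun w _ => ?_
  have h1 : ∀ v ∈ (Finset.univ.filter (fun x : L => x ≠ 0)).filter (fun v : L => v + a / v = w), f (v + a / v) = f w := by
    intro v hv
    rw [(Finset.mem_filter.1 hv).2]
  rw [Finset.sum_congr rfl h1, Finset.sum_const, nsmul_eq_mul, mul_comm]
  congr 1
  have := quadraticChar_card_sqrts h2 (w ^ 2 - 4 * a)
  have h3 : {x : L | x ^ 2 = w ^ 2 - 4 * a}.toFinset.card =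
      ((Finset.univ.filter (fun x : L => x ≠ 0)).filter (fun v : L => v + a / v = w)).card := by
    symm
    refine Finset.card_nbij' (fun x => 2 * x - w) (fun y => (y + w) / 2) ?_ ?_ ?_ ?_
    · intro x hx
      simp only [Finset.coe_filter, Finset.mem_filter, Finset.mem_univ, true_and, Set.mem_ofPred_eq] at hx
      simp only [Set.coe_toFinset, Set.mem_ofPred_eq]
      obtain ⟨hx0, hx1⟩ := hx
      field_simp at hx1
      linear_combination 4 * hx1
    · intro y hy
      simp only [Set.coe_toFinset, Set.mem_ofPred_eq] at hy
      simp only [Finset.coe_filter, Finset.mem_filter, Finset.mem_univ, true_and, Set.mem_ofPred_eq]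
      have h40 : (4 : L) ≠ 0 := by
        have : (4 : L) = 2 * 2 := by norm_num
        rw [this]; exact mul_ne_zero h20 h20
      have hx0 : y + w ≠ 0 := by
        intro h
        have h5 : y = - w := by linear_combination h
        rw [h5] at hy
        have : 4 * a = 0 := by linear_combination hy
        exact (mul_ne_zero h40 ha) this
      refine ⟨div_ne_zero hx0 h20, ?_⟩
      field_simp
      linear_combination hy
    · intro x _
      simp only
      field_simp
      ring
    · intro y _
      simp only
      field_simp
      ring
  rw [h3] at this
  have h4 := congrArg (fun z : ℤ => (z : ℂ)) this
  push_cast at h4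
  rw [h4]; ring

lemma kl_sum_both {L : Type} [Field L] [Fintype L] [DecidableEq L] (h2 : ringChar L ≠ 2)
    (f : L → ℂ) (δ : L) (hδ : ¬ IsSquare δ) :
    ∑ v, f (v ^ 2) + ∑ v, f (δ * v ^ 2) = 2 * ∑ w, f w := by
  have hδ0 : δ ≠ 0 := by rintro rfl; exact hδ (IsSquare.zero)
  rw [kl_sum_sq h2 f, kl_sum_sq h2 (fun w => f (δ * w))]
  have h1 : ∑ w, f (δ * w) * (1 + (quadraticChar L w : ℂ)) =
      ∑ w, f w * (1 - (quadraticChar L w : ℂ)) := by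
    rw [← Equiv.sum_comp (Equiv.mulLeft₀ δ hδ0) (fun w => f w * (1 - (quadraticChar L w : ℂ)))]
    refine Finset.sum_congr rfl fun w _ => ?_
    simp only [Equiv.mulLeft₀_apply, map_mul]
    rw [quadraticChar_neg_one_iff_not_isSquare.2 hδ]
    push_cast
    ring
  rw [h1, ← Finset.sum_add_distrib, Finset.mul_sum]
  refine Finset.sum_congr rfl fun w _ => ?_
  ring

lemma kl_double {L : Type} [Field L] [Fintype L] [DecidableEq L] (h2 : ringChar L ≠ 2)
    (δ : L) (hδ : ¬ IsSquare δ) (Ψ : AddChar L ℂ) (hΨ : Ψ.IsPrimitive) (a : L) (ha : a ≠ 0) :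
    kloo Ψ a ^ 2 + (∑ u, ∑ v, if u ^ 2 - δ * v ^ 2 ≠ 0 then
        Ψ (2 * u * (1 + a / (u ^ 2 - δ * v ^ 2))) else 0) = 2 * (Fintype.card L : ℂ) := by
  have h20 : (2 : L) ≠ 0 := Ring.two_ne_zero h2
  have hsq : kloo Ψ a ^ 2 = ∑ u, ∑ v, if u ^ 2 - v ^ 2 ≠ 0 then
        Ψ (2 * u * (1 + a / (u ^ 2 - v ^ 2))) else 0 := by
    let e : L × L ≃ L × L :=
      { toFun := fun z => (z.1 + z.2, z.1 - z.2)
        invFun := fun z => ((z.1 + z.2) / 2, (z.1 - z.2) / 2)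
        left_inv := by intro z; ext <;> simp <;> field_simp <;> ring
        right_inv := by intro z; ext <;> simp <;> field_simp <;> ring }
    rw [pow_two, kloo, Finset.sum_mul_sum, ← Finset.sum_product', ← Finset.sum_product',
      Finset.univ_product_univ, ← Equiv.sum_comp e]
    refine Finset.sum_congr rfl fun z _ => ?_
    obtain ⟨u, v⟩ := z
    simp only [e, Equiv.coe_fn_mk]
    have hf : u ^ 2 - v ^ 2 = (u + v) * (u - v) := by ring
    rw [hf]
    by_cases h1 : u + v = 0
    · simp [h1]
    by_cases h3 : u - v = 0
    · simp [h3]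
    rw [if_pos h1, if_pos h3, if_pos (mul_ne_zero h1 h3), ← AddChar.map_add_eq_mul]
    congr 1
    field_simp
    ring
  rw [hsq, ← Finset.sum_add_distrib]
  have h3 : ∀ u : L, ((∑ v, if u ^ 2 - v ^ 2 ≠ 0 then
        Ψ (2 * u * (1 + a / (u ^ 2 - v ^ 2))) else 0) + (∑ v, if u ^ 2 - δ * v ^ 2 ≠ 0 then
        Ψ (2 * u * (1 + a / (u ^ 2 - δ * v ^ 2))) else 0)) =
        2 * ∑ N, if N ≠ 0 then Ψ (u * (2 * (1 + a / N))) else 0 := by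
    intro u
    rw [kl_sum_both h2 (fun w => if u ^ 2 - w ≠ 0 then
        Ψ (2 * u * (1 + a / (u ^ 2 - w))) else 0) δ hδ]
    congr 1
    rw [← Equiv.sum_comp (Equiv.subLeft (u ^ 2))]
    refine Finset.sum_congr rfl fun w _ => ?_
    simp only [Equiv.subLeft_apply, sub_sub_cancel]
    congr 2
    ring
  rw [Finset.sum_congr rfl (fun u _ => h3 u), ← Finset.mul_sum, Finset.sum_comm]
  congr 1
  have h4 : ∀ N : L, (∑ u, if N ≠ 0 then Ψ (u * (2 * (1 + a / N))) else 0) =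
      if N = -a then (Fintype.card L : ℂ) else 0 := by
    intro N
    by_cases hN : N = 0
    · subst hN
      rw [if_neg (by rw [zero_eq_neg]; exact ha)]; simp
    · simp only [ne_eq, hN, not_false_eq_true, if_true]
      rw [AddChar.sum_mulShift _ hΨ]
      have : 2 * (1 + a / N) = 0 ↔ N = -a := by
        rw [mul_eq_zero, or_iff_right h20]
        constructor
        · intro h; field_simp at h; linear_combination h
        · rintro rfl; field_simp; ring
      simp only [this]
      split_ifs <;> simp
  rw [Finset.sum_congr rfl (fun u _ => h4 u)]
  simp

open Polynomial in
lemma kl_char_sum_lower {L : Type} [Field L] [Fintype L] [DecidableEq L] (p : ℕ) [Fact p.Prime]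
    [CharP L p] (hp : p ≠ 2) (e f : ℕ) (hf : f ≠ 0)
    (hcard : Fintype.card L = p ^ e * p ^ e) (hPq : 2 * p ^ f + 3 ≤ p ^ e)
    (a : L) (ha : a ≠ 0) :
    -(2 * (p ^ f : ℤ) + 4 * p ^ f * p ^ e) ≤
      ∑ z : L, quadraticChar L ((z ^ (p ^ f) - z) ^ 2 - 4 * a) := by
  have hst := kl_stepanov p hp e f hf hcard hPq a ha
  have hpp : p.Prime := Fact.out
  have hq1 : 1 < p ^ f := Nat.one_lt_pow hf hpp.one_lt
  have hzero : (Finset.univ.filter (fun z : L => (z ^ (p ^ f) - z) ^ 2 - 4 * a = 0)).card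
      ≤ 2 * p ^ f := by
    set g : L[X] := (X ^ (p ^ f) - X) ^ 2 - C (4 * a) with hg
    have hgd : g.natDegree = 2 * p ^ f := by
      rw [hg, natDegree_sub_C, natDegree_pow, FiniteField.X_pow_card_sub_X_natDegree_eq L hq1]
    have hg0 : g ≠ 0 := by
      intro h
      rw [h, natDegree_zero] at hgd
      omega
    have hsub : Finset.univ.filter (fun z : L => (z ^ (p ^ f) - z) ^ 2 - 4 * a = 0)
        ⊆ g.roots.toFinset := by
      intro z hz
      rw [Finset.mem_filter] at hz
      rw [Multiset.mem_toFinset, mem_roots hg0, IsRoot, ← hz.2]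
      simp [hg]
    rw [← hgd]
    exact (Finset.card_le_card hsub).trans ((Multiset.toFinset_card_le _).trans (card_roots' g))
  set G : L → L := fun z => (z ^ (p ^ f) - z) ^ 2 - 4 * a with hG
  have hpt : ∀ z, (1 : ℤ) - (if G z = 0 then 1 else 0) -
      2 * (if quadraticChar L (G z) = -1 then 1 else 0) ≤ quadraticChar L (G z) := by
    intro z
    by_cases h0 : G z = 0
    · simp [h0]
    · rcases quadraticChar_dichotomy h0 with h | h <;> simp [h, h0]
  have hsum := Finset.sum_le_sum (s := Finset.univ) (fun z _ => hpt z)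
  simp only [Finset.sum_sub_distrib, ← Finset.mul_sum, Finset.sum_boole] at hsum
  simp only [Finset.sum_const, Finset.card_univ, hcard, nsmul_eq_mul, mul_one] at hsum
  refine le_trans ?_ hsum
  zify at hst hzero
  push_cast at *
  linarith

lemma kl_fiber {F L : Type} [Field F] [Fintype F] [DecidableEq F] [Field L] [Fintype L]
    [DecidableEq L] (p : ℕ) [Fact p.Prime] [CharP L p] (f : ℕ) (hf : f ≠ 0)
    (hF : Fintype.card F = p ^ f) (T : L →+ F) (hT : Function.Surjective T)
    (hTq : ∀ z, T (z ^ (p ^ f)) = T z) (s : L) :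
    (Finset.univ.filter (fun z : L => z ^ (p ^ f) - z = s)).card = if T s = 0 then p ^ f else 0 := by
  classical
  have hpp : p.Prime := Fact.out
  have hq1 : 1 < p ^ f := Nat.one_lt_pow hf hpp.one_lt
  have hle : ∀ s : L, (Finset.univ.filter (fun z : L => z ^ (p ^ f) - z = s)).card
      ≤ if T s = 0 then p ^ f else 0 := by
    intro s
    split_ifs with h
    · open Polynomial in
      set g : L[X] := (X ^ (p ^ f) - X) - C s with hg
      have hgd : g.natDegree = p ^ f := by
        rw [hg, Polynomial.natDegree_sub_C, FiniteField.X_pow_card_sub_X_natDegree_eq L hq1]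
      have hg0 : g ≠ 0 := by
        intro h
        rw [h, Polynomial.natDegree_zero] at hgd
        omega
      have hsub : Finset.univ.filter (fun z : L => z ^ (p ^ f) - z = s)
          ⊆ g.roots.toFinset := by
        intro z hz
        rw [Finset.mem_filter] at hz
        rw [Multiset.mem_toFinset, Polynomial.mem_roots hg0, Polynomial.IsRoot]
        simp [hg, hz.2]
      refine le_trans ?_ hgd.le
      exact (Finset.card_le_card hsub).trans ((Multiset.toFinset_card_le _).trans (Polynomial.card_roots' g))
    · rw [Nat.le_zero, Finset.card_eq_zero, Finset.filter_eq_empty_iff]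
      intro z _ hz
      apply h
      rw [← hz, map_sub, hTq, sub_self]
  have hsum : ∑ s : L, (Finset.univ.filter (fun z : L => z ^ (p ^ f) - z = s)).card =
      ∑ s : L, if T s = 0 then p ^ f else 0 := by
    have h1 : ∑ s : L, (Finset.univ.filter (fun z : L => z ^ (p ^ f) - z = s)).card = Fintype.card L := by
      rw [← Finset.card_univ]
      exact (Finset.card_eq_sum_card_fiberwise (fun _ _ => Finset.mem_coe.2 (Finset.mem_univ _))).symm
    have h2 : ∑ c : F, (Finset.univ.filter (fun z : L => T z = c)).card = Fintype.card L := by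
      rw [← Finset.card_univ]
      exact (Finset.card_eq_sum_card_fiberwise (fun _ _ => Finset.mem_coe.2 (Finset.mem_univ _))).symm
    have h3 : ∀ c : F, (Finset.univ.filter (fun z : L => T z = c)).card =
        (Finset.univ.filter (fun z : L => T z = 0)).card := by
      intro c
      exact AddMonoidHom.card_fiber_eq_of_mem_range T (hT c) (hT 0)
    rw [h1, ← h2, Finset.sum_congr rfl (fun c _ => h3 c), Finset.sum_const, Finset.card_univ, hF,
      ← Finset.sum_filter, Finset.sum_const, smul_eq_mul, smul_eq_mul, mul_comm]
  exact (Finset.sum_eq_sum_iff_of_le (fun s _ => hle s)).1 hsum s (Finset.mem_univ _)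

lemma kl_total {F L : Type} [Field F] [Fintype F] [DecidableEq F] [Field L] [Fintype L]
    [DecidableEq L] (p : ℕ) [Fact p.Prime] [CharP L p] (hp : p ≠ 2) (f : ℕ) (hf : f ≠ 0)
    (hF : Fintype.card F = p ^ f) (T : L →+ F) (hT : Function.Surjective T)
    (hTq : ∀ z, T (z ^ (p ^ f)) = T z) (a : L) (ha : a ≠ 0)
    (ψ : AddChar F ℂ) (hψ : ψ.IsPrimitive) :
    ∑ c ∈ Finset.univ.erase (0 : F), kloo ((ψ.mulShift c).compAddMonoidHom T) a =
      1 + ((∑ z : L, quadraticChar L ((z ^ (p ^ f) - z) ^ 2 - 4 * a) : ℤ) : ℂ) := by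
  have h2 : ringChar L ≠ 2 := by rwa [ringChar.eq L p]
  have hJ : ∀ c : F, kloo ((ψ.mulShift c).compAddMonoidHom T) a =
      (∑ s, ψ (c * T s)) + ∑ s, ψ (c * T s) * (quadraticChar L (s ^ 2 - 4 * a) : ℂ) := by
    intro c
    rw [kloo, kl_sum_conj h2 _ a ha, ← Finset.sum_add_distrib]
    refine Finset.sum_congr rfl fun s _ => ?_
    simp only [AddChar.compAddMonoidHom_apply, AddChar.mulShift_apply]
    ring
  have hJ0 : ∑ s, ψ (0 * T s) * (quadraticChar L (s ^ 2 - 4 * a) : ℂ) = -1 := by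
    have h := kl_sum_conj h2 (fun _ => (1 : ℂ)) a ha
    simp only [one_mul, Finset.sum_add_distrib] at h
    simp only [zero_mul, AddChar.map_zero_eq_one, one_mul]
    have h3 : (∑ x : L, if x ≠ 0 then (1 : ℂ) else 0) = (∑ x : L, (1:ℂ)) - 1 := by
      have : ∀ x : L, (if x ≠ 0 then (1 : ℂ) else 0) = 1 - if x = 0 then 1 else 0 := by
        intro x; by_cases hx : x = 0 <;> simp [hx]
      rw [Finset.sum_congr rfl (fun x _ => this x), Finset.sum_sub_distrib]
      simp
    rw [h3] at h
    linear_combination -h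
  have hfree : ∀ c ∈ Finset.univ.erase (0 : F), ∑ s, ψ (c * T s) = 0 := by
    intro c hc
    have hc0 : c ≠ 0 := Finset.ne_of_mem_erase hc
    have h3 : (ψ.mulShift c).compAddMonoidHom T ≠ 1 := by
      intro h
      apply hψ hc0
      ext x
      obtain ⟨y, rfl⟩ := hT x
      exact DFunLike.congr_fun h y
    exact AddChar.sum_eq_zero_of_ne_one h3
  have hall : ∑ c : F, ∑ s, ψ (c * T s) * (quadraticChar L (s ^ 2 - 4 * a) : ℂ) =
      ((∑ z : L, quadraticChar L ((z ^ (p ^ f) - z) ^ 2 - 4 * a) : ℤ) : ℂ) := by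
    rw [Finset.sum_comm, ← Finset.sum_fiberwise (s := Finset.univ) (g := fun z : L => z ^ (p ^ f) - z)
      (f := fun z : L => quadraticChar L ((z ^ (p ^ f) - z) ^ 2 - 4 * a))]
    push_cast
    refine Finset.sum_congr rfl fun s _ => ?_
    rw [← Finset.sum_mul, AddChar.sum_mulShift _ hψ]
    have h1 : ∀ v ∈ Finset.univ.filter (fun z : L => z ^ (p ^ f) - z = s),
        (quadraticChar L ((v ^ (p ^ f) - v) ^ 2 - 4 * a) : ℂ) = (quadraticChar L (s ^ 2 - 4 * a) : ℂ) := by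
      intro v hv
      rw [(Finset.mem_filter.1 hv).2]
    rw [Finset.sum_congr rfl h1, Finset.sum_const, nsmul_eq_mul,
      kl_fiber p f hf hF T hT hTq s, hF]
  rw [Finset.sum_congr rfl (fun c _ => hJ c), Finset.sum_add_distrib, Finset.sum_congr rfl hfree,
    ← hall, ← Finset.add_sum_erase _ _ (Finset.mem_univ (0 : F)), hJ0]
  simp

/-- The sequence of Kloosterman sums in the tower of quadratic extensions. -/
noncomputable def klSeq (q : ℝ) : ℕ → ℝ → ℝ
  | 0, x => x
  | j + 1, x => 2 * q ^ (2 ^ j) - klSeq q j x ^ 2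

lemma kl_quadratic {L : Type} [Field L] [Fintype L] [DecidableEq L] (p : ℕ) [Fact p.Prime]
    [CharP L p] (hp : p ≠ 2) (f : ℕ) (a : L) (ha : a ≠ 0) :
    ∃ (M : Type) (_ : Field M) (_ : Fintype M) (_ : DecidableEq M) (_ : CharP M p)
      (b : M) (S : M →+ L), Fintype.card M = Fintype.card L ^ 2 ∧ b ≠ 0 ∧ Function.Surjective S ∧
      (∀ z, S (z ^ (p ^ f)) = S z ^ (p ^ f)) ∧
      ∀ Ψ : AddChar L ℂ, Ψ.IsPrimitive →
        kloo (Ψ.compAddMonoidHom S) b = 2 * (Fintype.card L : ℂ) - kloo Ψ a ^ 2 := by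
  classical
  have hpp : p.Prime := Fact.out
  have h2 : ringChar L ≠ 2 := by rwa [ringChar.eq L p]
  have h20 : (2 : L) ≠ 0 := Ring.two_ne_zero h2
  obtain ⟨δ, hδ⟩ := FiniteField.exists_nonsquare h2
  have : Fact (∀ r : L, r ^ 2 ≠ δ + 0 * r) := ⟨by
    intro r h
    apply hδ
    exact ⟨r, by rw [← pow_two, h]; ring⟩⟩
  let hM : Fintype (QuadraticAlgebra L δ 0) := Fintype.ofEquiv _ (QuadraticAlgebra.equivProd δ 0).symm
  have hch : CharP (QuadraticAlgebra L δ 0) p := charP_of_injective_algebraMap (algebraMap L (QuadraticAlgebra L δ 0)).injective p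
  let S : (QuadraticAlgebra L δ 0) →+ L := (QuadraticAlgebra.trace : (QuadraticAlgebra L δ 0) →ₗ[L] L).toAddMonoidHom
  have hS : ∀ z : (QuadraticAlgebra L δ 0), S z = 2 * z.re := by
    intro z
    change QuadraticAlgebra.trace z = _
    rw [QuadraticAlgebra.trace_def]; ring
  refine ⟨(QuadraticAlgebra L δ 0), inferInstance, hM, inferInstance, hch, algebraMap L (QuadraticAlgebra L δ 0) a, S, ?_, ?_, ?_, ?_, ?_⟩
  · rw [Fintype.card_congr (QuadraticAlgebra.equivProd δ 0), Fintype.card_prod, pow_two]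
  · exact (map_ne_zero_iff _ (algebraMap L (QuadraticAlgebra L δ 0)).injective).2 ha
  · intro x
    refine ⟨⟨x / 2, 0⟩, ?_⟩
    rw [hS]; field_simp
  · intro z
    have hodd : Odd (p ^ f) := (hpp.odd_of_ne_two hp).pow
    obtain ⟨k, hk⟩ := hodd
    have h2f : (2 : L) ^ (p ^ f) = 2 := by
      have : iterateFrobenius L p f 2 = 2 := map_ofNat _ 2
      rwa [iterateFrobenius_def] at this
    rw [hS, hS, mul_pow, h2f]
    congr 1
    have hz : z = algebraMap L (QuadraticAlgebra L δ 0) z.re + algebraMap L (QuadraticAlgebra L δ 0) z.im * QuadraticAlgebra.omega := by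
      ext <;> simp
    have hω : (QuadraticAlgebra.omega : (QuadraticAlgebra L δ 0)) ^ (p ^ f) = algebraMap L (QuadraticAlgebra L δ 0) (δ ^ k) * QuadraticAlgebra.omega := by
      have h3 : (QuadraticAlgebra.omega : (QuadraticAlgebra L δ 0)) ^ 2 = algebraMap L (QuadraticAlgebra L δ 0) δ := by
        ext <;> simp [pow_two]
      rw [hk, pow_succ, pow_mul, h3, map_pow]
    have h4 : z ^ (p ^ f) = algebraMap L (QuadraticAlgebra L δ 0) (z.re ^ (p ^ f)) +
        algebraMap L (QuadraticAlgebra L δ 0) (z.im ^ (p ^ f) * δ ^ k) * QuadraticAlgebra.omega := by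
      conv_lhs => rw [hz]
      rw [add_pow_char_pow, mul_pow, hω, map_pow]
      simp only [map_mul, map_pow]
      ring
    rw [h4, QuadraticAlgebra.re_add, QuadraticAlgebra.re_mul]
    have h6 : ∀ x : L, (algebraMap L (QuadraticAlgebra L δ 0) x).re = x := fun _ => rfl
    have h7 : ∀ x : L, (algebraMap L (QuadraticAlgebra L δ 0) x).im = 0 := fun _ => rfl
    rw [h6, h6, h7]
    simp
  · intro Ψ hΨ
    have hd := kl_double h2 δ hδ Ψ hΨ a ha
    rw [← hd, add_sub_cancel_left, kloo, ← Equiv.sum_comp (QuadraticAlgebra.equivProd δ 0).symm,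
      ← Finset.univ_product_univ, Finset.sum_product]
    refine Finset.sum_congr rfl fun u _ => Finset.sum_congr rfl fun v _ => ?_
    have hx : (QuadraticAlgebra.equivProd δ 0).symm (u, v) = (⟨u, v⟩ : (QuadraticAlgebra L δ 0)) := rfl
    rw [hx]
    have hn : QuadraticAlgebra.norm (⟨u, v⟩ : (QuadraticAlgebra L δ 0)) = u ^ 2 - δ * v ^ 2 := by
      rw [QuadraticAlgebra.norm_def]; ring
    have hiff : (⟨u, v⟩ : (QuadraticAlgebra L δ 0)) ≠ 0 ↔ u ^ 2 - δ * v ^ 2 ≠ 0 := by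
      rw [← hn, ne_eq, ne_eq, QuadraticAlgebra.norm_eq_zero_iff_eq_zero]
    by_cases h0 : u ^ 2 - δ * v ^ 2 = 0
    · rw [if_neg (by rw [hiff]; simpa using h0), if_neg (by simpa using h0)]
    · rw [if_pos (hiff.2 h0), if_pos h0, AddChar.compAddMonoidHom_apply, hS]
      congr 1
      have h5 : (algebraMap L (QuadraticAlgebra L δ 0) a / (⟨u, v⟩ : (QuadraticAlgebra L δ 0))) = (⟨a * u / (u ^ 2 - δ * v ^ 2), - a * v / (u ^ 2 - δ * v ^ 2)⟩ : (QuadraticAlgebra L δ 0)) := by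
        rw [div_eq_iff (hiff.2 h0)]
        ext
        · simp; field_simp; ring
        · simp; field_simp; ring
      rw [h5, QuadraticAlgebra.re_add]
      simp only
      ring

lemma kl_tower {F : Type} [Field F] [Fintype F] [DecidableEq F] (p : ℕ) [Fact p.Prime]
    [CharP F p] (hp : p ≠ 2) (f : ℕ) (hF : Fintype.card F = p ^ f) (a : F) (ha : a ≠ 0)
    (ψ : AddChar F ℂ) (hψ : ψ.IsPrimitive) (k0 : F → ℝ)
    (hk0 : ∀ c, kloo (ψ.mulShift c) a = (k0 c : ℂ)) (j : ℕ) :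
    ∃ (L : Type) (_ : Field L) (_ : Fintype L) (_ : DecidableEq L) (_ : CharP L p)
      (b : L) (T : L →+ F), Fintype.card L = p ^ (f * 2 ^ j) ∧ b ≠ 0 ∧ Function.Surjective T ∧
      (∀ z, T (z ^ (p ^ f)) = T z) ∧
      ∀ c ≠ 0, kloo ((ψ.mulShift c).compAddMonoidHom T) b =
        ((klSeq ((p : ℝ) ^ f) j (k0 c) : ℝ) : ℂ) := by
  induction j with
  | zero =>
    refine ⟨F, inferInstance, inferInstance, inferInstance, inferInstance, a, AddMonoidHom.id F,
      by simpa using hF, ha, Function.surjective_id, ?_, ?_⟩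
    · intro z
      rw [← hF]; simp [FiniteField.pow_card]
    · intro c _
      rw [klSeq, ← hk0 c]
      rfl
  | succ j ih =>
    obtain ⟨L, _, _, _, _, b, T, hcard, hb, hT, hTq, hK⟩ := ih
    obtain ⟨M, i1, i2, i3, i4, b', S, hcard', hb', hS, hSq, hK'⟩ := kl_quadratic p hp f b hb
    refine ⟨M, i1, i2, i3, i4, b', T.comp S, ?_, hb', hT.comp hS, ?_, ?_⟩
    · rw [hcard', hcard, ← pow_mul]; congr 1; ring
    · intro z
      simp only [AddMonoidHom.comp_apply]
      rw [hSq, hTq]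
    · intro c hc
      have hprim : ((ψ.mulShift c).compAddMonoidHom T).IsPrimitive := by
        apply AddChar.IsPrimitive.of_ne_one
        intro h
        apply hψ hc
        ext x
        obtain ⟨y, rfl⟩ := hT x
        exact DFunLike.congr_fun h y
      have h1 := hK' _ hprim
      have h2 : ((ψ.mulShift c).compAddMonoidHom T).compAddMonoidHom S =
        (ψ.mulShift c).compAddMonoidHom (T.comp S) := rfl
      rw [h2] at h1
      rw [h1, hK c hc, hcard, klSeq]
      push_cast
      rw [pow_mul]

lemma klSeq_le (q : ℝ) (j : ℕ) (x : ℝ) : klSeq q (j + 1) x ≤ 2 * q ^ (2 ^ j) := by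
  rw [klSeq]; nlinarith [sq_nonneg (klSeq q j x)]

lemma klSeq_growth (q : ℝ) (hq : 0 < q) (x ε : ℝ) (hε : 0 ≤ ε) (hx : x ^ 2 = (4 + ε) * q) (j : ℕ) :
    klSeq q (j + 1) x ≤ -((2 + 4 ^ j * ε) * q ^ (2 ^ j)) := by
  induction j with
  | zero => simp only [klSeq]; rw [hx]; simp; linarith
  | succ j ih =>
    rw [klSeq]
    have hQ : 0 < q ^ (2 ^ j) := by positivity
    have h1 : q ^ (2 ^ (j + 1)) = (q ^ (2 ^ j)) ^ 2 := by rw [← pow_mul, pow_succ 2 j]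
    rw [h1]
    have hu : 0 ≤ 4 ^ j * ε := by positivity
    rw [pow_succ (4 : ℝ) j]
    generalize q ^ (2 ^ j) = Q at *
    generalize klSeq q (j + 1) x = y at *
    have h3 : 4 ^ j * 4 * ε = 4 * (4 ^ j * ε) := by ring
    rw [h3]
    generalize (4 : ℝ) ^ j * ε = u at *
    have h2 : ((2 + u) * Q) ^ 2 ≤ y ^ 2 := by
      have : (2 + u) * Q ≤ -y := by linarith
      have h4 : 0 ≤ (2 + u) * Q := by positivity
      calc ((2 + u) * Q) ^ 2 ≤ (-y) ^ 2 := pow_le_pow_left₀ h4 this 2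
        _ = y ^ 2 := by ring
    nlinarith [mul_nonneg (sq_nonneg u) (sq_nonneg Q)]

lemma kloo_conj {L : Type} [Field L] [Fintype L] [DecidableEq L] (Ψ : AddChar L ℂ) (a : L) :
    (starRingEnd ℂ) (kloo Ψ a) = kloo Ψ a := by
  rw [kloo, map_sum, ← Equiv.sum_comp (Equiv.neg L)]
  refine Finset.sum_congr rfl fun x _ => ?_
  simp only [Equiv.neg_apply, ne_eq, neg_eq_zero]
  split_ifs with h
  · simp
  · rw [← AddChar.map_neg_eq_conj]
    congr 1
    rw [div_neg]; ring

lemma kl_weil {F : Type} [Field F] [Fintype F] [DecidableEq F] (h2 : ringChar F ≠ 2)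
    (ψ : AddChar F ℂ) (hψ : ψ.IsPrimitive) (a : F) (ha : a ≠ 0) :
    ‖kloo ψ a‖ ≤ 2 * √(Fintype.card F : ℝ) := by
  obtain ⟨f, hpp, hF⟩ := FiniteField.card F (ringChar F)
  set p := ringChar F with hpdef
  have : Fact p.Prime := ⟨hpp⟩
  have hf : (f : ℕ) ≠ 0 := f.pos.ne'
  generalize (f : ℕ) = f at hF hf
  let k0 : F → ℝ := fun c => (kloo (ψ.mulShift c) a).re
  have hk0 : ∀ c, kloo (ψ.mulShift c) a = (k0 c : ℂ) := by
    intro c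
    exact (Complex.conj_eq_iff_re.1 (kloo_conj _ a)).symm
  by_contra hcon
  push Not at hcon
  have hq3 : 3 ≤ p ^ f := by
    have : 3 ≤ p := by have := hpp.two_le; omega
    exact this.trans (Nat.le_self_pow hf p)
  set q : ℝ := (p : ℝ) ^ f with hqdef
  have hqc : (Fintype.card F : ℝ) = q := by rw [hF]; push_cast; rfl
  have hq3' : (3 : ℝ) ≤ q := by rw [hqdef]; exact_mod_cast hq3
  have hk1 : ‖kloo ψ a‖ = |k0 1| := by
    have := hk0 1
    rw [AddChar.mulShift_one] at this
    rw [this, Complex.norm_real, Real.norm_eq_abs]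
  rw [hk1, hqc] at hcon
  have hgt : 4 * q < k0 1 ^ 2 := by
    have h1 : (2 * √q) ^ 2 < |k0 1| ^ 2 := pow_lt_pow_left₀ hcon (by positivity) (by norm_num)
    rw [sq_abs, mul_pow, Real.sq_sqrt (by linarith)] at h1
    linarith
  obtain ⟨ε, hε⟩ : ∃ ε, ε = (k0 1 ^ 2 - 4 * q) / q := ⟨_, rfl⟩
  have hε0 : 0 < ε := by rw [hε]; apply div_pos <;> linarith
  have hx : k0 1 ^ 2 = (4 + ε) * q := by
    rw [hε]; field_simp; ring
  obtain ⟨n, hn⟩ := pow_unbounded_of_one_lt (8 * q / ε) (by norm_num : (1 : ℝ) < 4)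
  let j := n + 2
  have hj : 8 * q < 4 ^ j * ε := by
    rw [div_lt_iff₀ hε0] at hn
    have : (4 : ℝ) ^ n ≤ 4 ^ j := pow_le_pow_right₀ (by norm_num) (by omega)
    nlinarith
  obtain ⟨L, _, _, _, _, b, T, hcard, hb, hT, hTq, hK⟩ :=
    kl_tower p h2 f hF a ha ψ hψ k0 hk0 (j + 1)
  have hPn : (p : ℝ) ^ (f * 2 ^ j) = q ^ (2 ^ j) := by rw [pow_mul]
  have hPn' : p ^ (f * 2 ^ j) = (p ^ f) ^ (2 ^ j) := by rw [pow_mul]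
  have hPq : 2 * p ^ f + 3 ≤ p ^ (f * 2 ^ j) := by
    rw [hPn']
    have h4 : (p ^ f) ^ 4 ≤ (p ^ f) ^ (2 ^ j) := by
      apply Nat.pow_le_pow_right (by omega)
      calc 4 = 2 ^ 2 := by norm_num
        _ ≤ 2 ^ j := Nat.pow_le_pow_right (by norm_num) (by omega)
    generalize p ^ f = Q at *
    nlinarith [Nat.mul_le_mul hq3 hq3, Nat.pow_le_pow_left hq3 3, pow_succ Q 3]
  have hlow := kl_char_sum_lower (L := L) p h2 (f * 2 ^ j) f hf
    (by rw [hcard, ← pow_add]; congr 1; ring) hPq b hb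
  have htot := kl_total p h2 f hf hF T hT hTq b hb ψ hψ
  rw [Finset.sum_congr rfl fun c hc => hK c (Finset.ne_of_mem_erase hc)] at htot
  have htot' : ∑ c ∈ Finset.univ.erase (0 : F), klSeq q (j + 1) (k0 c) =
      1 + ((∑ z : L, quadraticChar L ((z ^ (p ^ f) - z) ^ 2 - 4 * b) : ℤ) : ℝ) := by
    apply Complex.ofReal_injective
    rw [Complex.ofReal_sum, htot]
    push_cast
    rfl
  have hlow' : -(2 * q + 4 * q * q ^ (2 ^ j)) ≤
      ((∑ z : L, quadraticChar L ((z ^ (p ^ f) - z) ^ 2 - 4 * b) : ℤ) : ℝ) := by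
    rw [← hPn, hqdef]
    exact_mod_cast hlow
  have hP1 : 1 ≤ q ^ (2 ^ j) := one_le_pow₀ (by linarith)
  have h1mem : (1 : F) ∈ Finset.univ.erase (0 : F) := by simp
  rw [← Finset.add_sum_erase _ _ h1mem] at htot'
  have hgr := klSeq_growth q (by linarith) (k0 1) ε hε0.le hx j
  have hup : ∑ c ∈ (Finset.univ.erase (0 : F)).erase 1, klSeq q (j + 1) (k0 c) ≤
      q * (2 * q ^ (2 ^ j)) := by
    refine (Finset.sum_le_card_nsmul _ _ _ fun c _ => klSeq_le q j (k0 c)).trans ?_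
    rw [nsmul_eq_mul]
    apply mul_le_mul_of_nonneg_right _ (by positivity)
    rw [← hqc]
    exact_mod_cast Finset.card_le_univ _
  generalize q ^ (2 ^ j) = P at *
  nlinarith [mul_pos (sub_pos.2 hj) (by linarith : 0 < P)]

lemma gs_norm {F : Type} [Field F] [Fintype F] [DecidableEq F] (h2 : ringChar F ≠ 2)
    (ψ : AddChar F ℂ) (hψ : ψ.IsPrimitive) :
    ‖∑ x : F, (quadraticChar F x : ℂ) * ψ x‖ = √(Fintype.card F : ℝ) := by
  let χ : MulChar F ℂ := (quadraticChar F).ringHomComp (Int.castRingHom ℂ)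
  have hχ : χ ≠ 1 := by
    obtain ⟨a, ha⟩ := quadraticChar_exists_neg_one h2
    intro h
    have h0 : a ≠ 0 := by rintro rfl; simp at ha
    have h1 : χ a = 1 := by rw [h]; exact MulChar.one_apply h0.isUnit
    have h3 : χ a = -1 := by
      change ((quadraticChar F a : ℤ) : ℂ) = -1
      rw [ha]; simp
    rw [h3] at h1; norm_num at h1
  have h1 : ∑ x : F, (quadraticChar F x : ℂ) * ψ x = gaussSum χ ψ := rfl
  have h3 := gaussSum_mul_gaussSum_eq_card hχ hψ
  rw [← star_gaussSum_eq, ← starRingEnd_apply, Complex.mul_conj'] at h3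
  rw [h1]
  have h4 : ‖gaussSum χ ψ‖ ^ 2 = (Fintype.card F : ℝ) := by exact_mod_cast h3
  rw [← h4, Real.sqrt_sq (norm_nonneg _)]

lemma salie_id {F : Type} [Field F] [Fintype F] [DecidableEq F] (h2 : ringChar F ≠ 2)
    (f : F → ℂ) (c : F) (hc : c ≠ 0) :
    (∑ x : F, if x ≠ 0 then (quadraticChar F x : ℂ) * f (x + c ^ 2 / x) else 0) =
      ∑ s, f s * ((quadraticChar F (s + 2 * c) : ℂ) + (quadraticChar F (s - 2 * c) : ℂ)) := by
  have h1 := kl_sum_sq h2 (fun x : F => if x ≠ 0 then f (x + c ^ 2 / x) else 0)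
  have h3 := kl_sum_conj h2 (fun s : F => f (s ^ 2 - 2 * c)) c hc
  have h4 := kl_sum_sq h2 (fun w : F => f (w - 2 * c) * (1 + (quadraticChar F (w - 4 * c) : ℂ)))
  have h5 := kl_sum_conj h2 f (c ^ 2) (pow_ne_zero 2 hc)
  have h6 : (∑ v : F, if v ^ 2 ≠ 0 then f (v ^ 2 + c ^ 2 / v ^ 2) else 0) =
      ∑ x : F, if x ≠ 0 then f ((x + c / x) ^ 2 - 2 * c) else 0 := by
    refine Finset.sum_congr rfl fun v _ => ?_
    by_cases hv : v = 0
    · simp [hv]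
    · rw [if_pos (pow_ne_zero 2 hv), if_pos hv]
      congr 1
      field_simp; ring
  rw [h6, h3] at h1
  rw [h4, ← Equiv.sum_comp (Equiv.addRight (2 * c))] at h1
  have h7 : (∑ x : F, (if x ≠ 0 then f (x + c ^ 2 / x) else 0) * (1 + (quadraticChar F x : ℂ))) =
      (∑ x : F, if x ≠ 0 then f (x + c ^ 2 / x) else 0) +
      ∑ x : F, if x ≠ 0 then (quadraticChar F x : ℂ) * f (x + c ^ 2 / x) else 0 := by
    rw [← Finset.sum_add_distrib]
    refine Finset.sum_congr rfl fun v _ => ?_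
    split_ifs <;> ring
  rw [h7, h5] at h1
  rw [← sub_eq_iff_eq_add', ← Finset.sum_sub_distrib] at h1
  rw [← h1]
  refine Finset.sum_congr rfl fun s _ => ?_
  simp only [Equiv.coe_addRight]
  have e1 : s + 2 * c - 2 * c = s := by ring
  have e2 : s + 2 * c - 4 * c = s - 2 * c := by ring
  have e3 : s ^ 2 - 4 * c ^ 2 = (s + 2 * c) * (s - 2 * c) := by ring
  rw [e1, e2, e3, map_mul]
  push_cast
  ring

lemma tw_bound_one {F : Type} [Field F] [Fintype F] [DecidableEq F] (h2 : ringChar F ≠ 2)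
    (ψ : AddChar F ℂ) (hψ : ψ.IsPrimitive) (d : ℕ) (b : F) :
    ‖∑ s : F, if s ≠ 0 then (quadraticChar F s : ℂ) ^ d * ψ (s + b / s) else 0‖ ≤
      2 * √(Fintype.card F : ℝ) := by
  have hq1 : (1 : ℝ) ≤ √(Fintype.card F : ℝ) := by
    rw [Real.one_le_sqrt]; exact_mod_cast Fintype.card_pos
  have hsq : ∀ s : F, s ≠ 0 → (quadraticChar F s : ℂ) ^ 2 = 1 := by
    intro s hs; exact_mod_cast quadraticChar_sq_one hs
  rcases Nat.even_or_odd' d with ⟨e, rfl | rfl⟩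
  · have h1 : (∑ s : F, if s ≠ 0 then (quadraticChar F s : ℂ) ^ (2 * e) * ψ (s + b / s) else 0) =
        kloo ψ b := by
      rw [kloo]
      refine Finset.sum_congr rfl fun s _ => ?_
      split_ifs with hs
      · rw [pow_mul, hsq s hs, one_pow, one_mul]
      · rfl
    rw [h1]
    by_cases hb : b = 0
    · subst hb
      have h3 : kloo ψ 0 = -1 := by
        have h4 := AddChar.sum_eq_zero_of_ne_one (ψ := ψ) (by
          have := hψ (one_ne_zero); rwa [AddChar.mulShift_one] at this)
        rw [← Finset.add_sum_erase _ _ (Finset.mem_univ (0 : F)), AddChar.map_zero_eq_one] at h4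
        rw [kloo, ← Finset.sum_filter, Finset.filter_ne']
        simp only [zero_div, add_zero]
        linear_combination h4
      rw [h3]; simp; linarith
    · exact kl_weil h2 ψ hψ b hb
  · have h1 : (∑ s : F, if s ≠ 0 then (quadraticChar F s : ℂ) ^ (2 * e + 1) * ψ (s + b / s) else 0) =
        ∑ s : F, if s ≠ 0 then (quadraticChar F s : ℂ) * ψ (s + b / s) else 0 := by
      refine Finset.sum_congr rfl fun s _ => ?_
      split_ifs with hs
      · rw [pow_succ, pow_mul, hsq s hs, one_pow, one_mul]
      · rfl
    rw [h1]
    by_cases hb : b = 0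
    · subst hb
      have h3 : (∑ s : F, if s ≠ 0 then (quadraticChar F s : ℂ) * ψ (s + 0 / s) else 0) =
          ∑ s : F, (quadraticChar F s : ℂ) * ψ s := by
        refine Finset.sum_congr rfl fun s _ => ?_
        by_cases hs : s = 0
        · simp [hs]
        · simp [hs]
      rw [h3, gs_norm h2 ψ hψ]; linarith
    · by_cases hsqb : IsSquare b
      · obtain ⟨c, rfl⟩ := hsqb
        have hc : c ≠ 0 := by rintro rfl; simp at hb
        rw [← pow_two, salie_id h2 ψ c hc]
        have h3 : ∀ u : F, ∑ s : F, ψ s * (quadraticChar F (s + u) : ℂ) =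
            ψ (-u) * ∑ s : F, (quadraticChar F s : ℂ) * ψ s := by
          intro u
          rw [← Equiv.sum_comp (Equiv.addRight u) (fun s => (quadraticChar F s : ℂ) * ψ s),
            Finset.mul_sum]
          refine Finset.sum_congr rfl fun s _ => ?_
          simp only [Equiv.coe_addRight]
          rw [AddChar.map_add_eq_mul, AddChar.map_neg_eq_inv]
          have : ψ u ≠ 0 := fun h => by
            have := AddChar.norm_apply ψ u
            rw [h] at this; simp at this
          field_simp
        simp only [mul_add, Finset.sum_add_distrib]
        have h4 := h3 (-(2 * c))
        simp only [← sub_eq_add_neg] at h4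
        rw [h3, h4]
        refine (norm_add_le _ _).trans ?_
        rw [norm_mul, norm_mul, gs_norm h2 ψ hψ, AddChar.norm_apply, AddChar.norm_apply]
        linarith
      · have hηb : (quadraticChar F b : ℂ) = -1 := by
          rw [quadraticChar_neg_one_iff_not_isSquare.2 hsqb]; simp
        have hinv : Function.Involutive (fun x : F => b / x) := by
          intro x
          by_cases hx : x = 0
          · simp [hx]
          · simp only; field_simp
        have h3 : (∑ s : F, if s ≠ 0 then (quadraticChar F s : ℂ) * ψ (s + b / s) else 0) =
            -∑ s : F, if s ≠ 0 then (quadraticChar F s : ℂ) * ψ (s + b / s) else 0 := by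
          conv_lhs => rw [← Equiv.sum_comp (hinv.toPerm (fun x : F => b / x))]
          rw [← Finset.sum_neg_distrib]
          refine Finset.sum_congr rfl fun s _ => ?_
          have e0 : (hinv.toPerm (fun x : F => b / x)) s = b / s := rfl
          rw [e0]
          by_cases hs : s = 0
          · simp [hs]
          · have hbs : b / s ≠ 0 := div_ne_zero hb hs
            rw [if_pos hbs, if_pos hs, ← neg_mul]
            have e1 : b / s + b / (b / s) = s + b / s := by field_simp; ring
            rw [e1]
            congr 1
            have e2 : (quadraticChar F (b / s) : ℂ) * (quadraticChar F s : ℂ) = -1 := by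
              rw [← hηb, ← Int.cast_mul, ← map_mul, div_mul_cancel₀ _ hs]
            have e3 := hsq s hs
            linear_combination (quadraticChar F s : ℂ) * e2 - (quadraticChar F (b / s) : ℂ) * e3
        have h4 : (∑ s : F, if s ≠ 0 then (quadraticChar F s : ℂ) * ψ (s + b / s) else 0) = 0 := by
          linear_combination h3 / 2
        rw [h4, norm_zero]; linarith

lemma tw_bound {F : Type} [Field F] [Fintype F] [DecidableEq F] (h2 : ringChar F ≠ 2)
    (ψ : AddChar F ℂ) (hψ : ψ.IsPrimitive) (d : ℕ) (A B : F) (hA : A ≠ 0) :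
    ‖∑ s : F, if s ≠ 0 then (quadraticChar F s : ℂ) ^ d * ψ (A * s + B / s) else 0‖ ≤
      2 * √(Fintype.card F : ℝ) := by
  have h := tw_bound_one h2 (ψ.mulShift A) (AddChar.IsPrimitive.of_ne_one (hψ hA)) d (B / A)
  have h1 : ∀ s : F, (ψ.mulShift A) (s + B / A / s) = ψ (A * s + B / s) := by
    intro s
    rw [AddChar.mulShift_apply]
    congr 1
    by_cases hs : s = 0
    · simp [hs]
    · field_simp
  simpa only [h1] using h

lemma addChar_sum {F : Type} [Field F] (ψ : AddChar F ℂ) {ι : Type} (s : Finset ι) (f : ι → F) :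
    ψ (∑ i ∈ s, f i) = ∏ i ∈ s, ψ (f i) := by
  classical
  induction s using Finset.induction_on with
  | empty => simp
  | insert a s ha ih => rw [Finset.sum_insert ha, Finset.prod_insert ha, AddChar.map_add_eq_mul, ih]

lemma gs_eq {F : Type} [Field F] [Fintype F] [DecidableEq F] (h2 : ringChar F ≠ 2)
    (ψ : AddChar F ℂ) (hψ : ψ.IsPrimitive) (c : F) (hc : c ≠ 0) :
    ∑ x : F, ψ (c * x ^ 2) = (quadraticChar F c : ℂ) * ∑ x : F, (quadraticChar F x : ℂ) * ψ x := by
  have h1 := kl_sum_sq h2 (fun x : F => ψ (c * x))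
  rw [h1]
  simp only [mul_add, mul_one, Finset.sum_add_distrib]
  have h3 : ∑ x : F, ψ (c * x) = 0 := by
    have := AddChar.sum_mulShift c hψ
    rw [if_neg hc] at this
    simpa [mul_comm] using this
  rw [h3, zero_add, ← Equiv.sum_comp (Equiv.mulLeft₀ c hc) (fun x => (quadraticChar F x : ℂ) * ψ x),
    Finset.mul_sum]
  refine Finset.sum_congr rfl fun s _ => ?_
  simp only [Equiv.mulLeft₀_apply, map_mul]
  have : (quadraticChar F c : ℂ) ^ 2 = 1 := by exact_mod_cast quadraticChar_sq_one hc
  push_cast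
  linear_combination (-(quadraticChar F s : ℂ) * ψ (c * s)) * this

lemma gs_sq {F : Type} [Field F] [Fintype F] [DecidableEq F] (h2 : ringChar F ≠ 2)
    (ψ : AddChar F ℂ) (hψ : ψ.IsPrimitive) :
    (quadraticChar F (-1) : ℂ) * (∑ x : F, (quadraticChar F x : ℂ) * ψ x) ^ 2 = Fintype.card F := by
  let χ : MulChar F ℂ := (quadraticChar F).ringHomComp (Int.castRingHom ℂ)
  have hχ : χ ≠ 1 := by
    obtain ⟨a, ha⟩ := quadraticChar_exists_neg_one h2
    intro h
    have h0 : a ≠ 0 := by rintro rfl; simp at ha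
    have h1 : χ a = 1 := by rw [h]; exact MulChar.one_apply h0.isUnit
    have h3 : χ a = -1 := by
      change ((quadraticChar F a : ℤ) : ℂ) = -1
      rw [ha]; simp
    rw [h3] at h1; norm_num at h1
  have h3 : gaussSum χ ψ ^ 2 = (quadraticChar F (-1) : ℂ) * Fintype.card F :=
    gaussSum_sq hχ ((quadraticChar_isQuadratic F).comp _) hψ
  have h1 : ∑ x : F, (quadraticChar F x : ℂ) * ψ x = gaussSum χ ψ := rfl
  rw [h1, h3, ← mul_assoc, ← pow_two]
  have : (quadraticChar F (-1) : ℂ) ^ 2 = 1 := by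
    exact_mod_cast quadraticChar_sq_one (by norm_num : (-1 : F) ≠ 0)
  rw [this, one_mul]

lemma fou_one {F : Type} [Field F] [Fintype F] [DecidableEq F] (h2 : ringChar F ≠ 2)
    (ψ : AddChar F ℂ) (hψ : ψ.IsPrimitive) (s : F) (hs : s ≠ 0) (z : F) :
    (Fintype.card F : ℂ) * ψ (s * z ^ 2) =
      (quadraticChar F s : ℂ) * (∑ x : F, (quadraticChar F x : ℂ) * ψ x) *
        ∑ m : F, ψ (m * z - m ^ 2 / (4 * s)) := by
  have h20 : (2 : F) ≠ 0 := Ring.two_ne_zero h2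
  have h40 : (4 : F) ≠ 0 := by
    have : (4 : F) = 2 * 2 := by norm_num
    rw [this]; exact mul_ne_zero h20 h20
  have hc : -1 / (4 * s) ≠ 0 := div_ne_zero (by norm_num) (mul_ne_zero h40 hs)
  have h1 : ∑ m : F, ψ (m * z - m ^ 2 / (4 * s)) = ψ (s * z ^ 2) *
      ∑ x : F, ψ ((-1 / (4 * s)) * x ^ 2) := by
    rw [← Equiv.sum_comp (Equiv.addRight (2 * s * z)), Finset.mul_sum]
    refine Finset.sum_congr rfl fun m _ => ?_
    rw [← AddChar.map_add_eq_mul]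
    congr 1
    simp only [Equiv.coe_addRight]
    field_simp
    ring
  rw [h1, gs_eq h2 ψ hψ _ hc]
  have h3 : (quadraticChar F (-1 / (4 * s)) : ℂ) * (quadraticChar F s : ℂ) =
      (quadraticChar F (-1) : ℂ) := by
    have h4 : (quadraticChar F (-1 / (4 * s) * s) : ℤ) * quadraticChar F (2 ^ 2) =
        quadraticChar F (-1) := by
      rw [← map_mul]; congr 1; field_simp; norm_num
    rw [quadraticChar_sq_one' h20, mul_one, map_mul] at h4
    exact_mod_cast h4
  have h5 := gs_sq h2 ψ hψ
  rw [← h3] at h5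
  rw [← h5]
  ring

lemma fou_d {F : Type} [Field F] [Fintype F] [DecidableEq F] (h2 : ringChar F ≠ 2)
    (ψ : AddChar F ℂ) (hψ : ψ.IsPrimitive) (s : F) (hs : s ≠ 0) (d : ℕ) (z : Fin d → F) :
    (Fintype.card F : ℂ) ^ d * ψ (s * ∑ j, z j ^ 2) =
      (quadraticChar F s : ℂ) ^ d * (∑ x : F, (quadraticChar F x : ℂ) * ψ x) ^ d *
        ∑ m : Fin d → F, ψ (∑ j, m j * z j - (∑ j, m j ^ 2) / (4 * s)) := by
  have h1 : ∑ m : Fin d → F, ψ (∑ j, m j * z j - (∑ j, m j ^ 2) / (4 * s)) =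
      ∏ j, ∑ m : F, ψ (m * z j - m ^ 2 / (4 * s)) := by
    rw [Finset.prod_univ_sum, Fintype.piFinset_univ]
    refine Finset.sum_congr rfl fun m _ => ?_
    rw [← addChar_sum]
    congr 1
    rw [Finset.sum_sub_distrib, Finset.sum_div]
  have h3 : ψ (s * ∑ j, z j ^ 2) = ∏ j, ψ (s * z j ^ 2) := by
    rw [← addChar_sum, Finset.mul_sum]
  have h4 : ∀ x : ℂ, x ^ d = ∏ _j : Fin d, x := by intro x; simp
  rw [h1, h3, h4, h4, h4, ← Finset.prod_mul_distrib, ← Finset.prod_mul_distrib,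
    ← Finset.prod_mul_distrib]
  exact Finset.prod_congr rfl fun j _ => fou_one h2 ψ hψ s hs (z j)

lemma orth_d {F : Type} [Field F] [Fintype F] [DecidableEq F]
    (ψ : AddChar F ℂ) (hψ : ψ.IsPrimitive) (d : ℕ) (z : Fin d → F) :
    ∑ m : Fin d → F, ψ (∑ j, m j * z j) = if z = 0 then (Fintype.card F : ℂ) ^ d else 0 := by
  have h1 : ∑ m : Fin d → F, ψ (∑ j, m j * z j) = ∏ j, ∑ m : F, ψ (m * z j) := by
    rw [Finset.prod_univ_sum, Fintype.piFinset_univ]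
    refine Finset.sum_congr rfl fun m _ => ?_
    rw [← addChar_sum]
  rw [h1]
  simp only [AddChar.sum_mulShift _ hψ]
  split_ifs with h
  · subst h; simp
  · obtain ⟨j, hj⟩ := Function.ne_iff.1 h
    apply Finset.prod_eq_zero (Finset.mem_univ j)
    simpa using hj

/-- Fourier transform of the indicator of a finite set. -/
noncomputable def fhat {F : Type} [Field F] [Fintype F] [DecidableEq F]
    (ψ : AddChar F ℂ) {d : ℕ} (A : Finset (Fin d → F)) (m : Fin d → F) : ℂ :=
  ∑ x ∈ A, ψ (∑ j, m j * x j)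

lemma parseval {F : Type} [Field F] [Fintype F] [DecidableEq F]
    (ψ : AddChar F ℂ) (hψ : ψ.IsPrimitive) {d : ℕ} (A : Finset (Fin d → F)) :
    ∑ m : Fin d → F, ‖fhat ψ A m‖ ^ 2 = (Fintype.card F : ℝ) ^ d * A.card := by
  apply Complex.ofReal_injective
  push_cast
  have h1 : ∀ m : Fin d → F, (‖fhat ψ A m‖ : ℂ) ^ 2 =
      ∑ x ∈ A, ∑ y ∈ A, ψ (∑ j, m j * (x - y) j) := by
    intro m
    rw [← Complex.mul_conj', fhat, map_sum, Finset.sum_mul_sum]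
    refine Finset.sum_congr rfl fun x _ => Finset.sum_congr rfl fun y _ => ?_
    rw [← AddChar.map_neg_eq_conj, ← AddChar.map_add_eq_mul]
    congr 1
    simp only [Pi.sub_apply, mul_sub, Finset.sum_sub_distrib]
    ring
  simp only [h1]
  rw [Finset.sum_comm]
  have h3 : ∀ x ∈ A, ∑ m : Fin d → F, ∑ y ∈ A, ψ (∑ j, m j * (x - y) j) =
      (Fintype.card F : ℂ) ^ d := by
    intro x hx
    rw [Finset.sum_comm]
    simp only [orth_d ψ hψ, sub_eq_zero]
    rw [Finset.sum_ite_eq, if_pos hx]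
  rw [Finset.sum_congr rfl h3]
  simp [mul_comm]

lemma mixing {F : Type} [Field F] [Fintype F] [DecidableEq F] (h2 : ringChar F ≠ 2)
    {d : ℕ} (A B : Finset (Fin d → F)) (t : F) (ht : t ≠ 0)
    (h : ∀ x ∈ A, ∀ y ∈ B, ∑ j, (x j - y j) ^ 2 ≠ t) :
    (A.card : ℝ) * B.card ≤ 4 * (Fintype.card F : ℝ) ^ (d + 1) := by
  obtain ⟨ψ, hψ⟩ : ∃ ψ : AddChar F ℂ, ψ.IsPrimitive := by
    obtain ⟨ψ, hψ⟩ := AddChar.exists_apply_ne_zero.2 (one_ne_zero : (1 : F) ≠ 0)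
    refine ⟨ψ, AddChar.IsPrimitive.of_ne_one fun h1 => hψ ?_⟩
    rw [h1]; rfl
  have h20 : (2 : F) ≠ 0 := Ring.two_ne_zero h2
  have h40 : (4 : F) ≠ 0 := by
    have : (4 : F) = 2 * 2 := by norm_num
    rw [this]; exact mul_ne_zero h20 h20
  set q : ℝ := (Fintype.card F : ℝ) with hq
  have hq0 : 0 < q := by rw [hq]; exact_mod_cast Fintype.card_pos
  set G : ℂ := ∑ x : F, (quadraticChar F x : ℂ) * ψ x with hG
  have hGn : ‖G‖ = √q := gs_norm h2 ψ hψ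
  let W : (Fin d → F) → ℂ := fun m => ∑ s : F, if s ≠ 0 then (quadraticChar F s : ℂ) ^ d *
    ψ ((-t) * s + (-(∑ j, m j ^ 2) / 4) / s) else 0
  have hW : ∀ m, ‖W m‖ ≤ 2 * √q := fun m => tw_bound h2 ψ hψ d (-t) _ (neg_ne_zero.2 ht)
  have key : ∀ x ∈ A, ∀ y ∈ B, (Fintype.card F : ℂ) ^ d =
      - (G ^ d * ∑ m, W m * (ψ (∑ j, m j * x j) * (starRingEnd ℂ) (ψ (∑ j, m j * y j)))) := by
    intro x hx y hy
    have h1 := AddChar.sum_mulShift (∑ j, (x j - y j) ^ 2 - t) hψ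
    rw [if_neg (sub_ne_zero.2 (h x hx y hy)),
      ← Finset.add_sum_erase _ _ (Finset.mem_univ (0 : F)), zero_mul, AddChar.map_zero_eq_one] at h1
    have h3 : (Fintype.card F : ℂ) ^ d * ∑ s ∈ Finset.univ.erase 0,
        ψ (s * (∑ j, (x j - y j) ^ 2 - t)) = G ^ d * ∑ m, W m *
          (ψ (∑ j, m j * x j) * (starRingEnd ℂ) (ψ (∑ j, m j * y j))) := by
      have h4 : ∀ m, W m * (ψ (∑ j, m j * x j) * (starRingEnd ℂ) (ψ (∑ j, m j * y j))) =
          ∑ s ∈ Finset.univ.erase (0 : F), (quadraticChar F s : ℂ) ^ d * ψ (-(s * t)) *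
            ψ (∑ j, m j * (x j - y j) - (∑ j, m j ^ 2) / (4 * s)) := by
        intro m
        simp only [W]
        rw [← Finset.sum_filter, Finset.filter_ne', Finset.sum_mul]
        refine Finset.sum_congr rfl fun s hs => ?_
        have hs0 := Finset.ne_of_mem_erase hs
        rw [← AddChar.map_neg_eq_conj, mul_assoc, mul_assoc, ← AddChar.map_add_eq_mul,
          ← AddChar.map_add_eq_mul, ← AddChar.map_add_eq_mul]
        congr 2
        simp only [mul_sub, Finset.sum_sub_distrib]
        field_simp
        ring
      simp only [h4]
      rw [Finset.sum_comm, Finset.mul_sum, Finset.mul_sum]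
      refine Finset.sum_congr rfl fun s hs => ?_
      have hs0 := Finset.ne_of_mem_erase hs
      have h5 := fou_d h2 ψ hψ s hs0 d (fun j => x j - y j)
      rw [mul_sub, sub_eq_add_neg, AddChar.map_add_eq_mul, ← mul_assoc, h5, ← Finset.mul_sum]
      ring
    linear_combination (Fintype.card F : ℂ) ^ d * h1 - h3
  have key2 : (Fintype.card F : ℂ) ^ d * (A.card * B.card) =
      - (G ^ d * ∑ m, W m * (fhat ψ A m * (starRingEnd ℂ) (fhat ψ B m))) := by
    have h1 : ∑ x ∈ A, ∑ y ∈ B, (Fintype.card F : ℂ) ^ d =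
        ∑ x ∈ A, ∑ y ∈ B, - (G ^ d * ∑ m, W m *
          (ψ (∑ j, m j * x j) * (starRingEnd ℂ) (ψ (∑ j, m j * y j)))) :=
      Finset.sum_congr rfl fun x hx => Finset.sum_congr rfl fun y hy => key x hx y hy
    simp only [Finset.sum_const, nsmul_eq_mul, Finset.sum_neg_distrib, ← Finset.mul_sum] at h1
    have h3 : ∑ x ∈ A, ∑ y ∈ B, ∑ m, W m *
          (ψ (∑ j, m j * x j) * (starRingEnd ℂ) (ψ (∑ j, m j * y j))) =
        ∑ m, W m * (fhat ψ A m * (starRingEnd ℂ) (fhat ψ B m)) := by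
      have h4 : ∀ m, W m * (fhat ψ A m * (starRingEnd ℂ) (fhat ψ B m)) =
          ∑ x ∈ A, ∑ y ∈ B, W m *
          (ψ (∑ j, m j * x j) * (starRingEnd ℂ) (ψ (∑ j, m j * y j))) := by
        intro m
        rw [fhat, fhat, map_sum, Finset.sum_mul_sum, Finset.mul_sum]
        simp only [Finset.mul_sum]
      simp only [h4]
      symm
      rw [Finset.sum_comm]
      refine Finset.sum_congr rfl fun x _ => ?_
      rw [Finset.sum_comm]
    rw [h3] at h1
    rw [← h1]; ring
  have key3 : q ^ d * (A.card * B.card) ≤ √q ^ d * (2 * √q * ∑ m, ‖fhat ψ A m‖ * ‖fhat ψ B m‖) := by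
    have h1 := congrArg norm key2
    rw [norm_neg, norm_mul, norm_mul, norm_mul, norm_pow, norm_pow, hGn] at h1
    simp only [Complex.norm_natCast] at h1
    rw [hq, h1, Finset.mul_sum]
    apply mul_le_mul_of_nonneg_left _ (by positivity)
    refine (norm_sum_le _ _).trans (Finset.sum_le_sum fun m _ => ?_)
    rw [norm_mul, norm_mul, RCLike.norm_conj]
    exact mul_le_mul_of_nonneg_right (hW m) (by positivity)
  have key4 : (∑ m, ‖fhat ψ A m‖ * ‖fhat ψ B m‖) ^ 2 ≤ (q ^ d * A.card) * (q ^ d * B.card) := by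
    rw [hq, ← parseval ψ hψ A, ← parseval ψ hψ B]
    exact Finset.sum_mul_sq_le_sq_mul_sq _ _ _
  set S := ∑ m, ‖fhat ψ A m‖ * ‖fhat ψ B m‖
  have key5 : (q ^ d * (A.card * B.card)) ^ 2 ≤
      4 * q ^ (d + 1) * ((q ^ d * A.card) * (q ^ d * B.card)) := by
    calc (q ^ d * (A.card * B.card)) ^ 2 ≤ (√q ^ d * (2 * √q * S)) ^ 2 :=
          pow_le_pow_left₀ (by positivity) key3 2
      _ = 4 * (√q ^ 2) ^ (d + 1) * S ^ 2 := by ring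
      _ = 4 * q ^ (d + 1) * S ^ 2 := by rw [Real.sq_sqrt hq0.le]
      _ ≤ _ := mul_le_mul_of_nonneg_left key4 (by positivity)
  by_cases hz : (A.card : ℝ) * B.card = 0
  · rw [hz]; positivity
  · have hpos : 0 < (A.card : ℝ) * B.card := lt_of_le_of_ne (by positivity) (Ne.symm hz)
    have hpos2 : 0 < (q ^ d) ^ 2 * ((A.card : ℝ) * B.card) := by positivity
    refine le_of_mul_le_mul_right ?_ hpos2
    calc _ = (q ^ d * (A.card * B.card : ℝ)) ^ 2 := by ring
      _ ≤ _ := key5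
      _ = _ := by ring

/-- `c` is a chain in `E` with step lengths `t`. -/
def IsChainIn {F : Type} [Field F] {d k : ℕ} (E : Finset (Fin d → F)) (t : Fin k → F)
    (c : Fin (k + 1) → (Fin d → F)) : Prop :=
  (∀ i, c i ∈ E) ∧ ∀ i : Fin k, ∑ j, (c i.castSucc j - c i.succ j) ^ 2 = t i

lemma chain_cons {F : Type} [Field F] {d k : ℕ} (E : Finset (Fin d → F)) (t : Fin (k + 1) → F)
    (c : Fin (k + 1) → (Fin d → F)) (hc : IsChainIn E (fun i => t i.succ) c) (x : Fin d → F)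
    (hx : x ∈ E) (hxc : ∑ j, (x j - c 0 j) ^ 2 = t 0) :
    IsChainIn E t (Fin.cons x c : Fin (k + 2) → (Fin d → F)) := by
  refine ⟨?_, ?_⟩
  · intro i
    refine Fin.cases ?_ (fun i => ?_) i
    · simpa using hx
    · simpa using hc.1 i
  · intro i
    refine Fin.cases ?_ (fun i => ?_) i
    · simpa using hxc
    · have := hc.2 i
      rw [← Fin.succ_castSucc]
      simpa using this

lemma chain_many {F : Type} [Field F] [Fintype F] [DecidableEq F] (h2 : ringChar F ≠ 2)
    {d : ℕ} (E : Finset (Fin d → F)) (μ : ℝ) (hμ : 0 < μ)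
    (hμ2 : μ ^ 2 = 4 * (Fintype.card F : ℝ) ^ (d + 1)) (hE : 2 * μ ≤ E.card)
    (k : ℕ) (t : Fin k → F) (ht : ∀ i, t i ≠ 0) :
    ∃ R : Finset (Fin d → F), μ ≤ R.card ∧ ∀ x ∈ R, ∃ c, IsChainIn E t c ∧ c 0 = x := by
  classical
  induction k with
  | zero =>
    refine ⟨E, by linarith, fun x hx => ⟨fun _ => x, ⟨fun _ => hx, fun i => i.elim0⟩, rfl⟩⟩
  | succ k ih =>
    obtain ⟨R', hR', hc'⟩ := ih (fun i => t i.succ) (fun i => ht _)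
    let P : (Fin d → F) → Prop := fun x => ∃ y ∈ R', ∑ j, (x j - y j) ^ 2 = t 0
    refine ⟨E.filter P, ?_, ?_⟩
    · have hmix := mixing h2 (E.filter (fun x => ¬ P x)) R' (t 0) (ht 0) (by
        intro x hx y hy hxy
        exact (Finset.mem_filter.1 hx).2 ⟨y, hy, hxy⟩)
      rw [← hμ2] at hmix
      have hcard := Finset.card_filter_add_card_filter_not (s := E) P
      have hcard' : ((E.filter P).card : ℝ) + (E.filter (fun x => ¬ P x)).card = E.card := by
        exact_mod_cast hcard
      have h3 : ((E.filter (fun x => ¬ P x)).card : ℝ) ≤ μ := by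
        refine le_of_mul_le_mul_right ?_ hμ
        have h0 : (0 : ℝ) ≤ (E.filter (fun x => ¬ P x)).card := by positivity
        nlinarith
      linarith
    · intro x hx
      obtain ⟨hxE, y, hy, hxy⟩ := Finset.mem_filter.1 hx
      obtain ⟨c, hc, rfl⟩ := hc' y hy
      exact ⟨_, chain_cons E t c hc x hxE hxy, rfl⟩

theorem statement1 {F : Type} [Field F] [Fintype F] [DecidableEq F]
    (q : ℕ) (hq : Fintype.card F = q) (hodd : Odd q)
    (d : ℕ) (hd : 2 ≤ d) (k : ℕ)
    (E : Finset (Fin d → F))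
    (hE : (2 * (k : ℝ) / Real.log 2) * (q : ℝ) ^ (((d : ℝ) + 1) / 2) < (E.card : ℝ))
    (t : Fin k → F) (ht : ∀ i, t i ≠ 0) :
    0 < chainCountVec E t := by
  have h2 : ringChar F ≠ 2 := by
    intro h
    have h1 := (FiniteField.even_card_iff_char_two (F := F)).1 h
    rw [hq] at h1
    rw [Nat.odd_iff] at hodd
    omega
  suffices hs : ∃ c, IsChainIn E t c by
    obtain ⟨c, hc⟩ := hs
    rw [chainCountVec, Finset.card_pos]
    exact ⟨c, Finset.mem_filter.2 ⟨Finset.mem_univ _, hc⟩⟩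
  have hq0 : (0 : ℝ) < q := by rw [← hq]; exact_mod_cast Fintype.card_pos
  set Q : ℝ := (q : ℝ) ^ (((d : ℝ) + 1) / 2) with hQ
  have hQ0 : 0 < Q := Real.rpow_pos_of_pos hq0 _
  have hQ2 : Q ^ 2 = (q : ℝ) ^ (d + 1) := by
    rw [hQ, ← Real.rpow_natCast, ← Real.rpow_mul hq0.le, ← Real.rpow_natCast]
    congr 1
    push_cast
    ring
  have hlog0 : 0 < Real.log 2 := Real.log_pos (by norm_num)
  have hlog1 : Real.log 2 < 1 := by have := Real.log_two_lt_d9; linarith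
  have hkE : 2 * (k : ℝ) * Q < E.card := by
    refine lt_of_le_of_lt ?_ hE
    apply mul_le_mul_of_nonneg_right _ hQ0.le
    rw [le_div_iff₀ hlog0]
    have : (0 : ℝ) ≤ 2 * k := by positivity
    nlinarith
  have hμ2 : (2 * Q) ^ 2 = 4 * (Fintype.card F : ℝ) ^ (d + 1) := by
    rw [mul_pow, hQ2, hq]; norm_num
  rcases Nat.lt_or_ge k 2 with hk | hk
  · have hEne : E.Nonempty := by
      rw [← Finset.card_pos]
      have : (0 : ℝ) < E.card := lt_of_le_of_lt (by positivity) hkE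
      exact_mod_cast this
    interval_cases k
    · obtain ⟨x, hx⟩ := hEne
      exact ⟨fun _ => x, fun _ => hx, fun i => i.elim0⟩
    · by_contra hno
      have hmix := mixing h2 E E (t 0) (ht 0) (by
        intro x hx y hy hxy
        exact hno ⟨_, chain_cons E t (fun _ => y) ⟨fun _ => hy, fun i => i.elim0⟩ x hx hxy⟩)
      rw [← hμ2] at hmix
      simp only [Nat.cast_one, mul_one] at hkE
      nlinarith
  · have hk' : (2 : ℝ) ≤ k := by exact_mod_cast hk
    obtain ⟨R, hR, hc⟩ := chain_many h2 E (2 * Q) (by positivity) hμ2 (by nlinarith) k t ht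
    have hRne : R.Nonempty := by
      rw [← Finset.card_pos]
      have : (0 : ℝ) < R.card := lt_of_lt_of_le (by positivity) hR
      exact_mod_cast this
    obtain ⟨x, hx⟩ := hRne
    obtain ⟨c, hc, _⟩ := hc x hx
    exact ⟨c, hc⟩
end
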